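/- Let n ≥ 2. There exist positive constants C₄ ≤ 1, h_c ≤ 1/5 and C′ depending only on n such that the following holds. Let L > 0 and let u be strictly convex and C² on the closure of the section S := S(u, L) = {z : u(z) < u(0) + L}, with B₁(ξ) ⊆ S ⊆ B_n(ξ) for some ξ ∈ ℝⁿ, D u(0) = 0, u = 0 on ∂S, and (det D²u)^{1/n} = g in S with g(0) = 1 and δ := sup_S |g − 1| ≤ n^{−2}/5. Let w be convex, smooth in S and continuous on S̄, with det D²w = 1 in S and w = 0 on ∂S. Suppose 0 < h ≤ h_c and δ ≤ min{C₄ h, n^{−2}/5}. Then S(u, h) ⊆ S(u, L/2), and, with the linear map T x := h^{−1/2} (D²w(0))^{1/2} x (where (D²w(0))^{1/2} is the positive-definite square root), there exist radii r₋, r₊ such that B₁ ⊆ B_{r₋} ⊆ T S(u, h) ⊆ B_{r₊} ⊆ B₂ and |r₋²/2 − 1| ≤ C′(δ/h + h^{1/2}) and |r₊²/2 − 1| ≤ C′(δ/h + h^{1/2}). -/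

import Mathlib

open scoped RealInnerProductSpace
noncomputable section

abbrev Euc (n : ℕ) := EuclideanSpace ℝ (Fin n)

/-- Hessian matrix of `u` at `x`. -/
def hessianMatrix {n : ℕ} (u : Euc n → ℝ) (x : Euc n) : Matrix (Fin n) (Fin n) ℝ :=
  Matrix.of fun i j =>
    iteratedFDeriv ℝ 2 u x ![EuclideanSpace.single i 1, EuclideanSpace.single j 1]

/-- Determinant of the Hessian of `u` at `x`. -/
def hessDet {n : ℕ} (u : Euc n → ℝ) (x : Euc n) : ℝ := (hessianMatrix u x).det

section QuasiNorm
open Filter Topology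
open scoped ContDiff

section Part1
/-- Gram matrix of a bilinear form on a family. -/
def gramM {n : ℕ} (B : Euc n →L[ℝ] Euc n →L[ℝ] ℝ) (e : Fin n → Euc n) : Matrix (Fin n) (Fin n) ℝ :=
  Matrix.of fun a b => B (e a) (e b)

def stdB {n : ℕ} (i : Fin n) : Euc n := EuclideanSpace.single i 1

def colM {n : ℕ} (e : Fin n → Euc n) : Matrix (Fin n) (Fin n) ℝ := Matrix.of fun i a => (e a) i

lemma sum_stdB {n : ℕ} (x : Euc n) : x = ∑ i, x i • stdB i := by
  ext j
  simp [stdB, Finset.sum_apply, Pi.single_apply]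

lemma bil_expand {n : ℕ} (B : Euc n →L[ℝ] Euc n →L[ℝ] ℝ) (x y : Euc n) :
    B x y = ∑ i, ∑ j, x i * B (stdB i) (stdB j) * y j := by
  conv_lhs => rw [sum_stdB x, sum_stdB y]
  simp only [map_sum, sum_apply, map_smul, smul_apply,
    smul_eq_mul, Finset.mul_sum]
  rw [Finset.sum_comm]
  refine Finset.sum_congr rfl fun i _ => Finset.sum_congr rfl fun j _ => by ring

lemma gramM_eq {n : ℕ} (B : Euc n →L[ℝ] Euc n →L[ℝ] ℝ) (e : Fin n → Euc n) :
    gramM B e = (colM e).transpose * gramM B stdB * colM e := by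
  ext a b
  simp only [gramM, Matrix.of_apply, Matrix.mul_apply, Matrix.transpose_apply, colM]
  rw [bil_expand, Finset.sum_comm]
  refine Finset.sum_congr rfl fun i _ => ?_
  rw [Finset.sum_mul]

lemma gramM_det {n : ℕ} (B : Euc n →L[ℝ] Euc n →L[ℝ] ℝ) (e : Fin n → Euc n) :
    (gramM B e).det = (gramM B stdB).det * (colM e).det ^ 2 := by
  rw [gramM_eq, Matrix.det_mul, Matrix.det_mul, Matrix.det_transpose]; ring

lemma gramM_psd {n : ℕ} (B : Euc n →L[ℝ] Euc n →L[ℝ] ℝ) (hs : ∀ x y, B x y = B y x)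
    (hp : ∀ x, 0 ≤ B x x) (e : Fin n → Euc n) : (gramM B e).PosSemidef := by
  apply Matrix.PosSemidef.of_dotProduct_mulVec_nonneg
  · ext a b; simp [gramM, hs (e a) (e b)]
  · intro x
    have : star x ⬝ᵥ (gramM B e).mulVec x = B (∑ a, x a • e a) (∑ a, x a • e a) := by
      simp only [map_sum, sum_apply, map_smul, smul_apply,
        smul_eq_mul, dotProduct, Matrix.mulVec, gramM, Matrix.of_apply, star_trivial, Finset.mul_sum]
      rw [Finset.sum_comm]
      refine Finset.sum_congr rfl fun i _ => Finset.sum_congr rfl fun j _ => by ring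
    rw [this]; exact hp _

lemma psd_amgm {n : ℕ} (hn : 0 < n) (M : Matrix (Fin n) (Fin n) ℝ) (hM : M.PosSemidef) (c : ℝ)
    (hc : 0 ≤ c) (hd : c ^ n ≤ M.det) : n * c ≤ M.trace := by
  have h1 := hM.1.det_eq_prod_eigenvalues
  have h2 := hM.1.trace_eq_sum_eigenvalues
  simp only [RCLike.ofReal_real_eq_id, id] at h1 h2
  have hnn : (0:ℝ) < n := by exact_mod_cast hn
  have h4 := Real.geom_mean_le_arith_mean_weighted (Finset.univ) (fun _ : Fin n => (1 / n : ℝ))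
    hM.1.eigenvalues (fun _ _ => by positivity) (by simp; field_simp)
    (fun i _ => hM.eigenvalues_nonneg i)
  rw [Real.finset_prod_rpow _ _ (fun i _ => hM.eigenvalues_nonneg i), ← h1, ← Finset.mul_sum, ← h2] at h4
  have h5 : c ≤ M.det ^ (1 / n : ℝ) := by
    calc c = (c ^ n) ^ (1 / n : ℝ) := by
          rw [one_div, Real.pow_rpow_inv_natCast hc hn.ne']
      _ ≤ _ := Real.rpow_le_rpow (by positivity) hd (by positivity)
  have h6 := h5.trans h4
  rw [one_div, inv_mul_eq_div, le_div_iff₀ hnn] at h6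
  linarith

lemma exists_onb {n : ℕ} (B : Euc n →L[ℝ] Euc n →L[ℝ] ℝ) (hs : ∀ x y, B x y = B y x)
    (hp : ∀ x, 0 ≤ B x x) (hd : (gramM B stdB).det ≠ 0) :
    ∃ e : Fin n → Euc n, (∀ a b, B (e a) (e b) = if a = b then 1 else 0) ∧
      (∀ v, v = ∑ a, B v (e a) • e a) ∧ (gramM B stdB).det * (colM e).det ^ 2 = 1 := by
  have hpd : (gramM B stdB).PosDef := ((gramM_psd B hs hp stdB).posDef_iff_det_ne_zero).2 hd
  set M := gramM B stdB with hMdef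
  obtain ⟨N, hN⟩ : ∃ N : Matrix (Fin n) (Fin n) ℝ, M = N.transpose * N := by
    open scoped MatrixOrder in
    have := CStarAlgebra.nonneg_iff_eq_star_mul_self.1 hpd.posSemidef.nonneg
    obtain ⟨N, hN⟩ := this
    exact ⟨N, by rw [hN]; rfl⟩
  have hNd : IsUnit N.det := by
    rw [isUnit_iff_ne_zero]; intro h
    apply hd; rw [hN, Matrix.det_mul, h, mul_zero]
  let e : Fin n → Euc n := fun a => WithLp.toLp 2 (fun i => (N⁻¹) i a)
  have hE : colM e = N⁻¹ := by ext i a; simp [colM, e]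
  have hg : gramM B e = 1 := by
    rw [gramM_eq, hE, ← hMdef, hN, Matrix.transpose_nonsing_inv]
    have h1 : N * N⁻¹ = 1 := Matrix.mul_nonsing_inv _ hNd
    have h2 : N.transpose⁻¹ * N.transpose = 1 := Matrix.nonsing_inv_mul _ (by rwa [Matrix.det_transpose])
    rw [Matrix.mul_assoc, Matrix.mul_assoc, h1, Matrix.mul_one, h2]
  have hab : ∀ a b, B (e a) (e b) = if a = b then 1 else 0 := by
    intro a b
    have := congrFun (congrFun hg a) b
    simpa [gramM, Matrix.one_apply] using this
  refine ⟨e, hab, ?_, ?_⟩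
  · intro v
    -- write v as combination
    have h1 : N⁻¹ * N = 1 := Matrix.nonsing_inv_mul _ hNd
    have hv : v = ∑ a, (N.mulVec v) a • e a := by
      ext i
      have : (N⁻¹.mulVec (N.mulVec v)) i = v i := by rw [Matrix.mulVec_mulVec, h1, Matrix.one_mulVec]
      rw [← this]
      simp [Matrix.mulVec, dotProduct, e, mul_comm]
    have hc : ∀ a, B v (e a) = (N.mulVec v) a := by
      intro a
      conv_lhs => rw [hv]
      simp [map_sum, hab]
    simp_rw [hc]; exact hv
  · rw [← gramM_det, hg, Matrix.det_one]

lemma gram_onb_det {n : ℕ} (hn : 0 < n) (X Y : Euc n →L[ℝ] Euc n →L[ℝ] ℝ) (e : Fin n → Euc n)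
    (he : (gramM Y stdB).det * (colM e).det ^ 2 = 1)
    (hs : ∀ x y, X x y = X y x) (hp : ∀ x, 0 ≤ X x x) (hY : 0 < (gramM Y stdB).det)
    (c : ℝ) (hc : 0 ≤ c) (hXY : c ^ n * (gramM Y stdB).det ≤ (gramM X stdB).det) :
    n * c ≤ ∑ a, X (e a) (e a) := by
  have h := psd_amgm hn (gramM X e) (gramM_psd X hs hp e) c hc (by
    rw [gramM_det]
    have : 0 ≤ (colM e).det ^ 2 := sq_nonneg _
    calc c ^ n = c ^ n * ((gramM Y stdB).det * (colM e).det ^ 2) := by rw [he, mul_one]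
      _ = (c ^ n * (gramM Y stdB).det) * (colM e).det ^ 2 := by ring
      _ ≤ _ := by gcongr)
  simpa [Matrix.trace, gramM] using h

/-- monotonicity of determinant -/
lemma det_mono_forms {n : ℕ} (hn : 0 < n) (X Y : Euc n →L[ℝ] Euc n →L[ℝ] ℝ)
    (hXs : ∀ x y, X x y = X y x) (hYs : ∀ x y, Y x y = Y y x) (hp : ∀ x, 0 ≤ X x x)
    (hXY : ∀ x, X x x ≤ Y x x) (c : ℝ) (hc : 0 ≤ c) (hY : 0 < (gramM Y stdB).det)
    (h : c ^ n * (gramM Y stdB).det ≤ (gramM X stdB).det) : c ≤ 1 := by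
  obtain ⟨e, he, -, hd⟩ := exists_onb Y hYs (fun x => (hp x).trans (hXY x)) hY.ne'
  have h1 := gram_onb_det hn X Y e hd hXs hp hY c hc h
  have h2 : ∑ a, X (e a) (e a) ≤ ∑ a : Fin n, (1:ℝ) := by
    refine Finset.sum_le_sum fun a _ => (hXY _).trans ?_
    simp [he]
  simp at h2
  have hnn : (0:ℝ) < n := by exact_mod_cast hn
  nlinarith

end Part1

section Part2
open Filter Topology

lemma second_test {F F1 : ℝ → ℝ} {F2 : ℝ} (hmax : IsLocalMax F 0)
    (h1 : ∀ᶠ t in 𝓝 (0:ℝ), HasDerivAt F (F1 t) t) (h2 : HasDerivAt F1 F2 0) :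
    F1 0 = 0 ∧ F2 ≤ 0 := by
  have h10 : F1 0 = 0 := hmax.hasDerivAt_eq_zero h1.self_of_nhds
  refine ⟨h10, ?_⟩
  by_contra hcon
  push Not at hcon
  have hd : deriv F =ᶠ[𝓝 0] F1 := h1.mono fun t ht => ht.deriv
  have hdd : deriv (deriv F) 0 = F2 := by rw [hd.deriv_eq]; exact h2.deriv
  have hmin : IsLocalMin F 0 := isLocalMin_of_deriv_deriv_pos (by rw [hdd]; exact hcon)
    (by rw [hd.self_of_nhds]; exact h10) h1.self_of_nhds.continuousAt
  have hc : F =ᶠ[𝓝 0] fun _ => F 0 := by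
    filter_upwards [hmax, hmin] with t ht1 ht2
    exact le_antisymm ht1 ht2
  have hd0 : deriv F =ᶠ[𝓝 0] fun _ => (0:ℝ) := by
    filter_upwards [hc.eventuallyEq_nhds] with t ht
    rw [ht.deriv_eq]; simp
  have : deriv (deriv F) 0 = 0 := by rw [hd0.deriv_eq]; simp
  linarith

lemma log_test {s s1 α α1 β β1 : ℝ → ℝ} {s2 α2 β2 : ℝ} (k m : ℕ)
    (hs : ∀ᶠ t in 𝓝 (0:ℝ), HasDerivAt s (s1 t) t) (hs2 : HasDerivAt s1 s2 0)
    (hα : ∀ᶠ t in 𝓝 (0:ℝ), HasDerivAt α (α1 t) t) (hα2 : HasDerivAt α1 α2 0)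
    (hβ : ∀ᶠ t in 𝓝 (0:ℝ), HasDerivAt β (β1 t) t) (hβ2 : HasDerivAt β1 β2 0)
    (s0 : 0 < s 0) (α0 : 0 < α 0) (β0 : β 0 = 1)
    (hmax : IsLocalMax (fun t => s t ^ k * α t ^ 2 / β t ^ m) 0) :
    k * (s1 0 / s 0) + 2 * (α1 0 / α 0) - m * β1 0 = 0 ∧
    k * (s2 / s 0 - (s1 0) ^ 2 / (s 0) ^ 2) + 2 * (α2 / α 0 - (α1 0) ^ 2 / (α 0) ^ 2)
      - m * (β2 - (β1 0) ^ 2) ≤ 0 := by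
  have ps : ∀ᶠ t in 𝓝 (0:ℝ), 0 < s t := hs.self_of_nhds.continuousAt.eventually (lt_mem_nhds s0)
  have pα : ∀ᶠ t in 𝓝 (0:ℝ), 0 < α t := hα.self_of_nhds.continuousAt.eventually (lt_mem_nhds α0)
  have pβ : ∀ᶠ t in 𝓝 (0:ℝ), 0 < β t :=
    hβ.self_of_nhds.continuousAt.eventually (lt_mem_nhds (by rw [β0]; exact one_pos))
  have hmax' : IsLocalMax (fun t => k * Real.log (s t) + 2 * Real.log (α t) - m * Real.log (β t)) 0 := by
    have key : ∀ a b c : ℝ, 0 < a → 0 < b → 0 < c →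
        k * Real.log a + 2 * Real.log b - m * Real.log c = Real.log (a ^ k * b ^ 2 / c ^ m) := by
      intro a b c ha hb hc
      rw [Real.log_div (by positivity) (by positivity), Real.log_mul (by positivity) (by positivity),
        Real.log_pow, Real.log_pow, Real.log_pow]; push_cast; ring
    filter_upwards [hmax, ps, pα, pβ] with t ht h1 h2 h3
    rw [key _ _ _ h1 h2 h3, key _ _ _ s0 α0 (by rw [β0]; exact one_pos)]
    exact Real.log_le_log (by positivity) ht
  have hlog : ∀ {f f1 : ℝ → ℝ} {t : ℝ}, HasDerivAt f (f1 t) t → 0 < f t →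
      HasDerivAt (fun t => Real.log (f t)) (f1 t / f t) t := fun h hp => h.log hp.ne'
  have hlog2 : ∀ {f f1 : ℝ → ℝ} {f2 : ℝ}, HasDerivAt f (f1 0) 0 → HasDerivAt f1 f2 0 → 0 < f 0 →
      HasDerivAt (fun t => f1 t / f t) (f2 / f 0 - (f1 0) ^ 2 / (f 0) ^ 2) 0 := by
    intro f f1 f2 h1 h2 hp
    have h := h2.div h1 hp.ne'
    have e : f2 / f 0 - (f1 0) ^ 2 / (f 0) ^ 2 = (f2 * f 0 - f1 0 * f1 0) / f 0 ^ 2 := by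
      have := hp.ne'
      field_simp
    rw [e]; exact h
  have := second_test (F := fun t => k * Real.log (s t) + 2 * Real.log (α t) - m * Real.log (β t))
    (F1 := fun t => k * (s1 t / s t) + 2 * (α1 t / α t) - m * (β1 t / β t)) hmax'
    (by
      filter_upwards [hs, hα, hβ, ps, pα, pβ] with t h1 h2 h3 h4 h5 h6
      exact (((hlog h1 h4).const_mul _).add ((hlog h2 h5).const_mul _)).sub ((hlog h3 h6).const_mul _))
    ((((hlog2 hs.self_of_nhds hs2 s0).const_mul _).add
      ((hlog2 hα.self_of_nhds hα2 α0).const_mul _)).sub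
      ((hlog2 hβ.self_of_nhds hβ2 (by rw [β0]; exact one_pos)).const_mul _))
  simpa [β0] using this

/-- entrywise derivative of matrix curves -/
def HD {n : ℕ} (A : ℝ → Matrix (Fin n) (Fin n) ℝ) (A' : Matrix (Fin n) (Fin n) ℝ) (t : ℝ) : Prop :=
  ∀ i j, HasDerivAt (fun s => A s i j) (A' i j) t

lemma HD.mul {n : ℕ} {A B : ℝ → Matrix (Fin n) (Fin n) ℝ} {A' B' : Matrix (Fin n) (Fin n) ℝ} {t : ℝ}
    (hA : HD A A' t) (hB : HD B B' t) : HD (fun s => A s * B s) (A' * B t + A t * B') t := by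
  intro i j
  simp only [Matrix.mul_apply, Matrix.add_apply]
  rw [← Finset.sum_add_distrib]
  exact HasDerivAt.fun_sum fun k _ => (hA i k).mul (hB k j)

lemma HD.neg {n : ℕ} {A : ℝ → Matrix (Fin n) (Fin n) ℝ} {A' : Matrix (Fin n) (Fin n) ℝ} {t : ℝ}
    (hA : HD A A' t) : HD (fun s => - A s) (-A') t := fun i j => (hA i j).neg

lemma HD.add {n : ℕ} {A B : ℝ → Matrix (Fin n) (Fin n) ℝ} {A' B' : Matrix (Fin n) (Fin n) ℝ} {t : ℝ}
    (hA : HD A A' t) (hB : HD B B' t) : HD (fun s => A s + B s) (A' + B') t :=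
  fun i j => (hA i j).add (hB i j)

lemma HD.trace {n : ℕ} {A : ℝ → Matrix (Fin n) (Fin n) ℝ} {A' : Matrix (Fin n) (Fin n) ℝ} {t : ℝ}
    (hA : HD A A' t) : HasDerivAt (fun s => (A s).trace) A'.trace t := by
  simp only [Matrix.trace, Matrix.diag]
  exact HasDerivAt.fun_sum fun k _ => (hA k k)

lemma HD.unique {n : ℕ} {A : ℝ → Matrix (Fin n) (Fin n) ℝ} {A' A'' : Matrix (Fin n) (Fin n) ℝ} {t : ℝ}
    (hA : HD A A' t) (h2 : HD A A'' t) : A' = A'' := by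
  ext i j; exact (hA i j).unique (h2 i j)

lemma HD.congr {n : ℕ} {A B : ℝ → Matrix (Fin n) (Fin n) ℝ} {A' : Matrix (Fin n) (Fin n) ℝ} {t : ℝ}
    (hA : HD A A' t) (h : B =ᶠ[𝓝 t] A) : HD B A' t := by
  intro i j
  exact (hA i j).congr_of_eventuallyEq (h.mono fun s hs => by simp only [hs])

lemma HD.det {n : ℕ} {A : ℝ → Matrix (Fin n) (Fin n) ℝ} {A' : Matrix (Fin n) (Fin n) ℝ} {t : ℝ}
    (hA : HD A A' t) : HasDerivAt (fun s => (A s).det) ((A t).adjugate * A').trace t := by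
  have h1 : HasDerivAt (fun s => (A s).det)
      (∑ σ : Equiv.Perm (Fin n), ((Equiv.Perm.sign σ : ℤ) : ℝ) *
        ∑ i, (∏ j ∈ Finset.univ.erase i, A t (σ j) j) * A' (σ i) i) t := by
    simp only [Matrix.det_apply']
    refine HasDerivAt.fun_sum fun σ _ => HasDerivAt.const_mul _ ?_
    have := HasDerivAt.fun_finsetProd (u := Finset.univ) (f := fun i s => A s (σ i) i)
      (f' := fun i => A' (σ i) i) (x := t) (fun i _ => hA (σ i) i)
    simpa [smul_eq_mul] using this
  convert h1 using 1
  have h2 : ∀ i, ((A t).adjugate * A') i i = ((A t).updateCol i (fun k => A' k i)).det := by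
    intro i
    rw [← Matrix.cramer_apply, Matrix.cramer_eq_adjugate_mulVec]
    simp [Matrix.mul_apply, Matrix.mulVec, dotProduct]
  simp only [Matrix.trace, Matrix.diag, h2, Matrix.det_apply']
  rw [Finset.sum_comm]
  refine Finset.sum_congr rfl fun σ _ => ?_
  rw [Finset.mul_sum]
  refine Finset.sum_congr rfl fun i _ => ?_
  congr 1
  rw [← Finset.prod_erase_mul _ _ (Finset.mem_univ i)]
  congr 1
  · refine Finset.prod_congr rfl fun j hj => ?_
    rw [Matrix.updateCol_ne (Finset.ne_of_mem_erase hj)]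
  · simp

lemma HD.adjugate {n : ℕ} {A : ℝ → Matrix (Fin n) (Fin n) ℝ} {A' : Matrix (Fin n) (Fin n) ℝ} {t : ℝ}
    (hA : HD A A' t) : ∃ N', HD (fun s => (A s).adjugate) N' t := by
  have : ∀ i j, ∃ d, HasDerivAt (fun s => (A s).adjugate i j) d t := by
    intro i j
    simp only [Matrix.adjugate_apply]
    have : HD (fun s => (A s).updateRow j (Pi.single i 1)) (A'.updateRow j 0) t := by
      intro k l
      by_cases hk : k = j
      · subst hk; simp [hasDerivAt_const]
      · simp [Matrix.updateRow_ne hk, hA k l]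
    exact ⟨_, this.det⟩
  choose N' hN' using this
  exact ⟨Matrix.of N', fun i j => hN' i j⟩

lemma trace_formulas {n : ℕ} {M M1 M2 : ℝ → Matrix (Fin n) (Fin n) ℝ} {M3 : Matrix (Fin n) (Fin n) ℝ}
    (h1 : ∀ᶠ t in 𝓝 (0:ℝ), HD M (M1 t) t) (h2 : ∀ᶠ t in 𝓝 (0:ℝ), HD M1 (M2 t) t)
    (h3 : HD M2 M3 0) (hM0 : M 0 = 1) (hdet : ∀ᶠ t in 𝓝 (0:ℝ), (M t).det = 1) :
    (M1 0).trace = 0 ∧ (M2 0).trace = (M1 0 * M1 0).trace ∧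
    M3.trace = 3 * (M1 0 * M2 0).trace - 2 * (M1 0 * M1 0 * M1 0).trace := by
  set N : ℝ → Matrix (Fin n) (Fin n) ℝ := fun t => (M t).adjugate with hN
  have hNM : ∀ᶠ t in 𝓝 (0:ℝ), N t * M t = 1 := hdet.mono fun t ht => by
    simp only [hN, Matrix.adjugate_mul, ht, one_smul]
  have hMN : ∀ᶠ t in 𝓝 (0:ℝ), M t * N t = 1 := hdet.mono fun t ht => by
    simp only [hN, Matrix.mul_adjugate, ht, one_smul]
  have hN1 : ∀ᶠ t in 𝓝 (0:ℝ), HD N (-(N t * M1 t * N t)) t := by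
    filter_upwards [h1, hNM.eventually_nhds, hMN] with t ht hnm hmn
    obtain ⟨N', hN'⟩ := ht.adjugate
    have e1 := hN'.mul ht
    have e2 : HD (fun s => (M s).adjugate * M s) 0 t := by
      refine HD.congr (A := fun _ => 1) (fun i j => by simpa using hasDerivAt_const _ _) ?_
      exact hnm
    have e3 := e1.unique e2
    have e4 : N' = -(N t * M1 t * N t) := by
      have : (N' * M t + N t * M1 t) * N t = 0 := by
        simp only [hN]; rw [e3, zero_mul]
      rw [add_mul, Matrix.mul_assoc, hmn, mul_one] at this
      exact eq_neg_of_add_eq_zero_left this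
    rw [← e4]; exact hN'
  have hT : ∀ᶠ t in 𝓝 (0:ℝ), (N t * M1 t).trace = 0 := by
    filter_upwards [h1, hdet.eventually_nhds] with t ht hd
    have e1 := ht.det
    have e2 : HasDerivAt (fun s => (M s).det) 0 t :=
      (hasDerivAt_const t (1:ℝ)).congr_of_eventuallyEq hd
    exact e1.unique e2
  have hT1 : ∀ᶠ t in 𝓝 (0:ℝ), (-(N t * M1 t * N t) * M1 t + N t * M2 t).trace = 0 := by
    filter_upwards [hN1, h2, hT.eventually_nhds] with t a b c
    exact (a.mul b).trace.unique ((hasDerivAt_const t (0:ℝ)).congr_of_eventuallyEq c)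
  have hN0 : N 0 = 1 := by simp [hN, hM0]
  have a := hN1.self_of_nhds
  have b := h2.self_of_nhds
  have hT2 := ((((a.mul b).mul a).neg.mul b).add (a.mul h3)).trace.unique
    ((hasDerivAt_const (0:ℝ) (0:ℝ)).congr_of_eventuallyEq hT1)
  have r0 := hT.self_of_nhds
  have r1 := hT1.self_of_nhds
  simp only [hN0, one_mul, mul_one] at r0 r1 hT2
  refine ⟨r0, ?_, ?_⟩
  · simp only [Matrix.trace_add, neg_mul, Matrix.trace_neg] at r1; linarith
  · simp only [Matrix.trace_add, neg_mul, Matrix.trace_neg, mul_neg, Matrix.add_mul, neg_add, neg_neg,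
      Matrix.mul_assoc] at hT2
    have c1 : (M2 0 * M1 0).trace = (M1 0 * M2 0).trace := Matrix.trace_mul_comm _ _
    rw [c1] at hT2
    rw [Matrix.mul_assoc]
    linarith

end Part2

section Part3
open Filter Topology
open scoped ContDiff
set_option maxSynthPendingDepth 8

section tensors
variable {E : Type} [NormedAddCommGroup E] [NormedSpace ℝ E]
abbrev T1 (w : E → ℝ) : E → (E →L[ℝ] ℝ) := fderiv ℝ w
abbrev T2 (w : E → ℝ) : E → (E →L[ℝ] E →L[ℝ] ℝ) := fderiv ℝ (T1 w)
abbrev T3 (w : E → ℝ) : E → (E →L[ℝ] E →L[ℝ] E →L[ℝ] ℝ) := fderiv ℝ (T2 w)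
abbrev T4 (w : E → ℝ) : E → (E →L[ℝ] E →L[ℝ] E →L[ℝ] E →L[ℝ] ℝ) := fderiv ℝ (T3 w)
abbrev T5 (w : E → ℝ) : E → (E →L[ℝ] E →L[ℝ] E →L[ℝ] E →L[ℝ] E →L[ℝ] ℝ) := fderiv ℝ (T4 w)
end tensors

section smooth
variable {E : Type} [NormedAddCommGroup E] [NormedSpace ℝ E] {F : Type*} [NormedAddCommGroup F] [NormedSpace ℝ F] {S : Set (E)}

lemma smooth_fderiv (hS : IsOpen S) {f : E → F} (hf : ContDiffOn ℝ ∞ f S) :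
    ContDiffOn ℝ ∞ (fderiv ℝ f) S := hf.fderiv_of_isOpen hS (by simp)

lemma smooth_hasFDerivAt (hS : IsOpen S) {f : E → F} (hf : ContDiffOn ℝ ∞ f S) {x : E}
    (hx : x ∈ S) : HasFDerivAt f (fderiv ℝ f x) x :=
  ((hf.contDiffAt (hS.mem_nhds hx)).differentiableAt (by simp)).hasFDerivAt

lemma smooth_symm (hS : IsOpen S) {f : E → F} (hf : ContDiffOn ℝ ∞ f S) {x : E}
    (hx : x ∈ S) (a b : E) : fderiv ℝ (fderiv ℝ f) x a b = fderiv ℝ (fderiv ℝ f) x b a :=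
  (hf.contDiffAt (hS.mem_nhds hx)).isSymmSndFDerivAt (by simp only [minSmoothness_of_isRCLikeNormedField]; exact WithTop.coe_le_coe.2 le_top) a b

lemma smooth_curve (hS : IsOpen S) {f : E → F} (hf : ContDiffOn ℝ ∞ f S) {x e : E} {t : ℝ}
    (hx : x + t • e ∈ S) :
    HasDerivAt (fun t : ℝ => f (x + t • e)) (fderiv ℝ f (x + t • e) e) t := by
  have h := smooth_hasFDerivAt hS hf hx
  have h2 : HasDerivAt (fun t : ℝ => x + t • e) e t := by
    simpa using ((hasDerivAt_id t).smul_const e).const_add x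
  exact h.comp_hasDerivAt t h2

lemma curve_mem (hS : IsOpen S) {x : E} (hx : x ∈ S) (e : E) :
    ∀ᶠ t : ℝ in 𝓝 0, x + t • e ∈ S := by
  have : ContinuousAt (fun t : ℝ => x + t • e) 0 := by fun_prop
  exact this.eventually (hS.mem_nhds (by simpa using hx))

end smooth

section sym
variable {E : Type} [NormedAddCommGroup E] [NormedSpace ℝ E] {n : ℕ} {S : Set (E)} {w : E → ℝ}

lemma T2_symm (hS : IsOpen S) (hw : ContDiffOn ℝ ∞ w S) {x : E} (hx : x ∈ S) (a b : E) :
    T2 w x a b = T2 w x b a := smooth_symm hS hw hx a b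

lemma T3_s12 (hS : IsOpen S) (hw : ContDiffOn ℝ ∞ w S) {x : E} (hx : x ∈ S) (a b c : E) :
    T3 w x a b c = T3 w x b a c := by
  have := smooth_symm hS (smooth_fderiv hS hw) hx a b
  exact congrArg (fun f => f c) this

lemma curve0 {F : Type*} [NormedAddCommGroup F] [NormedSpace ℝ F]
    (hS : IsOpen S) {f : E → F} (hf : ContDiffOn ℝ ∞ f S) {x : E} (hx : x ∈ S) (e : E) :
    HasDerivAt (fun t : ℝ => f (x + t • e)) (fderiv ℝ f x e) 0 := by
  have := smooth_curve hS hf (x := x) (e := e) (t := 0) (by simpa using hx)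
  simpa using this

lemma T3_s23 (hS : IsOpen S) (hw : ContDiffOn ℝ ∞ w S) {x : E} (hx : x ∈ S) (a b c : E) :
    T3 w x a b c = T3 w x a c b := by
  have h := curve0 hS (smooth_fderiv hS (smooth_fderiv hS hw)) hx a
  have h1 := (h.clm_apply (hasDerivAt_const (0:ℝ) b)).clm_apply (hasDerivAt_const (0:ℝ) c)
  have h2 := (h.clm_apply (hasDerivAt_const (0:ℝ) c)).clm_apply (hasDerivAt_const (0:ℝ) b)
  have h3 := h1.unique (h2.congr_of_eventuallyEq
    ((curve_mem hS hx a).mono fun t ht => T2_symm hS hw ht b c))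
  simpa using h3

lemma T4_s12 (hS : IsOpen S) (hw : ContDiffOn ℝ ∞ w S) {x : E} (hx : x ∈ S) (a b c d : E) :
    T4 w x a b c d = T4 w x b a c d := by
  have := smooth_symm hS (smooth_fderiv hS (smooth_fderiv hS hw)) hx a b
  exact congrArg (fun f => f c d) this

lemma T4_s23 (hS : IsOpen S) (hw : ContDiffOn ℝ ∞ w S) {x : E} (hx : x ∈ S) (a b c d : E) :
    T4 w x a b c d = T4 w x a c b d := by
  have h := curve0 hS (smooth_fderiv hS (smooth_fderiv hS (smooth_fderiv hS hw))) hx a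
  have hc := fun z : E => hasDerivAt_const (0:ℝ) z
  have h1 := ((h.clm_apply (hc b)).clm_apply (hc c)).clm_apply (hc d)
  have h2 := ((h.clm_apply (hc c)).clm_apply (hc b)).clm_apply (hc d)
  have h3 := h1.unique (h2.congr_of_eventuallyEq
    ((curve_mem hS hx a).mono fun t ht => T3_s12 hS hw ht b c d))
  simpa using h3

lemma T4_s34 (hS : IsOpen S) (hw : ContDiffOn ℝ ∞ w S) {x : E} (hx : x ∈ S) (a b c d : E) :
    T4 w x a b c d = T4 w x a b d c := by
  have h := curve0 hS (smooth_fderiv hS (smooth_fderiv hS (smooth_fderiv hS hw))) hx a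
  have hc := fun z : E => hasDerivAt_const (0:ℝ) z
  have h1 := ((h.clm_apply (hc b)).clm_apply (hc c)).clm_apply (hc d)
  have h2 := ((h.clm_apply (hc b)).clm_apply (hc d)).clm_apply (hc c)
  have h3 := h1.unique (h2.congr_of_eventuallyEq
    ((curve_mem hS hx a).mono fun t ht => T3_s23 hS hw ht b c d))
  simpa using h3

lemma T5_s12 (hS : IsOpen S) (hw : ContDiffOn ℝ ∞ w S) {x : E} (hx : x ∈ S)
    (a b c d e : E) : T5 w x a b c d e = T5 w x b a c d e := by
  have := smooth_symm hS (smooth_fderiv hS (smooth_fderiv hS (smooth_fderiv hS hw))) hx a b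
  exact congrArg (fun f => f c d e) this

lemma T5_tail (hS : IsOpen S) (hw : ContDiffOn ℝ ∞ w S) {x : E} (hx : x ∈ S)
    (a b c d e b' c' d' e' : E) (h4 : ∀ y ∈ S, T4 w y b c d e = T4 w y b' c' d' e') :
    T5 w x a b c d e = T5 w x a b' c' d' e' := by
  have h := curve0 hS (smooth_fderiv hS (smooth_fderiv hS (smooth_fderiv hS (smooth_fderiv hS hw)))) hx a
  have hc := fun z : E => hasDerivAt_const (0:ℝ) z
  have h1 := (((h.clm_apply (hc b)).clm_apply (hc c)).clm_apply (hc d)).clm_apply (hc e)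
  have h2 := (((h.clm_apply (hc b')).clm_apply (hc c')).clm_apply (hc d')).clm_apply (hc e')
  have h3 := h1.unique (h2.congr_of_eventuallyEq
    ((curve_mem hS hx a).mono fun t ht => h4 _ ht))
  simpa using h3

lemma T4_swap (hS : IsOpen S) (hw : ContDiffOn ℝ ∞ w S) {x : E} (hx : x ∈ S) (a b c d : E) :
    T4 w x a b c d = T4 w x c d a b := by
  rw [T4_s23 hS hw hx, T4_s12 hS hw hx, T4_s34 hS hw hx, T4_s23 hS hw hx]

lemma T5_swap (hS : IsOpen S) (hw : ContDiffOn ℝ ∞ w S) {x : E} (hx : x ∈ S) (a v : E) :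
    T5 w x a a v v v = T5 w x v v v a a := by
  rw [T5_tail hS hw hx a a v v v v v v a (fun y hy => by
      rw [T4_s12 hS hw hy, T4_s23 hS hw hy, T4_s34 hS hw hy]), T5_s12 hS hw hx,
    T5_tail hS hw hx v a v v a v v a a (fun y hy => by
      rw [T4_s12 hS hw hy, T4_s23 hS hw hy])]

/-- the trace identities from `det D²w = const` -/
lemma trace_id (hS : IsOpen S) (hw : ContDiffOn ℝ ∞ w S) {x : E} (hx : x ∈ S)
    (e : Fin n → E)
    (hdet : ∀ y ∈ S, (Matrix.of fun a b => T2 w y (e a) (e b)).det = 1)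
    (he : ∀ a b, T2 w x (e a) (e b) = if a = b then 1 else 0)
    (v : E) :
    ∑ i, T3 w x (e i) (e i) v = 0 ∧
    ∑ i, T4 w x (e i) (e i) v v = ∑ i, ∑ j, T3 w x v (e i) (e j) ^ 2 ∧
    ∑ i, T5 w x (e i) (e i) v v v = 3 * ∑ i, ∑ j, T3 w x v (e i) (e j) * T4 w x v v (e i) (e j)
      - 2 * ∑ i, ∑ j, ∑ k, T3 w x v (e i) (e j) * T3 w x v (e j) (e k) * T3 w x v (e k) (e i) := by
  have hc := fun (z : E) (t : ℝ) => hasDerivAt_const t z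
  have s1 := smooth_fderiv hS hw
  have s2 := smooth_fderiv hS s1
  have s3 := smooth_fderiv hS s2
  have s4 := smooth_fderiv hS s3
  have hmem := curve_mem hS hx v
  have hg : (Matrix.of fun a b => T2 w x (e a) (e b)) = 1 := by
    ext a b; simp [he, Matrix.one_apply]
  obtain ⟨r1, r2, r3⟩ := trace_formulas (n := n)
    (M := fun t => Matrix.of fun a b => T2 w (x + t • v) (e a) (e b))
    (M1 := fun t => Matrix.of fun a b => T3 w (x + t • v) v (e a) (e b))
    (M2 := fun t => Matrix.of fun a b => T4 w (x + t • v) v v (e a) (e b))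
    (M3 := Matrix.of fun a b => T5 w x v v v (e a) (e b))
    (hmem.mono fun t ht i j => by
      have := ((smooth_curve hS s2 ht).clm_apply (hc (e i) t)).clm_apply (hc (e j) t)
      simpa using this)
    (hmem.mono fun t ht i j => by
      have := (((smooth_curve hS s3 ht).clm_apply (hc v t)).clm_apply (hc (e i) t)).clm_apply (hc (e j) t)
      simpa using this)
    (fun i j => by
      have := ((((curve0 hS s4 hx v).clm_apply (hc v 0)).clm_apply (hc v 0)).clm_apply
        (hc (e i) 0)).clm_apply (hc (e j) 0)
      simpa using this)
    (by simpa using hg)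
    (hmem.mono fun t ht => hdet _ ht)
  simp only [zero_smul, add_zero, Matrix.trace, Matrix.diag, Matrix.of_apply, Matrix.mul_apply] at r1 r2 r3
  have sy : ∀ a b, T3 w x v (e a) (e b) = T3 w x v (e b) (e a) := fun a b => T3_s23 hS hw hx _ _ _
  have sy4 : ∀ a b, T4 w x v v (e a) (e b) = T4 w x v v (e b) (e a) := fun a b => T4_s34 hS hw hx _ _ _ _
  refine ⟨?_, ?_, ?_⟩
  · rw [← r1]; refine Finset.sum_congr rfl fun i _ => ?_
    rw [T3_s23 hS hw hx, T3_s12 hS hw hx]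
  · calc _ = ∑ i, T4 w x v v (e i) (e i) := Finset.sum_congr rfl fun i _ => T4_swap hS hw hx _ _ _ _
      _ = _ := r2
      _ = _ := Finset.sum_congr rfl fun i _ => Finset.sum_congr rfl fun j _ => by
        rw [sy j i]; ring
  · calc _ = ∑ i, T5 w x v v v (e i) (e i) := Finset.sum_congr rfl fun i _ => T5_swap hS hw hx _ _
      _ = _ := r3
      _ = _ := by
        congr 2
        · refine Finset.sum_congr rfl fun i _ => Finset.sum_congr rfl fun j _ => by rw [sy4 j i]
        · refine Finset.sum_congr rfl fun i _ => ?_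
          simp only [Finset.sum_mul]
          rw [Finset.sum_comm]
end sym

end Part3

section Part4
open Filter Topology
open scoped ContDiff
set_option maxSynthPendingDepth 8

section curves
variable {E : Type} [NormedAddCommGroup E] [NormedSpace ℝ E] {S : Set E} {w : E → ℝ}

lemma hV (v f : E) (t : ℝ) : HasDerivAt (fun t : ℝ => v + t • f) f t := by
  simpa using ((hasDerivAt_id t).smul_const f).const_add v

lemma cs (hS : IsOpen S) (hw : ContDiffOn ℝ ∞ w S) {x : E} (hx : x ∈ S) (e : E) (ε : ℝ) :
    (∀ᶠ t : ℝ in 𝓝 0, HasDerivAt (fun t : ℝ => - w (x + t • e) - ε) (- T1 w (x + t • e) e) t) ∧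
    HasDerivAt (fun t : ℝ => - T1 w (x + t • e) e) (- T2 w x e e) 0 := by
  constructor
  · filter_upwards [curve_mem hS hx e] with t ht
    exact ((smooth_curve hS hw ht).neg).sub_const ε
  · have := ((curve0 hS (smooth_fderiv hS hw) hx e).clm_apply (hasDerivAt_const (0:ℝ) e)).neg
    refine this.congr_deriv ?_
    simp

lemma ca (hS : IsOpen S) (hw : ContDiffOn ℝ ∞ w S) {x : E} (hx : x ∈ S) (e v f : E) :
    (∀ᶠ t : ℝ in 𝓝 0, HasDerivAt (fun t : ℝ => T1 w (x + t • e) (v + t • f))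
      (T2 w (x + t • e) e (v + t • f) + T1 w (x + t • e) f) t) ∧
    HasDerivAt (fun t : ℝ => T2 w (x + t • e) e (v + t • f) + T1 w (x + t • e) f)
      (T3 w x e e v + 2 * T2 w x e f) 0 := by
  have s1 := smooth_fderiv hS hw
  have s2 := smooth_fderiv hS s1
  have hc := fun (z : E) (t : ℝ) => hasDerivAt_const t z
  constructor
  · filter_upwards [curve_mem hS hx e] with t ht
    exact (smooth_curve hS s1 ht).clm_apply (hV v f t)
  · have := (((curve0 hS s2 hx e).clm_apply (hc e 0)).clm_apply (hV v f 0)).add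
      ((curve0 hS s1 hx e).clm_apply (hc f 0))
    refine this.congr_deriv ?_
    simp; ring

lemma cb (hS : IsOpen S) (hw : ContDiffOn ℝ ∞ w S) {x : E} (hx : x ∈ S) (e v f : E) :
    (∀ᶠ t : ℝ in 𝓝 0, HasDerivAt (fun t : ℝ => T2 w (x + t • e) (v + t • f) (v + t • f))
      (T3 w (x + t • e) e (v + t • f) (v + t • f) + 2 * T2 w (x + t • e) f (v + t • f)) t) ∧
    HasDerivAt (fun t : ℝ => T3 w (x + t • e) e (v + t • f) (v + t • f)
        + 2 * T2 w (x + t • e) f (v + t • f))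
      (T4 w x e e v v + 4 * T3 w x e v f + 2 * T2 w x f f) 0 := by
  have s1 := smooth_fderiv hS hw
  have s2 := smooth_fderiv hS s1
  have s3 := smooth_fderiv hS s2
  have hc := fun (z : E) (t : ℝ) => hasDerivAt_const t z
  constructor
  · filter_upwards [curve_mem hS hx e] with t ht
    have := ((smooth_curve hS s2 ht).clm_apply (hV v f t)).clm_apply (hV v f t)
    refine this.congr_deriv ?_
    simp only [add_apply, T2_symm hS hw ht _ f]
    ring
  · have := ((((curve0 hS s3 hx e).clm_apply (hc e 0)).clm_apply (hV v f 0)).clm_apply (hV v f 0)).add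
      ((((curve0 hS s2 hx e).clm_apply (hc f 0)).clm_apply (hV v f 0)).const_mul 2)
    refine this.congr_deriv ?_
    simp only [zero_smul, add_zero, map_zero, add_apply, T3_s23 hS hw hx _ f v]
    ring

lemma cg (hS : IsOpen S) (hw : ContDiffOn ℝ ∞ w S) {x : E} (hx : x ∈ S) (e v f : E) :
    (∀ᶠ t : ℝ in 𝓝 0, HasDerivAt (fun t : ℝ => T3 w (x + t • e) (v + t • f) (v + t • f) (v + t • f))
      (T4 w (x + t • e) e (v + t • f) (v + t • f) (v + t • f)
        + 3 * T3 w (x + t • e) f (v + t • f) (v + t • f)) t) ∧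
    HasDerivAt (fun t : ℝ => T4 w (x + t • e) e (v + t • f) (v + t • f) (v + t • f)
        + 3 * T3 w (x + t • e) f (v + t • f) (v + t • f))
      (T5 w x e e v v v + 6 * T4 w x e v v f + 6 * T3 w x v f f) 0 := by
  have s1 := smooth_fderiv hS hw
  have s2 := smooth_fderiv hS s1
  have s3 := smooth_fderiv hS s2
  have s4 := smooth_fderiv hS s3
  have hc := fun (z : E) (t : ℝ) => hasDerivAt_const t z
  constructor
  · filter_upwards [curve_mem hS hx e] with t ht
    have := (((smooth_curve hS s3 ht).clm_apply (hV v f t)).clm_apply (hV v f t)).clm_apply (hV v f t)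
    refine this.congr_deriv ?_
    simp only [add_apply]
    generalize v + t • f = V
    rw [T3_s23 hS hw ht V V f, T3_s12 hS hw ht V f V]
    ring
  · have := (((((curve0 hS s4 hx e).clm_apply (hc e 0)).clm_apply (hV v f 0)).clm_apply
      (hV v f 0)).clm_apply (hV v f 0)).add
      (((((curve0 hS s3 hx e).clm_apply (hc f 0)).clm_apply (hV v f 0)).clm_apply (hV v f 0)).const_mul 3)
    refine this.congr_deriv ?_
    simp only [zero_smul, add_zero, map_zero, add_apply]
    have q1 := T4_s34 hS hw hx e v f v
    have q2 := T4_s23 hS hw hx e f v v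
    have q3 := T3_s23 hS hw hx f f v
    have q4 := T3_s12 hS hw hx v f f
    have q5 := T3_s23 hS hw hx f v f
    linarith
end curves

/-- the data used for the interior estimates -/
structure MA {E : Type} [NormedAddCommGroup E] [NormedSpace ℝ E] (n : ℕ) (S : Set E) (w : E → ℝ) :
    Prop where
  opn : IsOpen S
  smooth : ContDiffOn ℝ ∞ w S
  pos : ∀ x ∈ S, ∀ v : E, v ≠ 0 → 0 < T2 w x v v
  onb : ∀ x ∈ S, ∃ e : Fin n → E, (∀ a b, T2 w x (e a) (e b) = if a = b then 1 else 0) ∧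
    (∀ v, v = ∑ a, T2 w x v (e a) • e a) ∧
    (∀ y ∈ S, (Matrix.of fun a b => T2 w y (e a) (e b)).det = 1)

lemma max_principle {E : Type} [NormedAddCommGroup E] [NormedSpace ℝ E] [ProperSpace E]
    {G : E → E → ℝ} {K : Set E} (hK : IsCompact K)
    (hG : ContinuousOn (fun q : E × E => G q.1 q.2) (K ×ˢ Metric.sphere (0:E) 1))
    (hom : ∀ y ∈ K, ∀ V, ∀ c : ℝ, 0 < c → G y (c • V) = G y V) (h0 : ∀ y ∈ K, G y 0 = 0)
    {M : ℝ} (hM : 0 ≤ M)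
    (hmax : ∀ x ∈ K, ∀ v, v ≠ 0 → 0 < G x v → (∀ y ∈ K, ∀ V, G y V ≤ G x v) → G x v ≤ M) :
    ∀ y ∈ K, ∀ V, G y V ≤ M := by
  intro y hy V
  rcases eq_or_ne V 0 with rfl | hV
  · rw [h0 y hy]; exact hM
  have nrm : ∀ V : E, V ≠ 0 → (‖V‖⁻¹ • V) ∈ Metric.sphere (0:E) 1 := by
    intro V hV; simp [norm_smul, hV]
  obtain ⟨q, hq, hqm⟩ := (hK.prod (isCompact_sphere (0:E) 1)).exists_isMaxOn
    ⟨(y, ‖V‖⁻¹ • V), hy, nrm V hV⟩ hG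
  have key : ∀ y ∈ K, ∀ V, V ≠ 0 → G y V ≤ G q.1 q.2 := by
    intro y hy V hV
    have := hqm (show (y, ‖V‖⁻¹ • V) ∈ _ from ⟨hy, nrm V hV⟩)
    simp only [Set.mem_ofPred_eq] at this
    rwa [hom y hy V _ (by positivity)] at this
  by_cases hp : 0 < G q.1 q.2
  · refine (key y hy V hV).trans (hmax q.1 hq.1 q.2 ?_ hp ?_)
    · intro h
      have := hq.2
      rw [h] at this; simp at this
    · intro z hz W
      rcases eq_or_ne W 0 with rfl | hW
      · rw [h0 z hz]; exact hp.le
      · exact key z hz W hW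
  · exact (key y hy V hV).trans ((not_lt.1 hp).trans hM)

end Part4

section Part5
open Filter Topology
open scoped ContDiff
set_option maxSynthPendingDepth 8

section pack
variable {E : Type} [NormedAddCommGroup E] [NormedSpace ℝ E] {S : Set E} {w : E → ℝ} {n : ℕ}

lemma onb_pack (hMA : MA n S w) {x : E} (hx : x ∈ S) (v : E) :
    ∃ (e g : Fin n → E) (c : Fin n → ℝ) (A : Fin n → Fin n → ℝ),
      (∀ i, T2 w x (e i) (e i) = 1) ∧ (∀ i, T2 w x v (e i) = c i) ∧
      (∑ i, c i ^ 2 = T2 w x v v) ∧ (∑ i, A i i = 0) ∧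
      (∀ i, T3 w x (e i) v v = ∑ j, A i j * c j) ∧
      (∀ i, T2 w x v (g i) = ∑ j, A i j * c j) ∧
      (∑ i, T3 w x (e i) (e i) v = 0) ∧
      (∑ i, T2 w x (e i) (g i) = 0) ∧
      (∑ i, T2 w x (g i) (g i) = ∑ i, ∑ j, A i j ^ 2) ∧
      (∑ i, T3 w x (e i) v (g i) = ∑ i, ∑ j, A i j ^ 2) ∧
      (∑ i, T4 w x (e i) (e i) v v = ∑ i, ∑ j, A i j ^ 2) ∧
      (∑ i, T5 w x (e i) (e i) v v v
        = 3 * ∑ i, T4 w x (e i) v v (g i) - 2 * ∑ i, T3 w x v (g i) (g i)) ∧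
      (∀ ℓ : E →L[ℝ] ℝ, ∃ z, ℓ z = ∑ i, ℓ (e i) ^ 2 ∧ T2 w x z z = ∑ i, ℓ (e i) ^ 2) := by
  have hS := hMA.opn
  have hw := hMA.smooth
  obtain ⟨e, he, hv, hdet⟩ := hMA.onb x hx
  obtain ⟨t1, t2, t3⟩ := trace_id hS hw hx e hdet he v
  set A : Fin n → Fin n → ℝ := fun i j => T3 w x v (e i) (e j) with hA
  have sA : ∀ i j, A i j = A j i := fun i j => T3_s23 hS hw hx _ _ _
  have tA : ∑ i, A i i = 0 := by
    rw [← t1]; refine Finset.sum_congr rfl fun i _ => ?_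
    rw [T3_s23 hS hw hx (e i) (e i) v, T3_s12 hS hw hx]
  have g2 : ∀ z i, T2 w x z (∑ j, A i j • e j) = ∑ j, A i j * T2 w x z (e j) := by
    intro z i; simp
  have g2e : ∀ k i, T2 w x (e k) (∑ j, A i j • e j) = A i k := by
    intro z i; rw [g2]; simp [he]
  have g3 : ∀ a b i, T3 w x a b (∑ j, A i j • e j) = ∑ j, A i j * T3 w x a b (e j) := by
    intro a b i; simp
  have g4 : ∀ a b c i, T4 w x a b c (∑ j, A i j • e j) = ∑ j, A i j * T4 w x a b c (e j) := by
    intro a b c i; simp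
  have qv : ∀ i, T3 w x (e i) v v = ∑ j, A i j * T2 w x v (e j) := by
    intro i
    conv_lhs => rw [T3_s12 hS hw hx]; enter [2]; rw [hv v]
    rw [map_sum]
    refine Finset.sum_congr rfl fun j _ => ?_
    rw [map_smul, smul_eq_mul, mul_comm]
  refine ⟨e, fun i => ∑ j, A i j • e j, fun i => T2 w x v (e i), A, fun i => by simp [he],
    fun i => rfl, ?_, tA, qv, fun i => g2 v i, t1, ?_, ?_, ?_, t2, ?_, ?_⟩
  · conv_rhs => enter [2]; rw [hv v]
    rw [map_sum]
    refine Finset.sum_congr rfl fun j _ => ?_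
    rw [map_smul, smul_eq_mul, sq]
  · simp only [g2e]; exact tA
  · refine Finset.sum_congr rfl fun i _ => ?_
    rw [g2]
    refine Finset.sum_congr rfl fun j _ => ?_
    rw [T2_symm hS hw hx, g2e, sq]
  · refine Finset.sum_congr rfl fun i _ => ?_
    rw [g3]
    refine Finset.sum_congr rfl fun j _ => ?_
    rw [T3_s12 hS hw hx, sq]
  · rw [t3]
    congr 2
    · refine Finset.sum_congr rfl fun i _ => ?_
      rw [g4]
      refine Finset.sum_congr rfl fun j _ => ?_
      rw [T4_s12 hS hw hx (e i), T4_s23 hS hw hx v (e i)]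
    · refine Finset.sum_congr rfl fun i _ => ?_
      rw [g3]
      refine Finset.sum_congr rfl fun j _ => ?_
      beta_reduce
      rw [T3_s23 hS hw hx v (∑ j, A i j • e j) (e j), g3, Finset.mul_sum]
      refine Finset.sum_congr rfl fun k _ => ?_
      change A i j * A j k * A k i = A i j * (A i k * A j k)
      rw [sA k i]; ring
  · intro ℓ
    refine ⟨∑ i, ℓ (e i) • e i, ?_, ?_⟩
    · simp [sq]
    · simp [he, sq]

lemma alg_trfree (hn : 2 ≤ n) (A : Fin n → Fin n → ℝ) (c : Fin n → ℝ) (m : ℝ) (hc : ∑ i, c i ^ 2 = 1)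
    (ht : ∑ i, A i i = 0) (ha : ∀ i, ∑ j, A i j * c j = m * c i) :
    (1 + 1 / (n:ℝ)) * m ^ 2 ≤ ∑ i, ∑ j, A i j ^ 2 := by
  have hn' : (2:ℝ) ≤ n := by exact_mod_cast hn
  set l : ℝ := m * n / (n - 1) with hl
  have h0 : 0 ≤ ∑ i, ∑ j, (A i j - l * (c i * c j - (if i = j then 1 else 0) / n)) ^ 2 :=
    Finset.sum_nonneg fun i _ => Finset.sum_nonneg fun j _ => sq_nonneg _
  have hq : ∑ i, (∑ j, A i j * c j) * c i = m := by
    calc _ = ∑ i, m * (c i ^ 2) := Finset.sum_congr rfl fun i _ => by rw [ha]; ring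
      _ = m := by rw [← Finset.mul_sum, hc, mul_one]
  have e1 : ∀ i j, (A i j - l * (c i * c j - (if i = j then 1 else 0) / n)) ^ 2
      = A i j ^ 2 - 2 * l * (A i j * c j * c i) + l ^ 2 * (c i ^ 2 * c j ^ 2)
        + (if i = j then 2 * l / n * A i j - 2 * l ^ 2 / n * (c i * c j) + l ^ 2 / n ^ 2 else 0) := by
    intro i j
    split_ifs <;> (field_simp; ring)
  simp only [e1, Finset.sum_add_distrib, Finset.sum_sub_distrib, ← Finset.mul_sum, hq, hc,
    Finset.sum_ite_eq, Finset.mem_univ, if_true, ht, Finset.sum_const, Finset.card_univ,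
    Fintype.card_fin, nsmul_eq_mul, ← Finset.sum_mul, ← sq] at h0
  have h1 : (1 + 1 / (n:ℝ)) ≤ n / (n - 1) := by
    rw [le_div_iff₀ (by linarith)]; field_simp; nlinarith
  have h2 : 2 * l * m - l ^ 2 * (1 - 1 / n) = n / (n - 1) * m ^ 2 := by
    rw [hl]
    have : (n:ℝ) - 1 ≠ 0 := by linarith
    field_simp; ring
  have h3 : (n:ℝ) * (l ^ 2 / n ^ 2) = l ^ 2 * (1 / n) := by field_simp
  have h4 : 2 * l ^ 2 / (n:ℝ) * 1 = 2 * (l ^ 2 * (1 / n)) := by field_simp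
  have h5 : (1 + 1 / (n:ℝ)) * m ^ 2 ≤ n / (n - 1) * m ^ 2 := by gcongr
  rw [← h2] at h5
  nlinarith

lemma alg_cs (A : Fin n → Fin n → ℝ) (c : Fin n → ℝ) (m : ℝ) (hc : ∑ i, c i ^ 2 = 1)
    (ha : ∀ i, ∑ j, A i j * c j = m * c i) :
    m ^ 2 ≤ ∑ i, ∑ j, A i j ^ 2 := by
  calc m ^ 2 = ∑ i, (∑ j, A i j * c j) ^ 2 := by
        simp only [ha, mul_pow, ← Finset.mul_sum, hc, mul_one]
    _ ≤ ∑ i, ∑ j, A i j ^ 2 := by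
        refine Finset.sum_le_sum fun i _ => ?_
        have := Finset.sum_mul_sq_le_sq_mul_sq Finset.univ (A i) c
        rwa [hc, mul_one] at this
end pack

end Part5

section Part6
open Filter Topology
open scoped ContDiff
set_option maxSynthPendingDepth 8

section core
variable {E : Type} [NormedAddCommGroup E] [NormedSpace ℝ E] {S : Set E} {w : E → ℝ} {n : ℕ}

lemma curve_locmax (hS : IsOpen S) (hw : ContDiffOn ℝ ∞ w S) {ε : ℝ} {x : E} (hx : x ∈ S)
    (hs : 0 < - w x - ε) {G : E → E → ℝ} {v : E}
    (hmax : ∀ y ∈ S, w y ≤ -ε → ∀ V, G y V ≤ G x v) (e f : E) :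
    IsLocalMax (fun t : ℝ => G (x + t • e) (v + t • f)) 0 := by
  have h1 := curve_mem hS hx e
  have h2 : ∀ᶠ t : ℝ in 𝓝 0, 0 < - w (x + t • e) - ε := by
    have := (cs hS hw hx e ε).1.self_of_nhds.continuousAt
    exact this.eventually (lt_mem_nhds (by simpa using hs))
  filter_upwards [h1, h2] with t ht1 ht2
  simpa using hmax _ ht1 (by linarith) (v + t • f)

lemma alg_q {N q : ℝ} (hN : 2 ≤ N) (hq0 : 0 < q)
    (h : (1 + 1 / N) * (2 - 4 * N * q) ^ 2 ≤ 8 * N ^ 2 * q + 8 * N * q ^ 2 + 16 * N ^ 2 * q ^ 2) :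
    q ≤ N + 4 := by
  have e : N * ((1 + 1 / N) * (2 - 4 * N * q) ^ 2) = (N + 1) * (2 - 4 * N * q) ^ 2 := by field_simp
  have h' := mul_le_mul_of_nonneg_left h (by linarith : (0:ℝ) ≤ N)
  rw [e] at h'
  have h3 : q * (8 * N ^ 2 * q - 8 * N ^ 3 - 16 * N ^ 2 - 16 * N) ≤ 0 := by nlinarith
  have h4 : 8 * N ^ 2 * q - 8 * N ^ 3 - 16 * N ^ 2 - 16 * N ≤ 0 := nonpos_of_mul_nonpos_right h3 hq0
  by_contra hcon
  push Not at hcon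
  have h5 : 8 * N ^ 2 * (N + 4) < 8 * N ^ 2 * q := by gcongr
  nlinarith

set_option maxHeartbeats 1000000 in
lemma P_core (hMA : MA n S w) (hn : 2 ≤ n) {ε : ℝ} {x : E} (hx : x ∈ S) {v : E}
    (hs : 0 < - w x - ε) (hp : 0 < T1 w x v) (hβ : T2 w x v v = 1)
    (hmax : ∀ y ∈ S, w y ≤ -ε → ∀ V, (- w y - ε) ^ (4 * n) * (T1 w y V) ^ 2 / (T2 w y V V) ^ 1
      ≤ (- w x - ε) ^ (4 * n) * (T1 w x v) ^ 2 / (T2 w x v v) ^ 1) :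
    (T1 w x v) ^ 2 ≤ (n + 4) * (- w x - ε) := by
  have hS := hMA.opn
  have hw := hMA.smooth
  have hn' : (2:ℝ) ≤ n := by exact_mod_cast hn
  have test : ∀ e f : E,
      ((4 * n : ℕ) : ℝ) * (- T1 w x e / (- w x - ε)) + 2 * ((T2 w x e v + T1 w x f) / T1 w x v)
        - (1:ℕ) * (T3 w x e v v + 2 * T2 w x f v) = 0 ∧
      ((4 * n : ℕ) : ℝ) * (- T2 w x e e / (- w x - ε) - (- T1 w x e) ^ 2 / (- w x - ε) ^ 2)
        + 2 * ((T3 w x e e v + 2 * T2 w x e f) / T1 w x v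
          - (T2 w x e v + T1 w x f) ^ 2 / (T1 w x v) ^ 2)
        - (1:ℕ) * ((T4 w x e e v v + 4 * T3 w x e v f + 2 * T2 w x f f)
          - (T3 w x e v v + 2 * T2 w x f v) ^ 2) ≤ 0 := by
    intro e f
    have := log_test (4 * n) 1 (cs hS hw hx e ε).1 (cs hS hw hx e ε).2 (ca hS hw hx e v f).1
      (ca hS hw hx e v f).2 (cb hS hw hx e v f).1 (cb hS hw hx e v f).2 (by simpa using hs)
      (by simpa using hp) (by simpa using hβ)
      (curve_locmax hS hw hx hs (G := fun y V => (- w y - ε) ^ (4 * n) * (T1 w y V) ^ 2 / (T2 w y V V) ^ 1)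
        hmax e f)
    simpa only [zero_smul, add_zero] using this
  obtain ⟨e, g, c, A, he, hc, hc2, tA, a3, ga, t3, tg, gg, eg, t4, -, -⟩ := onb_pack hMA hx v
  set s := - w x - ε with hsdef
  set p := T1 w x v with hpdef
  have hT1 : ∀ z, T1 w x z = p * T2 w x v z := by
    intro z
    have h := (test 0 z).1
    rw [T2_symm hS hw hx z v] at h
    simp only [map_zero, zero_apply, neg_zero, zero_div, mul_zero, zero_add, Nat.cast_one, one_mul] at h
    have : T1 w x z / p = T2 w x v z := by linarith
    rw [← this]; field_simp
  have sy : ∀ z, T2 w x z v = T2 w x v z := fun z => T2_symm hS hw hx z v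
  set m : ℝ := 2 / p - (4 * n) * p / s with hm
  have hone : ∀ i, (∑ j, A i j * c j) = m * c i := by
    intro i
    have h := (test (e i) ((-1/2 : ℝ) • g i)).1
    rw [sy, sy, hT1, hT1, a3, map_smul, ga, hc] at h
    simp only [smul_eq_mul] at h
    push_cast at h
    have e1 : (c i + p * (-1 / 2 * ∑ j, A i j * c j)) / p = c i / p - 1 / 2 * ∑ j, A i j * c j := by
      field_simp
      ring
    rw [e1] at h
    rw [hm]
    have e2 : 4 * (n:ℝ) * (-(p * c i) / s) = - ((4 * n) * p / s * c i) := by ring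
    have e3 : 2 * (c i / p) = 2 / p * c i := by ring
    linear_combination -h + e2 + e3
  have htwo : ∑ i, (((4 * n : ℕ) : ℝ) * (- 1 / s - (p * c i) ^ 2 / s ^ 2)
        + 2 * ((T3 w x (e i) (e i) v - T2 w x (e i) (g i)) / p
          - ((4 * n) * p / (2 * s) * c i) ^ 2)
        - (T4 w x (e i) (e i) v v - 2 * T3 w x (e i) v (g i) + (1/2) * T2 w x (g i) (g i))) ≤ 0 := by
    refine Finset.sum_nonpos fun i _ => ?_
    have h := (test (e i) ((-1/2 : ℝ) • g i)).2
    rw [sy, sy, hT1, hT1, a3] at h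
    simp only [map_smul, smul_apply, smul_eq_mul] at h
    rw [ga, hc, hone, he] at h
    have e1 : (c i + p * (-1 / 2 * (m * c i))) = ((4 * n) * p / (2 * s) * c i) * p := by
      rw [hm]; field_simp; ring
    rw [e1, mul_pow, mul_div_assoc, div_self (by positivity), mul_one] at h
    refine le_trans (le_of_eq ?_) h
    push_cast
    ring
  have e1 : ∀ i, (((4 * n : ℕ) : ℝ) * (- 1 / s - (p * c i) ^ 2 / s ^ 2)
        + 2 * ((T3 w x (e i) (e i) v - T2 w x (e i) (g i)) / p
          - ((4 * n) * p / (2 * s) * c i) ^ 2)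
        - (T4 w x (e i) (e i) v v - 2 * T3 w x (e i) v (g i) + (1/2) * T2 w x (g i) (g i)))
      = - (4 * n) / s - ((4 * n) * p ^ 2 / s ^ 2 + 8 * n ^ 2 * p ^ 2 / s ^ 2) * c i ^ 2
       + 2 / p * T3 w x (e i) (e i) v - 2 / p * T2 w x (e i) (g i)
       - T4 w x (e i) (e i) v v + 2 * T3 w x (e i) v (g i) - (1/2) * T2 w x (g i) (g i) := by
    intro i
    push_cast
    field_simp
    ring
  simp only [e1, Finset.sum_add_distrib, Finset.sum_sub_distrib, ← Finset.mul_sum, t3, tg, gg, eg, t4,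
    hc2, hβ, Finset.sum_const, Finset.card_univ, Fintype.card_fin, nsmul_eq_mul] at htwo
  have hA := alg_trfree hn A c m (by rw [hc2, hβ]) tA hone
  set Q := ∑ i, ∑ j, A i j ^ 2
  have hm2 : m = (2 - 4 * n * (p ^ 2 / s)) / p := by rw [hm]; field_simp
  have hA2 : (1 + 1 / (n:ℝ)) * (2 - 4 * n * (p ^ 2 / s)) ^ 2 ≤ Q * p ^ 2 := by
    have := mul_le_mul_of_nonneg_right hA (sq_nonneg p)
    refine le_trans (le_of_eq ?_) this
    rw [hm2]; field_simp
  have hQ : Q * p ^ 2 ≤ 8 * n ^ 2 * (p ^ 2 / s) + 8 * n * (p ^ 2 / s) ^ 2 + 16 * n ^ 2 * (p ^ 2 / s) ^ 2 := by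
    have : Q ≤ 2 * (4 * n ^ 2 / s + 4 * n * p ^ 2 / s ^ 2 + 8 * n ^ 2 * p ^ 2 / s ^ 2) := by
      have r : (n:ℝ) * (-(4 * n) / s) = - (4 * n ^ 2 / s) := by ring
      linarith
    have := mul_le_mul_of_nonneg_right this (sq_nonneg p)
    refine le_trans this (le_of_eq ?_)
    field_simp; ring
  set q := p ^ 2 / s with hq
  have hq0 : 0 < q := by positivity
  have : q ≤ n + 4 := alg_q hn' hq0 (hA2.trans hQ)
  rw [hq, div_le_iff₀ hs] at this
  exact this
end core

end Part6

section Part7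
open Filter Topology
open scoped ContDiff
set_option maxSynthPendingDepth 8

section est
variable {E : Type} [NormedAddCommGroup E] [NormedSpace ℝ E] {S : Set E} {w : E → ℝ} {n : ℕ}

lemma psd_of (hMA : MA n S w) {x : E} (hx : x ∈ S) (v : E) : 0 ≤ T2 w x v v := by
  rcases eq_or_ne v 0 with rfl | h
  · simp
  · exact (hMA.pos x hx v h).le

lemma P_est [ProperSpace E] (hMA : MA n S w) (hn : 2 ≤ n) {ε Λ : ℝ} (hε : 0 ≤ ε)
    (hK : IsCompact {x | x ∈ S ∧ w x ≤ -ε}) (hΛ : ∀ x ∈ S, -Λ ≤ w x) (hΛ0 : 0 ≤ Λ) :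
    ∀ y ∈ S, w y ≤ -ε → ∀ V, (- w y - ε) ^ (4 * n) * (T1 w y V) ^ 2
      ≤ (n + 4) * Λ ^ (4 * n + 1) * T2 w y V V := by
  have hS := hMA.opn
  have hw := hMA.smooth
  have s1 := smooth_fderiv hS hw
  have s2 := smooth_fderiv hS s1
  have key := max_principle (E := E) (K := {x | x ∈ S ∧ w x ≤ -ε})
    (G := fun y V => (- w y - ε) ^ (4 * n) * (T1 w y V) ^ 2 / (T2 w y V V) ^ 1)
    (M := (n + 4) * Λ ^ (4 * n + 1)) hK ?_ ?_ ?_ (by positivity) ?_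
  · intro y hy hyε V
    rcases eq_or_ne V 0 with rfl | hV
    · simp
    have h := key y ⟨hy, hyε⟩ V
    simp only [pow_one] at h
    rwa [div_le_iff₀ (hMA.pos y hy V hV)] at h
  · have c0 : ContinuousOn (fun q : E × E => w q.1) ({x | x ∈ S ∧ w x ≤ -ε} ×ˢ Metric.sphere (0:E) 1) :=
      hw.continuousOn.comp continuousOn_fst fun q hq => hq.1.1
    have c1 : ContinuousOn (fun q : E × E => T1 w q.1) ({x | x ∈ S ∧ w x ≤ -ε} ×ˢ Metric.sphere (0:E) 1) :=
      s1.continuousOn.comp continuousOn_fst fun q hq => hq.1.1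
    have c2 : ContinuousOn (fun q : E × E => T2 w q.1) ({x | x ∈ S ∧ w x ≤ -ε} ×ˢ Metric.sphere (0:E) 1) :=
      s2.continuousOn.comp continuousOn_fst fun q hq => hq.1.1
    have cv : ContinuousOn (fun q : E × E => q.2) ({x | x ∈ S ∧ w x ≤ -ε} ×ˢ Metric.sphere (0:E) 1) :=
      continuousOn_snd
    refine (((c0.neg.sub continuousOn_const).pow _).mul ((c1.clm_apply cv).pow 2)).div
      (((c2.clm_apply cv).clm_apply cv).pow 1) ?_
    intro q hq
    have : q.2 ≠ 0 := by
      intro h; have := hq.2; rw [h] at this; simp at this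
    have := hMA.pos q.1 hq.1.1 q.2 this
    simp only [pow_one]; exact this.ne'
  · intro y hy V c hc
    simp only [map_smul, smul_apply, smul_eq_mul, pow_one, mul_pow]
    rw [show (-w y - ε) ^ (4 * n) * (c ^ 2 * T1 w y V ^ 2) = (c * c) * ((-w y - ε) ^ (4 * n) * T1 w y V ^ 2) by ring,
      ← mul_assoc c c, mul_div_mul_left _ _ (by positivity)]
  · intro y hy; simp
  · intro x hx v hv hpos hmax
    have hxS := hx.1
    have b0 := hMA.pos x hxS v hv
    have hs0 : 0 ≤ - w x - ε := by linarith [hx.2]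
    have hs : 0 < - w x - ε := by
      rcases hs0.lt_or_eq with h | h
      · exact h
      · rw [← h, zero_pow (by omega)] at hpos; simp at hpos
    have hT : T1 w x v ≠ 0 := by
      intro h; rw [h] at hpos; simp at hpos
    obtain ⟨c, hc1, hc2, hc3⟩ : ∃ c : ℝ, c ≠ 0 ∧ 0 < c * T1 w x v ∧ c * c * T2 w x v v = 1 := by
      have hq : 0 < Real.sqrt (T2 w x v v) := Real.sqrt_pos.2 b0
      have hqq : Real.sqrt (T2 w x v v) ^ 2 = T2 w x v v := Real.sq_sqrt b0.le
      rcases lt_or_gt_of_ne hT with h | h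
      · refine ⟨-(Real.sqrt (T2 w x v v))⁻¹, by simp [hq.ne'], ?_, ?_⟩
        · have : 0 < (Real.sqrt (T2 w x v v))⁻¹ := by positivity
          nlinarith
        · nth_rw 3 [← hqq]; field_simp
      · refine ⟨(Real.sqrt (T2 w x v v))⁻¹, by simp [hq.ne'], by positivity, ?_⟩
        nth_rw 3 [← hqq]; field_simp
    have hG : (-w x - ε) ^ (4 * n) * (T1 w x (c • v)) ^ 2 / (T2 w x (c • v) (c • v)) ^ 1
        = (-w x - ε) ^ (4 * n) * (T1 w x v) ^ 2 / (T2 w x v v) ^ 1 := by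
      simp only [map_smul, smul_apply, smul_eq_mul, pow_one, mul_pow]
      rw [show (-w x - ε) ^ (4 * n) * (c ^ 2 * T1 w x v ^ 2) = (c * c) * ((-w x - ε) ^ (4 * n) * T1 w x v ^ 2) by ring,
        ← mul_assoc c c, mul_div_mul_left _ _ (by positivity)]
    have hb : T2 w x (c • v) (c • v) = 1 := by
      simp only [map_smul, smul_apply, smul_eq_mul]; linarith
    have := P_core hMA hn hxS (v := c • v) hs (by simpa using hc2) hb
      (fun y hy hy2 V => by rw [hG]; exact hmax y ⟨hy, hy2⟩ V)
    rw [← hG, hb, pow_one, div_one]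
    have hsΛ : - w x - ε ≤ Λ := by linarith [hΛ x hxS]
    calc (-w x - ε) ^ (4 * n) * (T1 w x (c • v)) ^ 2
        ≤ (-w x - ε) ^ (4 * n) * ((n + 4) * (- w x - ε)) := by gcongr
      _ = (n + 4) * (-w x - ε) ^ (4 * n + 1) := by ring
      _ ≤ _ := by gcongr

set_option maxHeartbeats 2000000 in
lemma Q_core (hMA : MA n S w) {ε CP : ℝ} {x : E} (hx : x ∈ S) {v : E}
    (hs : 0 < - w x - ε) (hp : 0 < T3 w x v v v) (hβ : T2 w x v v = 1)
    (hP : ∀ V, (- w x - ε) ^ (4 * n) * (T1 w x V) ^ 2 ≤ CP * T2 w x V V) (hCP : 0 ≤ CP)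
    (hmax : ∀ y ∈ S, w y ≤ -ε → ∀ V, (- w y - ε) ^ (4 * n + 2) * (T3 w y V V V) ^ 2 / (T2 w y V V) ^ 3
      ≤ (- w x - ε) ^ (4 * n + 2) * (T3 w x v v v) ^ 2 / (T2 w x v v) ^ 3) :
    (- w x - ε) ^ (4 * n + 2) * (T3 w x v v v) ^ 2
      ≤ 4 * (2 * n + 1) * n * (- w x - ε) ^ (4 * n + 1)
        + 4 * ((2 * n + 1) + (2 * n + 1) ^ 2) * CP := by
  have hS := hMA.opn
  have hw := hMA.smooth
  have test : ∀ e f : E,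
      ((4 * n + 2 : ℕ) : ℝ) * (- T1 w x e / (- w x - ε))
        + 2 * ((T4 w x e v v v + 3 * T3 w x f v v) / T3 w x v v v)
        - (3:ℕ) * (T3 w x e v v + 2 * T2 w x f v) = 0 ∧
      ((4 * n + 2 : ℕ) : ℝ) * (- T2 w x e e / (- w x - ε) - (- T1 w x e) ^ 2 / (- w x - ε) ^ 2)
        + 2 * ((T5 w x e e v v v + 6 * T4 w x e v v f + 6 * T3 w x v f f) / T3 w x v v v
          - (T4 w x e v v v + 3 * T3 w x f v v) ^ 2 / (T3 w x v v v) ^ 2)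
        - (3:ℕ) * ((T4 w x e e v v + 4 * T3 w x e v f + 2 * T2 w x f f)
          - (T3 w x e v v + 2 * T2 w x f v) ^ 2) ≤ 0 := by
    intro e f
    have := log_test (4 * n + 2) 3 (cs hS hw hx e ε).1 (cs hS hw hx e ε).2 (cg hS hw hx e v f).1
      (cg hS hw hx e v f).2 (cb hS hw hx e v f).1 (cb hS hw hx e v f).2 (by simpa using hs)
      (by simpa using hp) (by simpa using hβ)
      (curve_locmax hS hw hx hs (G := fun y V =>
        (- w y - ε) ^ (4 * n + 2) * (T3 w y V V V) ^ 2 / (T2 w y V V) ^ 3) hmax e f)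
    simpa only [zero_smul, add_zero] using this
  obtain ⟨e, g, c, A, he, hc, hc2, tA, a3, ga, t3, tg, gg, eg, t4, t5, hl⟩ := onb_pack hMA hx v
  obtain ⟨z, hz1, hz2⟩ := hl (T1 w x)
  set s := - w x - ε with hsdef
  set p := T3 w x v v v with hpdef
  have sy : ∀ z, T2 w x z v = T2 w x v z := fun z => T2_symm hS hw hx z v
  have hT3 : ∀ z, T3 w x z v v = p * T2 w x v z := by
    intro z
    have h := (test 0 z).1
    rw [sy] at h
    simp only [map_zero, zero_apply, neg_zero, zero_div, mul_zero, zero_add] at h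
    push_cast at h
    have : T3 w x z v v / p = T2 w x v z := by
      have e0 : 3 * T3 w x z v v / p = 3 * (T3 w x z v v / p) := by ring
      linarith
    rw [← this]; field_simp
  have hcs : ∀ z, (T2 w x v z) ^ 2 ≤ T2 w x z z := by
    intro z
    have := psd_of hMA hx (z - T2 w x v z • v)
    simp only [map_sub, map_smul, sub_apply, smul_apply, smul_eq_mul, sy, hβ] at this
    nlinarith
  have hvgg : ∀ z, T3 w x v z z ≤ p * T2 w x z z := by
    intro z
    have h := (test 0 z).2
    rw [sy, hT3] at h
    simp only [map_zero, zero_apply, neg_zero, zero_div, mul_zero, zero_add, ne_eq, OfNat.ofNat_ne_zero,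
      not_false_eq_true, zero_pow, sub_zero] at h
    have e0 : (3 * (p * T2 w x v z)) ^ 2 / p ^ 2 = 9 * (T2 w x v z) ^ 2 := by field_simp; ring
    rw [e0] at h
    push_cast at h
    have e1 : 6 * T3 w x v z z / p = 6 * (T3 w x v z z / p) := by ring
    have h2 := hcs z
    have : T3 w x v z z / p ≤ T2 w x z z := by nlinarith
    rw [div_le_iff₀ hp] at this; linarith
  have hone : ∀ i, (∑ j, A i j * c j) = p * c i := by
    intro i
    rw [← a3, hT3, hc]
  have hg1 : ∀ i, T4 w x (e i) v v v + 3 * T3 w x ((-1/2 : ℝ) • g i) v v = (2 * n + 1) * T1 w x (e i) / s * p := by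
    intro i
    have h := (test (e i) ((-1/2 : ℝ) • g i)).1
    rw [sy, hT3 (e i), map_smul (T2 w x v), ga, hone, hc, smul_eq_mul] at h
    push_cast at h
    have e0 : (T4 w x (e i) v v v + 3 * T3 w x ((-1/2 : ℝ) • g i) v v) / p = (2 * n + 1) * T1 w x (e i) / s := by
      linear_combination h / 2
    rw [← e0]; field_simp
  have htwo : ∑ i, (((4 * n + 2 : ℕ) : ℝ) * (- 1 / s - (T1 w x (e i)) ^ 2 / s ^ 2)
        + 2 * ((T5 w x (e i) (e i) v v v - 3 * T4 w x (e i) v v (g i) + (3/2) * T3 w x v (g i) (g i)) / p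
          - ((2 * n + 1) * T1 w x (e i) / s) ^ 2)
        - 3 * (T4 w x (e i) (e i) v v - 2 * T3 w x (e i) v (g i) + (1/2) * T2 w x (g i) (g i))) ≤ 0 := by
    refine Finset.sum_nonpos fun i _ => ?_
    have h := (test (e i) ((-1/2 : ℝ) • g i)).2
    rw [hg1, sy, hT3 (e i)] at h
    simp only [map_smul, smul_apply, smul_eq_mul] at h
    rw [ga, hc, hone, he, mul_pow, mul_div_assoc, div_self (by positivity), mul_one] at h
    refine le_trans (le_of_eq ?_) h
    push_cast
    ring
  set P := ∑ i, (T1 w x (e i)) ^ 2 with hPdef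
  have e1 : ∀ i, (((4 * n + 2 : ℕ) : ℝ) * (- 1 / s - (T1 w x (e i)) ^ 2 / s ^ 2)
        + 2 * ((T5 w x (e i) (e i) v v v - 3 * T4 w x (e i) v v (g i) + (3/2) * T3 w x v (g i) (g i)) / p
          - ((2 * n + 1) * T1 w x (e i) / s) ^ 2)
        - 3 * (T4 w x (e i) (e i) v v - 2 * T3 w x (e i) v (g i) + (1/2) * T2 w x (g i) (g i)))
      = - (4 * n + 2) / s - ((4 * n + 2) / s ^ 2 + 2 * (2 * n + 1) ^ 2 / s ^ 2) * (T1 w x (e i)) ^ 2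
       + 2 / p * T5 w x (e i) (e i) v v v - 6 / p * T4 w x (e i) v v (g i) + 3 / p * T3 w x v (g i) (g i)
       - 3 * T4 w x (e i) (e i) v v + 6 * T3 w x (e i) v (g i) - (3/2) * T2 w x (g i) (g i) := by
    intro i
    push_cast
    field_simp
    ring
  have hB : ∑ i, T3 w x v (g i) (g i) ≤ p * ∑ i, T2 w x (g i) (g i) := by
    rw [Finset.mul_sum]; exact Finset.sum_le_sum fun i _ => hvgg _
  simp only [e1, Finset.sum_add_distrib, Finset.sum_sub_distrib, ← Finset.mul_sum, t5, gg, eg, t4,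
    ← hPdef, Finset.sum_const, Finset.card_univ, Fintype.card_fin, nsmul_eq_mul] at htwo
  rw [gg] at hB
  have hA := alg_cs A c p (by rw [hc2, hβ]) hone
  set Q := ∑ i, ∑ j, A i j ^ 2
  set B := ∑ i, T3 w x v (g i) (g i)
  set D := ∑ i, T4 w x (e i) v v (g i)
  have hP0 : 0 ≤ P := Finset.sum_nonneg fun i _ => sq_nonneg _
  have hPP : s ^ (4 * n) * P ≤ CP := by
    have := hP z
    rw [hz1, hz2] at this
    rcases hP0.lt_or_eq with h | h
    · have h2 : (s ^ (4 * n) * P) * P ≤ CP * P := by linarith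
      exact le_of_mul_le_mul_right h2 h
    · rw [← h]; simpa using hCP
  have hB' : B / p ≤ Q := by rw [div_le_iff₀ hp]; linarith
  have hmu : p ^ 2 ≤ 4 * (2 * n + 1) * n / s + 4 * ((2 * n + 1) + (2 * n + 1) ^ 2) * P / s ^ 2 := by
    have r : 2 / p * (3 * D - 2 * B) - 6 / p * D + 3 / p * B = - (B / p) := by field_simp; ring
    have r2 : (n:ℝ) * (-(4 * n + 2) / s) = - ((4 * (2 * n + 1) * n / s) / 2) := by field_simp; ring
    have r3 : (((4 * n + 2) / s ^ 2 + 2 * (2 * n + 1) ^ 2 / s ^ 2) * P : ℝ)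
       = (4 * ((2 * n + 1) + (2 * n + 1) ^ 2) * P / s ^ 2) / 2 := by field_simp; ring
    linarith
  calc s ^ (4 * n + 2) * p ^ 2
      ≤ s ^ (4 * n + 2) * (4 * (2 * n + 1) * n / s + 4 * ((2 * n + 1) + (2 * n + 1) ^ 2) * P / s ^ 2) := by
        gcongr
    _ = 4 * (2 * n + 1) * n * s ^ (4 * n + 1)
        + 4 * ((2 * n + 1) + (2 * n + 1) ^ 2) * (s ^ (4 * n) * P) := by
        field_simp
        ring
    _ ≤ _ := by gcongr
end est

end Part7

section Part8
open Filter Topology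
open scoped ContDiff
set_option maxSynthPendingDepth 8

def CPc (n : ℕ) (Λ : ℝ) : ℝ := (n + 4) * Λ ^ (4 * n + 1)
def CQc (n : ℕ) (Λ : ℝ) : ℝ := 4 * (2 * n + 1) * n * Λ ^ (4 * n + 1)
        + 4 * ((2 * n + 1) + (2 * n + 1) ^ 2) * CPc n Λ

section est
variable {E : Type} [NormedAddCommGroup E] [NormedSpace ℝ E] {S : Set E} {w : E → ℝ} {n : ℕ}

lemma Q_est [ProperSpace E] (hMA : MA n S w) (hn : 2 ≤ n) {ε Λ : ℝ} (hε : 0 ≤ ε)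
    (hK : IsCompact {x | x ∈ S ∧ w x ≤ -ε}) (hΛ : ∀ x ∈ S, -Λ ≤ w x) (hΛ0 : 0 ≤ Λ) :
    ∀ y ∈ S, w y ≤ -ε → ∀ V, (- w y - ε) ^ (4 * n + 2) * (T3 w y V V V) ^ 2
      ≤ CQc n Λ * (T2 w y V V) ^ 3 := by
  have hS := hMA.opn
  have hw := hMA.smooth
  have hPe := P_est hMA hn hε hK hΛ hΛ0
  have hCP : 0 ≤ CPc n Λ := by unfold CPc; positivity
  have s1 := smooth_fderiv hS hw
  have s2 := smooth_fderiv hS s1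
  have s3 := smooth_fderiv hS s2
  have hom : ∀ y V (c : ℝ), c ≠ 0 →
      (- w y - ε) ^ (4 * n + 2) * (T3 w y (c • V) (c • V) (c • V)) ^ 2 / (T2 w y (c • V) (c • V)) ^ 3
      = (- w y - ε) ^ (4 * n + 2) * (T3 w y V V V) ^ 2 / (T2 w y V V) ^ 3 := by
    intro y V c hc
    simp only [map_smul, smul_apply, smul_eq_mul, mul_pow]
    rw [show (-w y - ε) ^ (4 * n + 2) * (c ^ 2 * (c ^ 2 * (c ^ 2 * T3 w y V V V ^ 2)))
        = (c ^ 3 * c ^ 3) * ((-w y - ε) ^ (4 * n + 2) * T3 w y V V V ^ 2) by ring,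
      ← mul_assoc (c ^ 3) (c ^ 3), mul_div_mul_left _ _ (by positivity)]
  have key := max_principle (E := E) (K := {x | x ∈ S ∧ w x ≤ -ε})
    (G := fun y V => (- w y - ε) ^ (4 * n + 2) * (T3 w y V V V) ^ 2 / (T2 w y V V) ^ 3)
    (M := CQc n Λ) hK ?_ ?_ ?_ (by unfold CQc; positivity) ?_
  · intro y hy hyε V
    rcases eq_or_ne V 0 with rfl | hV
    · simp
    have h := key y ⟨hy, hyε⟩ V
    rwa [div_le_iff₀ (pow_pos (hMA.pos y hy V hV) 3)] at h
  · have c0 : ContinuousOn (fun q : E × E => w q.1) ({x | x ∈ S ∧ w x ≤ -ε} ×ˢ Metric.sphere (0:E) 1) :=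
      hw.continuousOn.comp continuousOn_fst fun q hq => hq.1.1
    have c1 : ContinuousOn (fun q : E × E => T3 w q.1) ({x | x ∈ S ∧ w x ≤ -ε} ×ˢ Metric.sphere (0:E) 1) :=
      s3.continuousOn.comp continuousOn_fst fun q hq => hq.1.1
    have c2 : ContinuousOn (fun q : E × E => T2 w q.1) ({x | x ∈ S ∧ w x ≤ -ε} ×ˢ Metric.sphere (0:E) 1) :=
      s2.continuousOn.comp continuousOn_fst fun q hq => hq.1.1
    have cv : ContinuousOn (fun q : E × E => q.2) ({x | x ∈ S ∧ w x ≤ -ε} ×ˢ Metric.sphere (0:E) 1) :=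
      continuousOn_snd
    refine (((c0.neg.sub continuousOn_const).pow _).mul
      ((((c1.clm_apply cv).clm_apply cv).clm_apply cv).pow 2)).div
      (((c2.clm_apply cv).clm_apply cv).pow 3) ?_
    intro q hq
    have : q.2 ≠ 0 := by
      intro h; have := hq.2; rw [h] at this; simp at this
    have := hMA.pos q.1 hq.1.1 q.2 this
    exact (pow_pos this 3).ne'
  · intro y hy V c hc
    exact hom y V c hc.ne'
  · intro y hy; simp
  · intro x hx v hv hpos hmax
    have hxS := hx.1
    have b0 := hMA.pos x hxS v hv
    have hs0 : 0 ≤ - w x - ε := by linarith [hx.2]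
    have hs : 0 < - w x - ε := by
      rcases hs0.lt_or_eq with h | h
      · exact h
      · rw [← h, zero_pow (by omega)] at hpos; simp at hpos
    have hT : T3 w x v v v ≠ 0 := by
      intro h; rw [h] at hpos; simp at hpos
    obtain ⟨c, hc1, hc2, hc3⟩ : ∃ c : ℝ, c ≠ 0 ∧ 0 < c * T3 w x v v v ∧ c * c * T2 w x v v = 1 := by
      have hq : 0 < Real.sqrt (T2 w x v v) := Real.sqrt_pos.2 b0
      have hqq : Real.sqrt (T2 w x v v) ^ 2 = T2 w x v v := Real.sq_sqrt b0.le
      rcases lt_or_gt_of_ne hT with h | h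
      · refine ⟨-(Real.sqrt (T2 w x v v))⁻¹, by simp [hq.ne'], ?_, ?_⟩
        · have : 0 < (Real.sqrt (T2 w x v v))⁻¹ := by positivity
          nlinarith
        · nth_rw 3 [← hqq]; field_simp
      · refine ⟨(Real.sqrt (T2 w x v v))⁻¹, by simp [hq.ne'], by positivity, ?_⟩
        nth_rw 3 [← hqq]; field_simp
    have hG := hom x v c hc1
    have hb : T2 w x (c • v) (c • v) = 1 := by
      simp only [map_smul, smul_apply, smul_eq_mul]; linarith
    have hq : 0 < T3 w x (c • v) (c • v) (c • v) := by
      simp only [map_smul, smul_apply, smul_eq_mul]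
      have : 0 < c ^ 2 * (c * T3 w x v v v) := by positivity
      linarith
    have := Q_core hMA hxS (v := c • v) hs hq hb (hPe x hxS hx.2) hCP
      (fun y hy hy2 V => by rw [hG]; exact hmax y ⟨hy, hy2⟩ V)
    rw [← hG, hb, one_pow, div_one]
    have hsΛ : - w x - ε ≤ Λ := by linarith [hΛ x hxS]
    refine this.trans ?_
    unfold CQc
    gcongr
    exact le_rfl
end est

end Part8

section Part9
open Filter Topology
open scoped ContDiff
set_option maxSynthPendingDepth 8

lemma mvt0 {F F' : ℝ → ℝ} {t C : ℝ} (ht : 0 ≤ t)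
    (h : ∀ τ ∈ Set.Icc 0 t, HasDerivAt F (F' τ) τ) (hb : ∀ τ ∈ Set.Icc 0 t, |F' τ| ≤ C) :
    |F t - F 0| ≤ C * t := by
  have := Convex.norm_image_sub_le_of_norm_hasDerivWithin_le (f := F) (f' := F') (C := C)
    (s := Set.Icc 0 t) (x := 0) (y := t)
    (fun τ hτ => (h τ hτ).hasDerivWithinAt) (fun τ hτ => by simpa using hb τ hτ)
    (convex_Icc 0 t) ⟨le_rfl, ht⟩ ⟨ht, le_rfl⟩
  simpa [abs_of_nonneg ht] using this

section est
variable {E : Type} [NormedAddCommGroup E] [NormedSpace ℝ E] {S : Set E} {w : E → ℝ} {n : ℕ}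

lemma local_exp (hMA : MA n S w) (h0 : (0:E) ∈ S) (hw0 : w 0 ≤ -1/8)
    (hK : IsCompact {x | x ∈ S ∧ w x ≤ -1/16}) {p0 K r0 : ℝ} (hp0 : 0 < p0) (hK0 : 0 < K)
    (hP : ∀ y ∈ S, w y ≤ -1/16 → ∀ V, (T1 w y V) ^ 2 ≤ p0 ^ 2 * T2 w y V V)
    (hQ : ∀ y ∈ S, w y ≤ -1/16 → ∀ V, (T3 w y V V V) ^ 2 ≤ K ^ 2 * (T2 w y V V) ^ 3)
    (hr1 : r0 * p0 ≤ 1/64) (hr2 : r0 * K ≤ 1/8) (v : E) (hv : T2 w 0 v v = 1) :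
    ∀ t ∈ Set.Icc 0 r0, t • v ∈ S ∧
      |w (t • v) - w 0 - t * T1 w 0 v - t ^ 2 / 2| ≤ 8 * K * t ^ 3 := by
  have hS := hMA.opn
  have hw := hMA.smooth
  have s1 := smooth_fderiv hS hw
  have s2 := smooth_fderiv hS s1
  have hc := fun (z : E) (t : ℝ) => hasDerivAt_const t z
  have d0 : ∀ t : ℝ, t • v ∈ S → HasDerivAt (fun t : ℝ => w (t • v)) (T1 w (t • v) v) t := by
    intro t ht
    have := smooth_curve hS hw (x := 0) (e := v) (t := t) (by simpa using ht)
    simpa using this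
  have d1 : ∀ t : ℝ, t • v ∈ S → HasDerivAt (fun t : ℝ => T1 w (t • v) v) (T2 w (t • v) v v) t := by
    intro t ht
    have := (smooth_curve hS s1 (x := 0) (e := v) (t := t) (by simpa using ht)).clm_apply (hc v t)
    simpa using this
  have d2 : ∀ t : ℝ, t • v ∈ S → HasDerivAt (fun t : ℝ => T2 w (t • v) v v) (T3 w (t • v) v v v) t := by
    intro t ht
    have := ((smooth_curve hS s2 (x := 0) (e := v) (t := t) (by simpa using ht)).clm_apply
      (hc v t)).clm_apply (hc v t)
    simpa using this
  set Gd : Set ℝ := {t | t • v ∈ {x | x ∈ S ∧ w x ≤ -1/16} ∧ T2 w (t • v) v v ≤ 4} with hGd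
  -- bounds on a good interval
  have bnd : ∀ t, 0 ≤ t → (∀ τ ∈ Set.Icc 0 t, τ ∈ Gd) →
      (∀ τ ∈ Set.Icc 0 t, |T1 w (τ • v) v| ≤ 2 * p0) ∧ (∀ τ ∈ Set.Icc 0 t, |T3 w (τ • v) v v v| ≤ 8 * K) := by
    intro t ht hg
    constructor
    · intro τ hτ
      obtain ⟨⟨a1, a2⟩, a3⟩ := hg τ hτ
      refine abs_le_of_sq_le_sq ?_ (by positivity)
      refine (hP _ a1 a2 v).trans ?_
      nlinarith [sq_nonneg p0]
    · intro τ hτ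
      obtain ⟨⟨a1, a2⟩, a3⟩ := hg τ hτ
      refine abs_le_of_sq_le_sq ?_ (by positivity)
      refine (hQ _ a1 a2 v).trans ?_
      have : T2 w (τ • v) v v ^ 3 ≤ 4 ^ 3 := pow_le_pow_left₀ (psd_of hMA a1 v) a3 3
      nlinarith [sq_nonneg K]
  have hclosed : IsClosed Gd := by
    have hc2 : ContinuousOn (fun x => T2 w x v v) {x | x ∈ S ∧ w x ≤ -1/16} :=
      ((s2.continuousOn.mono fun x hx => hx.1).clm_apply continuousOn_const).clm_apply continuousOn_const
    have h1 : IsClosed ({x | x ∈ S ∧ w x ≤ -1/16} ∩ (fun x => T2 w x v v) ⁻¹' Set.Iic 4) :=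
      hc2.preimage_isClosed_of_isClosed hK.isClosed isClosed_Iic
    exact h1.preimage (by fun_prop : Continuous fun t : ℝ => t • v)
  have g0 : (0:ℝ) ∈ Gd := by
    simp only [hGd, Set.mem_ofPred_eq, zero_smul]
    exact ⟨⟨h0, by linarith⟩, by rw [hv]; norm_num⟩
  have all : ∀ t ∈ Set.Icc 0 r0, t ∈ Gd := by
    by_contra hcon
    push Not at hcon
    obtain ⟨b, hb, hbG⟩ := hcon
    set Bd : Set ℝ := {t | t ∈ Set.Icc 0 r0 ∧ t ∉ Gd} with hBd
    have hne : Bd.Nonempty := ⟨b, hb, hbG⟩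
    have hbb : BddBelow Bd := ⟨0, fun t ht => ht.1.1⟩
    set T := sInf Bd with hT
    have hT0 : 0 ≤ T := le_csInf hne fun t ht => ht.1.1
    have hTr : T ≤ r0 := (csInf_le hbb ⟨hb, hbG⟩).trans hb.2
    have hlt : ∀ τ, 0 ≤ τ → τ < T → τ ∈ Gd := by
      intro τ h1 h2
      by_contra h3
      exact absurd (csInf_le hbb (show τ ∈ Bd from ⟨⟨h1, by linarith⟩, h3⟩)) (not_le.2 h2)
    have hTG : T ∈ Gd := by
      rcases hT0.lt_or_eq with h | h
      · have h1 : Set.Ico 0 T ⊆ Gd := fun τ hτ => hlt τ hτ.1 hτ.2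
        have h2 := closure_minimal h1 hclosed
        rw [closure_Ico h.ne] at h2
        exact h2 ⟨hT0, le_rfl⟩
      · rw [← h]; exact g0
    have hgood : ∀ τ ∈ Set.Icc 0 T, τ ∈ Gd := by
      intro τ hτ
      rcases hτ.2.lt_or_eq with h | h
      · exact hlt τ hτ.1 h
      · rw [h]; exact hTG
    obtain ⟨b1, b3⟩ := bnd T hT0 hgood
    have m1 := mvt0 hT0 (fun τ hτ => d0 τ (hgood τ hτ).1.1) b1
    have m2 := mvt0 hT0 (fun τ hτ => d2 τ (hgood τ hτ).1.1) b3
    simp only [zero_smul] at m1 m2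
    have hTp : T * p0 ≤ 1/64 := le_trans (by gcongr) hr1
    have hTK : T * K ≤ 1/8 := le_trans (by gcongr) hr2
    have k1 : w (T • v) < -1/16 := by have := (abs_le.1 m1).2; linarith
    have k2 : T2 w (T • v) v v < 4 := by
      have := (abs_le.1 m2).2; rw [hv] at this; linarith
    have hTS := hTG.1.1
    have ev : ∀ᶠ t : ℝ in 𝓝 T, t ∈ Gd := by
      have c1 := (d0 T hTS).continuousAt.eventually (gt_mem_nhds k1)
      have c2 := (d2 T hTS).continuousAt.eventually (gt_mem_nhds k2)
      have c3 : ∀ᶠ t : ℝ in 𝓝 T, t • v ∈ S :=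
        (by fun_prop : Continuous fun t : ℝ => t • v).continuousAt.eventually (hS.mem_nhds hTS)
      filter_upwards [c1, c2, c3] with t h1 h2 h3
      exact ⟨⟨h3, h1.le⟩, h2.le⟩
    obtain ⟨η, hη, hη2⟩ := Metric.eventually_nhds_iff.1 ev
    obtain ⟨τ, hτ, hτ2⟩ := exists_lt_of_csInf_lt hne (show sInf Bd < T + η by linarith)
    have : T ≤ τ := csInf_le hbb hτ
    exact hτ.2 (hη2 (by rw [Real.dist_eq, abs_lt]; constructor <;> linarith))
  intro t ht
  have hgood : ∀ τ ∈ Set.Icc 0 t, τ ∈ Gd := fun τ hτ => all τ ⟨hτ.1, hτ.2.trans ht.2⟩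
  refine ⟨(hgood t ⟨ht.1, le_rfl⟩).1.1, ?_⟩
  obtain ⟨b1, b3⟩ := bnd t ht.1 hgood
  have a2 : ∀ τ ∈ Set.Icc 0 t, |T2 w (τ • v) v v - 1| ≤ 8 * K * t := by
    intro τ hτ
    have hsub : ∀ σ ∈ Set.Icc 0 τ, σ ∈ Set.Icc 0 t := fun σ hσ => ⟨hσ.1, hσ.2.trans hτ.2⟩
    have := mvt0 hτ.1 (fun σ hσ => d2 σ (hgood σ (hsub σ hσ)).1.1) (fun σ hσ => b3 σ (hsub σ hσ))
    simp only [zero_smul, hv] at this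
    exact this.trans (by gcongr; exact hτ.2)
  have a1 : ∀ τ ∈ Set.Icc 0 t, |T1 w (τ • v) v - T1 w 0 v - τ| ≤ 8 * K * t * t := by
    intro τ hτ
    have hsub : ∀ σ ∈ Set.Icc 0 τ, σ ∈ Set.Icc 0 t := fun σ hσ => ⟨hσ.1, hσ.2.trans hτ.2⟩
    have := mvt0 (F := fun σ => T1 w (σ • v) v - σ) hτ.1
      (fun σ hσ => (d1 σ (hgood σ (hsub σ hσ)).1.1).sub (hasDerivAt_id σ)) (fun σ hσ => a2 σ (hsub σ hσ))
    simp only [zero_smul, sub_zero] at this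
    rw [show T1 w (τ • v) v - T1 w 0 v - τ = T1 w (τ • v) v - τ - T1 w 0 v by ring]
    have ht0 := ht.1
    exact this.trans (by gcongr; exact hτ.2)
  have := mvt0 (F := fun σ => w (σ • v) - σ * T1 w 0 v - σ ^ 2 / 2) ht.1
      (F' := fun σ => T1 w (σ • v) v - T1 w 0 v - σ)
      (fun σ hσ => by
        refine (((d0 σ (hgood σ hσ).1.1).sub ((hasDerivAt_id σ).mul_const (T1 w 0 v))).sub
          (((hasDerivAt_id σ).pow 2).div_const 2)).congr_deriv ?_
        simp) a1
  simp only [zero_smul, zero_mul, sub_zero] at this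
  refine le_trans (le_of_eq ?_) (this.trans (le_of_eq (by ring)))
  congr 1; ring
end est

end Part9

section Part10
open Filter Topology
open scoped ContDiff
set_option maxSynthPendingDepth 8

section c2
variable {E : Type} [NormedAddCommGroup E] [NormedSpace ℝ E]

lemma gen_curve {F : Type} [NormedAddCommGroup F] [NormedSpace ℝ F] {f : E → F} {x : E}
    (hf : DifferentiableAt ℝ f x) (ζ : E) :
    HasDerivAt (fun t : ℝ => f (x + t • ζ)) (fderiv ℝ f x ζ) 0 := by
  have h : HasFDerivAt f (fderiv ℝ f x) (x + (0:ℝ) • ζ) := by simpa using hf.hasFDerivAt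
  exact h.comp_hasDerivAt (0:ℝ) (hV x ζ 0)

lemma c2_curve {u : E → ℝ} {x : E} (hu : ContDiffAt ℝ 2 u x) (ζ : E) :
    (∀ᶠ t : ℝ in 𝓝 0, HasDerivAt (fun t : ℝ => u (x + t • ζ)) (T1 u (x + t • ζ) ζ) t) ∧
    HasDerivAt (fun t : ℝ => T1 u (x + t • ζ) ζ) (T2 u x ζ ζ) 0 := by
  have hd : ∀ t : ℝ, HasDerivAt (fun t : ℝ => x + t • ζ) ζ t := fun t => hV x ζ t
  have hcont : Tendsto (fun t : ℝ => x + t • ζ) (𝓝 0) (𝓝 x) := by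
    have := (hd 0).continuousAt.tendsto
    simpa using this
  constructor
  · have h1 : ∀ᶠ y in 𝓝 x, ContDiffAt ℝ 2 u y := hu.eventually (by simp)
    filter_upwards [hcont.eventually h1] with t ht
    exact (ht.differentiableAt (by simp)).hasFDerivAt.comp_hasDerivAt t (hd t)
  · have h1 : ContDiffAt ℝ 1 (fderiv ℝ u) x := hu.fderiv_right (by norm_num)
    have h3 := (gen_curve (h1.differentiableAt (by simp)) ζ).clm_apply (hasDerivAt_const (0:ℝ) ζ)
    simpa using h3

lemma c2_symm {u : E → ℝ} {x : E} (hu : ContDiffAt ℝ 2 u x) (a b : E) : T2 u x a b = T2 u x b a :=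
  hu.isSymmSndFDerivAt (by simp) a b

lemma quartic_deriv (a1 a2 a3 a4 t : ℝ) :
    HasDerivAt (fun t : ℝ => a1 * t + a2 * t ^ 2 + a3 * t ^ 3 + a4 * t ^ 4)
      (a1 + 2 * a2 * t + 3 * a3 * t ^ 2 + 4 * a4 * t ^ 3) t := by
  have := ((((hasDerivAt_id t).const_mul a1).add ((hasDerivAt_pow 2 t).const_mul a2)).add
    ((hasDerivAt_pow 3 t).const_mul a3)).add ((hasDerivAt_pow 4 t).const_mul a4)
  refine this.congr_deriv ?_
  norm_num; ring

lemma dbl_test {u : E → ℝ} {x y : E} (hx : ContDiffAt ℝ 2 u x) (hy : ContDiffAt ℝ 2 u y) (ζ η : E)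
    (a1 a2 a3 a4 : ℝ)
    (hle : ∀ᶠ t : ℝ in 𝓝 0, u (x + t • ζ) - u (y + t • η)
      + (a1 * t + a2 * t ^ 2 + a3 * t ^ 3 + a4 * t ^ 4) ≤ u x - u y) :
    T1 u x ζ - T1 u y η + a1 = 0 ∧ T2 u x ζ ζ - T2 u y η η + 2 * a2 ≤ 0 := by
  have h := second_test (F := fun t : ℝ => u (x + t • ζ) - u (y + t • η)
      + (a1 * t + a2 * t ^ 2 + a3 * t ^ 3 + a4 * t ^ 4))
    (F1 := fun t : ℝ => T1 u (x + t • ζ) ζ - T1 u (y + t • η) η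
      + (a1 + 2 * a2 * t + 3 * a3 * t ^ 2 + 4 * a4 * t ^ 3))
    (F2 := T2 u x ζ ζ - T2 u y η η + 2 * a2) ?_ ?_ ?_
  · simpa using h
  · filter_upwards [hle] with t ht
    simpa using ht
  · filter_upwards [(c2_curve hx ζ).1, (c2_curve hy η).1] with t h1 h2
    exact (h1.sub h2).add (quartic_deriv _ _ _ _ t)
  · refine ((c2_curve hx ζ).2.sub (c2_curve hy η).2).add ?_
    have := ((((hasDerivAt_id (0:ℝ)).const_mul (2 * a2)).const_add a1).add
      ((hasDerivAt_pow 2 (0:ℝ)).const_mul (3 * a3))).add ((hasDerivAt_pow 3 (0:ℝ)).const_mul (4 * a4))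
    refine this.congr_deriv ?_
    norm_num

lemma psd_of_convex {u : E → ℝ} {s : Set E} (hc : ConvexOn ℝ s u) {x : E} (hs : s ∈ 𝓝 x)
    (hu : ContDiffAt ℝ 2 u x) (ζ : E) : 0 ≤ T2 u x ζ ζ := by
  have hcont : ∀ ζ : E, ∀ᶠ t : ℝ in 𝓝 0, x + t • ζ ∈ s := by
    intro ζ
    have : Tendsto (fun t : ℝ => x + t • ζ) (𝓝 0) (𝓝 x) := by
      have := (hV x ζ 0).continuousAt.tendsto
      simpa using this
    exact this hs
  have h := second_test (F := fun t : ℝ => - u (x + t • ζ) - u (x + t • (-ζ)))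
    (F1 := fun t : ℝ => - T1 u (x + t • ζ) ζ - T1 u (x + t • (-ζ)) (-ζ))
    (F2 := - T2 u x ζ ζ - T2 u x (-ζ) (-ζ)) ?_ ?_ ?_
  · have := h.2
    simp only [map_neg, neg_apply] at this
    linarith
  · filter_upwards [hcont ζ, hcont (-ζ)] with t h1 h2
    have := hc.2 h1 h2 (by norm_num : (0:ℝ) ≤ 1/2) (by norm_num : (0:ℝ) ≤ 1/2) (by norm_num)
    rw [show (1/2:ℝ) • (x + t • ζ) + (1/2:ℝ) • (x + t • -ζ) = x by module] at this
    simp only [smul_eq_mul] at this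
    simp only [zero_smul, add_zero]
    linarith
  · filter_upwards [(c2_curve hu ζ).1, (c2_curve hu (-ζ)).1] with t h1 h2
    exact h1.neg.sub h2
  · exact (c2_curve hu ζ).2.neg.sub (c2_curve hu (-ζ)).2
end c2

lemma norm_quad {E : Type} [NormedAddCommGroup E] [InnerProductSpace ℝ E] (e η : E) (he : ‖e‖ = 1)
    {r : ℝ} (hr : 0 < r) (t : ℝ) :
    ‖r • e + t • η‖ ≤ r + t * ⟪e, η⟫ + t ^ 2 * ‖η‖ ^ 2 / (2 * r) := by
  have hcs : ⟪e, η⟫ ^ 2 ≤ ‖η‖ ^ 2 := by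
    have := abs_real_inner_le_norm e η
    rw [he, one_mul] at this
    exact sq_le_sq' (by have := (abs_le.1 this).1; linarith) (abs_le.1 this).2
  set a := ⟪e, η⟫ with ha
  set b := ‖η‖ with hb
  have hsq : ‖r • e + t • η‖ ^ 2 = r ^ 2 + 2 * r * t * a + t ^ 2 * b ^ 2 := by
    rw [norm_add_sq_real, norm_smul, norm_smul, inner_smul_left, inner_smul_right, he]
    simp only [Real.norm_eq_abs, mul_pow, sq_abs]
    simp; ring
  have h0 : 0 ≤ r + t * a + t ^ 2 * b ^ 2 / (2 * r) := by
    have : 0 ≤ (2 * r * (r + t * a) + t ^ 2 * b ^ 2) / (2 * r) := by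
      apply div_nonneg _ (by positivity)
      nlinarith [sq_nonneg (r + t * a), sq_nonneg r, mul_nonneg (sq_nonneg t) (sub_nonneg.2 hcs)]
    refine this.trans (le_of_eq ?_); field_simp
  refine abs_le_of_sq_le_sq' ?_ h0 |>.2
  rw [hsq]
  have : (r + t * a + t ^ 2 * b ^ 2 / (2 * r)) ^ 2
    = r ^ 2 + 2 * r * t * a + t ^ 2 * b ^ 2 + (t * a + t ^ 2 * b ^ 2 / (2 * r)) ^ 2 := by
    field_simp; ring
  rw [this]
  nlinarith [sq_nonneg (t * a + t ^ 2 * b ^ 2 / (2 * r))]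

end Part10

section Part11
open Filter Topology
open scoped ContDiff
set_option maxSynthPendingDepth 8

/-- reflection -/
def rfl' {n : ℕ} (e ζ : Euc n) : Euc n := ζ - (2 * ⟪e, ζ⟫) • e

lemma refl_inner {n : ℕ} (e a b : Euc n) (he : ‖e‖ = 1) : ⟪rfl' e a, rfl' e b⟫ = ⟪a, b⟫ := by
  unfold rfl'
  simp only [inner_sub_left, inner_sub_right, inner_smul_left, inner_smul_right, real_inner_self_eq_norm_sq, he]
  simp only [conj_trivial]
  rw [real_inner_comm e a]
  ring

lemma refl_norm {n : ℕ} (e a : Euc n) (he : ‖e‖ = 1) : ‖rfl' e a‖ = ‖a‖ := by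
  have := refl_inner e a a he
  rw [real_inner_self_eq_norm_sq, real_inner_self_eq_norm_sq] at this
  exact (pow_left_inj₀ (norm_nonneg _) (norm_nonneg _) two_ne_zero).1 this

lemma refl_e {n : ℕ} (e a : Euc n) (he : ‖e‖ = 1) : ⟪e, rfl' e a⟫ = - ⟪e, a⟫ := by
  unfold rfl'
  simp only [inner_sub_right, inner_smul_right, real_inner_self_eq_norm_sq, he]
  ring

lemma refl_refl {n : ℕ} (e a : Euc n) (he : ‖e‖ = 1) : rfl' e (rfl' e a) = a := by
  rw [show rfl' e (rfl' e a) = rfl' e a - (2 * ⟪e, rfl' e a⟫) • e from rfl, refl_e e a he]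
  unfold rfl'
  module

def iForm (n : ℕ) : Euc n →L[ℝ] Euc n →L[ℝ] ℝ := innerSL ℝ

lemma iForm_apply {n : ℕ} (a b : Euc n) : iForm n a b = ⟪a, b⟫ := rfl

lemma inner_stdB {n : ℕ} (e : Euc n) (i : Fin n) : ⟪e, stdB i⟫ = e i := by
  simp [stdB, EuclideanSpace.inner_single_right]

lemma stdB_ap {n : ℕ} (i j : Fin n) : (stdB i : Euc n) j = if i = j then 1 else 0 := by
  simp [stdB, Pi.single_apply, eq_comm]

lemma inner_std_det {n : ℕ} : (gramM (iForm n) stdB).det = 1 := by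
  have : gramM (iForm n) stdB = 1 := by
    ext i j
    simp [gramM, iForm_apply, inner_stdB, stdB_ap, Matrix.one_apply]
  rw [this, Matrix.det_one]

def dForm {n : ℕ} (σ : ℝ) (e : Euc n) : Euc n →L[ℝ] Euc n →L[ℝ] ℝ :=
  iForm n + (σ - 1) • (iForm n e).smulRight (iForm n e)

lemma dForm_apply {n : ℕ} (σ : ℝ) (e a b : Euc n) :
    dForm σ e a b = ⟪a, b⟫ + (σ - 1) * (⟪e, a⟫ * ⟪e, b⟫) := by
  simp [dForm, iForm_apply]

lemma dForm_det {n : ℕ} (σ : ℝ) (e : Euc n) (he : ‖e‖ = 1) : (gramM (dForm σ e) stdB).det = σ := by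
  have : gramM (dForm σ e) stdB = 1 + Matrix.replicateCol Unit (fun i => (σ - 1) * e i) *
      Matrix.replicateRow Unit (fun i => e i) := by
    ext i j
    simp only [gramM, Matrix.of_apply, dForm_apply, Matrix.add_apply, Matrix.mul_apply,
      Matrix.replicateCol_apply, Matrix.replicateRow_apply, Finset.univ_unique, Finset.sum_singleton]
    rw [inner_stdB, inner_stdB, inner_stdB, stdB_ap, Matrix.one_apply]
    ring
  rw [this, Matrix.det_one_add_replicateCol_mul_replicateRow]
  have h := EuclideanSpace.real_norm_sq_eq e
  rw [he] at h
  have h2 : (fun i => e i) ⬝ᵥ (fun i => (σ - 1) * e i) = (σ - 1) * ∑ i, e i ^ 2 := by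
    simp only [dotProduct, Finset.mul_sum]
    refine Finset.sum_congr rfl fun i _ => by ring
  rw [h2, ← h]; ring

lemma refl_contra {n : ℕ} (hn : 0 < n) (X Y : Euc n →L[ℝ] Euc n →L[ℝ] ℝ)
    (hXs : ∀ x y, X x y = X y x) (hYs : ∀ x y, Y x y = Y y x) (hXp : ∀ x, 0 ≤ X x x)
    (e : Euc n) (he : ‖e‖ = 1) {κ δ : ℝ} (hκ : 0 < κ) (hκ2 : κ ≤ 1 / 16) (hδ : 0 ≤ δ) (hδκ : δ ≤ κ)
    (hYl : ∀ ζ, 1 / 2 * ‖ζ‖ ^ 2 ≤ Y ζ ζ)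
    (hXY : ∀ ζ, X ζ ζ ≤ Y (rfl' e ζ) (rfl' e ζ) - 8 * (2 * 8 ^ n) * κ * ⟪e, ζ⟫ ^ 2 + 8 * κ * ‖ζ‖ ^ 2)
    (hX : (1 - δ) ^ n ≤ (gramM X stdB).det) (hY0 : 0 < (gramM Y stdB).det)
    (hY : (gramM Y stdB).det ≤ (1 + δ) ^ n) : False := by
  have hnn : (0:ℝ) < n := by exact_mod_cast hn
  have hYp : ∀ x, 0 ≤ Y x x := fun x => le_trans (by positivity) (hYl x)
  obtain ⟨f, hf, -, hd⟩ := exists_onb Y hYs hYp hY0.ne'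
  have hf2 : ∀ a, ‖f a‖ ^ 2 ≤ 2 := fun a => by
    have := hYl (f a); rw [hf a a, if_pos rfl] at this; linarith
  set g : Fin n → Euc n := fun a => rfl' e (f a) with hg
  have hdg : (colM g).det ^ 2 = (colM f).det ^ 2 := by
    have h1 := gramM_det (iForm n) g
    have h2 := gramM_det (iForm n) f
    rw [inner_std_det, one_mul] at h1 h2
    rw [← h1, ← h2]
    congr 1
    ext a b
    simp only [gramM, Matrix.of_apply, iForm_apply]
    exact refl_inner e _ _ he
  -- lower bound on the sum of squares
  have hσ : 2 * (n:ℝ) ≤ 8 ^ n * ∑ a, ⟪e, f a⟫ ^ 2 := by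
    have h1 := gram_onb_det hn (dForm (8 ^ n) e) Y f hd
      (fun x y => by rw [dForm_apply, dForm_apply, real_inner_comm]; ring)
      (fun x => by
        rw [dForm_apply, real_inner_self_eq_norm_sq]
        have : (1:ℝ) ≤ 8 ^ n := one_le_pow₀ (by norm_num)
        have := mul_nonneg (sub_nonneg.2 this) (mul_self_nonneg ⟪e, x⟫)
        positivity) hY0 4 (by norm_num) (by
        rw [dForm_det _ _ he]
        calc (4:ℝ) ^ n * (gramM Y stdB).det ≤ 4 ^ n * 2 ^ n := by
              gcongr
              exact hY.trans (pow_le_pow_left₀ (by linarith) (by linarith) n)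
          _ = 8 ^ n := by rw [← mul_pow]; norm_num)
    have h2 : ∑ a, dForm (8 ^ n) e (f a) (f a) ≤ ∑ a, (2 + 8 ^ n * ⟪e, f a⟫ ^ 2) := by
      refine Finset.sum_le_sum fun a _ => ?_
      rw [dForm_apply, real_inner_self_eq_norm_sq]
      nlinarith [hf2 a, sq_nonneg ⟪e, f a⟫]
    rw [Finset.sum_add_distrib, ← Finset.mul_sum] at h2
    simp at h2
    linarith
  have hc : (1 - 2 * δ) ≤ (1 - δ) / (1 + δ) := by
    rw [le_div_iff₀ (by linarith)]; nlinarith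
  have h1 := gram_onb_det hn X Y g (by rw [hdg, hd]) hXs hXp hY0 ((1 - δ) / (1 + δ))
    (div_nonneg (by linarith) (by linarith)) (by
      calc ((1 - δ) / (1 + δ)) ^ n * (gramM Y stdB).det ≤ ((1 - δ) / (1 + δ)) ^ n * (1 + δ) ^ n := by
            gcongr
            exact pow_nonneg (div_nonneg (by linarith) (by linarith)) n
        _ = (1 - δ) ^ n := by
            rw [← mul_pow, div_mul_cancel₀ _ (by linarith : 1 + δ ≠ 0)]
        _ ≤ _ := hX)
  have h2 : ∑ a, X (g a) (g a) ≤ ∑ a, (1 + 16 * κ - 16 * κ * (8 ^ n * ⟪e, f a⟫ ^ 2)) := by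
    refine Finset.sum_le_sum fun a _ => (hXY (g a)).trans ?_
    rw [hg]
    simp only
    rw [refl_refl _ _ he, refl_e _ _ he, refl_norm _ _ he, hf, if_pos rfl]
    nlinarith [hf2 a]
  rw [Finset.sum_sub_distrib, ← Finset.mul_sum, ← Finset.mul_sum] at h2
  simp only [Finset.sum_const, Finset.card_univ, Fintype.card_fin, nsmul_eq_mul] at h2
  nlinarith [mul_le_mul_of_nonneg_left hc hnn.le, mul_le_mul_of_nonneg_left hσ hκ.le, mul_pos hnn hκ]

end Part11

section Part12
open Filter Topology
open scoped ContDiff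
set_option maxSynthPendingDepth 8

lemma convex_tangent {E : Type} [NormedAddCommGroup E] [NormedSpace ℝ E] {u : E → ℝ} {s : Set E}
    (hc : ConvexOn ℝ s u) {x y : E} (hx : x ∈ s) (hy : y ∈ s) (hd : DifferentiableAt ℝ u x) :
    u x + fderiv ℝ u x (y - x) ≤ u y := by
  have h := (gen_curve hd (y - x)).tendsto_slope_zero_right
  have h2 : fderiv ℝ u x (y - x) ≤ u y - u x := by
    refine le_of_tendsto h ?_
    have : Set.Ioo (0:ℝ) 1 ∈ 𝓝[>] (0:ℝ) := Ioo_mem_nhdsGT (by norm_num)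
    filter_upwards [this] with t ht
    have h3 := hc.2 hx hy (by linarith [ht.2] : 0 ≤ 1 - t) ht.1.le (by ring)
    rw [show (1 - t) • x + t • y = x + t • (y - x) by module] at h3
    simp only [zero_add, zero_smul, add_zero, smul_eq_mul] at h3 ⊢
    rw [inv_mul_le_iff₀ ht.1]
    linarith
  linarith

def mM {n : ℕ} (u : Euc n → ℝ) (ℓ : Euc n) (κ A B : ℝ) (x y : Euc n) : ℝ :=
  u x - u y - ⟪ℓ, x - y⟫ - 1 / 2 * ‖x‖ ^ 2 + 1 / 2 * ‖y‖ ^ 2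
    - κ * (A * ‖x - y‖ - B * ‖x - y‖ ^ 2 + 2 * ‖x‖ ^ 2 + 2 * ‖y‖ ^ 2)

lemma nsq_curve {n : ℕ} (x ζ : Euc n) (t : ℝ) :
    ‖x + t • ζ‖ ^ 2 = ‖x‖ ^ 2 + 2 * t * ⟪x, ζ⟫ + t ^ 2 * ‖ζ‖ ^ 2 := by
  rw [norm_add_sq_real, inner_smul_right, norm_smul, mul_pow, Real.norm_eq_abs, sq_abs]; ring

lemma var_test {n : ℕ} {u : Euc n → ℝ} {ℓ : Euc n} {κ B : ℝ} (hκ : 0 < κ) (hB : 0 < B) {x y : Euc n}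
    (hx : ContDiffAt ℝ 2 u x) (hy : ContDiffAt ℝ 2 u y) (hx1 : ‖x‖ < 1) (hy1 : ‖y‖ < 1)
    (hmax : ∀ x' y' : Euc n, ‖x'‖ ≤ 1 → ‖y'‖ ≤ 1 → mM u ℓ κ (4 * B) B x' y' ≤ mM u ℓ κ (4 * B) B x y)
    {r : ℝ} (hr : r = ‖x - y‖) (hr2 : r < 2) (ζ η : Euc n) (ρ1 ρ2 : ℝ)
    (hρ : ∀ᶠ t : ℝ in 𝓝 0, ‖(x + t • ζ) - (y + t • η)‖ ≤ r + t * ρ1 + t ^ 2 * ρ2) :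
    T1 u x ζ - T1 u y η = ⟪ℓ, ζ - η⟫ + ⟪x, ζ⟫ - ⟪y, η⟫
      + κ * (4 * B * ρ1 - 2 * B * r * ρ1 + 4 * ⟪x, ζ⟫ + 4 * ⟪y, η⟫) ∧
    T2 u x ζ ζ - T2 u y η η ≤ ‖ζ‖ ^ 2 - ‖η‖ ^ 2
      + 2 * κ * (4 * B * ρ2 - B * (ρ1 ^ 2 + 2 * r * ρ2) + 2 * ‖ζ‖ ^ 2 + 2 * ‖η‖ ^ 2) := by
  have h := dbl_test hx hy ζ η
    (-(⟪ℓ, ζ - η⟫ + ⟪x, ζ⟫ - ⟪y, η⟫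
      + κ * (4 * B * ρ1 - 2 * B * r * ρ1 + 4 * ⟪x, ζ⟫ + 4 * ⟪y, η⟫)))
    (-(1 / 2 * ‖ζ‖ ^ 2 - 1 / 2 * ‖η‖ ^ 2
      + κ * (4 * B * ρ2 - B * (ρ1 ^ 2 + 2 * r * ρ2) + 2 * ‖ζ‖ ^ 2 + 2 * ‖η‖ ^ 2)))
    (κ * B * (2 * ρ1 * ρ2)) (κ * B * ρ2 ^ 2) ?_
  · constructor
    · linarith [h.1]
    · linarith [h.2]
  have c1 : ∀ (x ζ : Euc n), ‖x‖ < 1 → ∀ᶠ t : ℝ in 𝓝 0, ‖x + t • ζ‖ < 1 := by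
    intro x ζ hx
    have : ContinuousAt (fun t : ℝ => ‖x + t • ζ‖) 0 := by fun_prop
    exact this.eventually_lt continuousAt_const (by simpa using hx)
  have c2 : ∀ᶠ t : ℝ in 𝓝 0, r + t * ρ1 + t ^ 2 * ρ2 < 2 := by
    have : ContinuousAt (fun t : ℝ => r + t * ρ1 + t ^ 2 * ρ2) 0 := by fun_prop
    exact this.eventually_lt continuousAt_const (by simpa using hr2)
  filter_upwards [c1 x ζ hx1, c1 y η hy1, c2, hρ] with t h1 h2 h3 h4
  have h5 := hmax _ _ h1.le h2.le
  unfold mM at h5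
  rw [← hr] at h5
  set s := ‖(x + t • ζ) - (y + t • η)‖ with hs
  have hs0 : 0 ≤ s := norm_nonneg _
  set ρ := r + t * ρ1 + t ^ 2 * ρ2 with hρd
  have h6 : 4 * B * s - B * s ^ 2 ≤ 4 * B * ρ - B * ρ ^ 2 := by
    have : 0 ≤ B * ((ρ - s) * (4 - ρ - s)) :=
      mul_nonneg hB.le (mul_nonneg (by linarith) (by linarith))
    nlinarith
  have h6' := mul_le_mul_of_nonneg_left h6 hκ.le
  rw [show x + t • ζ - (y + t • η) = (x - y) + t • (ζ - η) by module, inner_add_right,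
    inner_smul_right, nsq_curve, nsq_curve] at h5
  have h7 : κ * (4 * B * ρ - B * ρ ^ 2) = κ * (4 * B * r - B * r ^ 2)
    + κ * (4 * B * ρ1 - 2 * B * r * ρ1) * t + κ * (4 * B * ρ2 - B * (ρ1 ^ 2 + 2 * r * ρ2)) * t ^ 2
    - κ * B * (2 * ρ1 * ρ2) * t ^ 3 - κ * B * ρ2 ^ 2 * t ^ 4 := by rw [hρd]; ring
  linarith

set_option maxHeartbeats 1600000 in
lemma lemG_aux {n : ℕ} (hn : 0 < n) {u : Euc n → ℝ} {ℓ : Euc n} {c κ δ B : ℝ}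
    (hB : B = 2 * 8 ^ n)
    (hC2 : ∀ x : Euc n, ‖x‖ < 1 → ContDiffAt ℝ 2 u x)
    (hcont : ContinuousOn u (Metric.closedBall 0 1))
    (hconv : ConvexOn ℝ (Metric.closedBall 0 1) u)
    (hκ : 0 < κ) (hκ2 : κ ≤ 1 / 16) (hδ : 0 ≤ δ) (hδκ : δ ≤ κ)
    (happ : ∀ x : Euc n, ‖x‖ ≤ 1 → |u x - (c + ⟪ℓ, x⟫ + 1 / 2 * ‖x‖ ^ 2)| ≤ κ)
    (hdl : ∀ x : Euc n, ‖x‖ < 1 → (1 - δ) ^ n ≤ (gramM (T2 u x) stdB).det)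
    (hdu : ∀ x : Euc n, ‖x‖ < 1 → (gramM (T2 u x) stdB).det ≤ (1 + δ) ^ n) :
    ∀ x y : Euc n, ‖x‖ ≤ 1 → ‖y‖ ≤ 1 → mM u ℓ κ (4 * B) B x y ≤ 12 * (4 * B + 4) ^ 2 * κ ^ 2 := by
  have hB0 : 0 < B := by rw [hB]; positivity
  obtain ⟨⟨x, y⟩, ⟨hx, hy⟩, hmax⟩ := ((isCompact_closedBall (0 : Euc n) 1).prod
    (isCompact_closedBall (0 : Euc n) 1)).exists_isMaxOn (⟨(0, 0), by simp⟩)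
    (f := fun p : Euc n × Euc n => mM u ℓ κ (4 * B) B p.1 p.2) (by
      unfold mM
      have h1 : ContinuousOn (fun p : Euc n × Euc n => u p.1)
          (Metric.closedBall 0 1 ×ˢ Metric.closedBall 0 1) :=
        hcont.comp continuousOn_fst (fun p hp => hp.1)
      have h2 : ContinuousOn (fun p : Euc n × Euc n => u p.2)
          (Metric.closedBall 0 1 ×ˢ Metric.closedBall 0 1) :=
        hcont.comp continuousOn_snd (fun p hp => hp.2)
      have h3 : Continuous (fun p : Euc n × Euc n => ⟪ℓ, p.1 - p.2⟫) := by fun_prop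
      have h4 : Continuous (fun p : Euc n × Euc n => 1 / 2 * ‖p.1‖ ^ 2) := by fun_prop
      have h5 : Continuous (fun p : Euc n × Euc n => 1 / 2 * ‖p.2‖ ^ 2) := by fun_prop
      have h6 : Continuous (fun p : Euc n × Euc n => κ * (4 * B * ‖p.1 - p.2‖ - B * ‖p.1 - p.2‖ ^ 2
        + 2 * ‖p.1‖ ^ 2 + 2 * ‖p.2‖ ^ 2)) := by fun_prop
      exact ((((h1.sub h2).sub h3.continuousOn).sub h4.continuousOn).add h5.continuousOn).sub
        h6.continuousOn)
  have hmax' : ∀ x' y' : Euc n, ‖x'‖ ≤ 1 → ‖y'‖ ≤ 1 →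
      mM u ℓ κ (4 * B) B x' y' ≤ mM u ℓ κ (4 * B) B x y := fun x' y' h1 h2 =>
    hmax (show (x', y') ∈ _ from ⟨by simpa using h1, by simpa using h2⟩)
  simp only [Metric.mem_closedBall, dist_zero_right] at hx hy
  suffices hM : mM u ℓ κ (4 * B) B x y ≤ 12 * (4 * B + 4) ^ 2 * κ ^ 2 from
    fun x' y' h1 h2 => (hmax' x' y' h1 h2).trans hM
  by_contra hM
  push Not at hM
  have hMpos : 0 < mM u ℓ κ (4 * B) B x y := lt_of_le_of_lt (by positivity) hM
  set r := ‖x - y‖ with hr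
  have hr0 : 0 ≤ r := norm_nonneg _
  have hrle : r ≤ ‖x‖ + ‖y‖ := norm_sub_le _ _
  have hup : mM u ℓ κ (4 * B) B x y ≤ 2 * κ - κ * (2 * ‖x‖ ^ 2 + 2 * ‖y‖ ^ 2) := by
    have h1 := (abs_le.1 (happ x hx)).2
    have h2 := (abs_le.1 (happ y hy)).1
    unfold mM
    rw [← hr, inner_sub_right]
    have : 0 ≤ κ * (B * (r * (4 - r))) :=
      mul_nonneg hκ.le (mul_nonneg hB0.le (mul_nonneg hr0 (by linarith)))
    nlinarith
  have hx1 : ‖x‖ < 1 := by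
    refine lt_of_le_of_ne hx fun h => ?_
    rw [h] at hup
    nlinarith [mul_nonneg hκ.le (sq_nonneg ‖y‖)]
  have hy1 : ‖y‖ < 1 := by
    refine lt_of_le_of_ne hy fun h => ?_
    rw [h] at hup
    nlinarith [mul_nonneg hκ.le (sq_nonneg ‖x‖)]
  have hr2 : r < 2 := by linarith
  have hrpos : 0 < r := by
    refine lt_of_le_of_ne hr0 fun h => ?_
    have hxy : x = y := by rw [← sub_eq_zero, ← norm_eq_zero, ← hr, ← h]
    unfold mM at hMpos
    rw [hxy] at hMpos
    simp at hMpos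
    nlinarith [mul_nonneg hκ.le (sq_nonneg ‖y‖)]
  set e := r⁻¹ • (x - y) with he
  have he1 : ‖e‖ = 1 := by
    rw [he, norm_smul, ← hr, Real.norm_eq_abs, abs_of_pos (inv_pos.2 hrpos), inv_mul_cancel₀ hrpos.ne']
  have hxy : x - y = r • e := by rw [he, smul_smul, mul_inv_cancel₀ hrpos.ne', one_smul]
  have hX := hC2 x hx1
  have hY := hC2 y hy1
  have hve := var_test hκ hB0 hX hY hx1 hy1 hmax' hr hr2
  -- step 1
  have hrbig : 4 * (4 * B + 4) * κ < r := by
    have h1 := (hve e 0 1 0 (by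
      have hev : ∀ᶠ t : ℝ in 𝓝 0, 0 < r + t := by
        have : ContinuousAt (fun t : ℝ => r + t) 0 := by fun_prop
        exact continuousAt_const.eventually_lt this (by simpa using hrpos)
      filter_upwards [hev] with t ht
      rw [show x + t • e - (y + t • (0 : Euc n)) = (x - y) + t • e by module, hxy, ← add_smul,
        norm_smul, he1, Real.norm_eq_abs, abs_of_pos ht]; simp)).1
    have h2 := convex_tangent hconv (x := x) (y := y) (by simpa using hx) (by simpa using hy)
      (hX.differentiableAt (by simp))
    rw [show y - x = (-r) • e by rw [neg_smul, ← hxy]; abel, map_smul, smul_eq_mul] at h2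
    have hy' : y = x + (-r) • e := by rw [neg_smul, ← hxy]; abel
    have h3 : ‖y‖ ^ 2 = ‖x‖ ^ 2 - 2 * r * ⟪x, e⟫ + r ^ 2 := by
      rw [hy', nsq_curve, he1]; ring
    have h4 : ⟪x, e⟫ ≤ 1 := by
      have := real_inner_le_norm x e
      rw [he1] at this; linarith
    simp only [map_zero, inner_zero_right, sub_zero] at h1
    change fderiv ℝ u x e = _ at h1
    rw [h1] at h2
    have h5 : mM u ℓ κ (4 * B) B x y ≤ r ^ 2 / 2 + κ * (4 * B + 4) * r := by
      unfold mM
      rw [← hr, hxy, inner_smul_right]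
      have e1 : 0 ≤ κ * (r * (1 - ⟪x, e⟫)) := mul_nonneg hκ.le (mul_nonneg hr0 (by linarith))
      have e2 : 0 ≤ κ * (B * r) := by positivity
      have e3 : 0 ≤ κ * (B * r ^ 2) := by positivity
      have e4 : 0 ≤ κ * (2 * ‖x‖ ^ 2 + 2 * ‖y‖ ^ 2) := by positivity
      nlinarith
    by_contra hcon
    push Not at hcon
    have h6 : r ^ 2 / 2 + κ * (4 * B + 4) * r ≤ 12 * (4 * B + 4) ^ 2 * κ ^ 2 := by
      set q := (4 * B + 4) * κ with hq
      have hq0 : 0 ≤ q := by positivity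
      have hc' : r ≤ 4 * q := by rw [hq]; linarith
      have : 12 * (4 * B + 4) ^ 2 * κ ^ 2 = 12 * q ^ 2 := by rw [hq]; ring
      rw [this, mul_comm κ, ← hq]
      nlinarith
    linarith
  -- step 2
  have hYl : ∀ η : Euc n, 1 / 2 * ‖η‖ ^ 2 ≤ T2 u y η η := by
    intro η
    have h1 := (hve 0 η (-⟪e, η⟫) (‖η‖ ^ 2 / (2 * r)) (Eventually.of_forall fun t => by
      rw [show x + t • (0 : Euc n) - (y + t • η) = (x - y) + t • (-η) by module, hxy]
      have := norm_quad e (-η) he1 hrpos t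
      rw [inner_neg_right, norm_neg] at this
      refine this.trans (le_of_eq ?_)
      ring)).2
    simp only [map_zero, norm_zero] at h1
    have e1 : 4 * B * κ * (‖η‖ ^ 2 / r) ≤ 1 / 4 * ‖η‖ ^ 2 := by
      rw [mul_div_assoc', div_le_iff₀ hrpos]
      nlinarith [mul_le_mul_of_nonneg_right hrbig.le (sq_nonneg ‖η‖), mul_nonneg hκ.le (sq_nonneg ‖η‖)]
    have e2 : ‖η‖ ^ 2 / (2 * r) = 1 / 2 * (‖η‖ ^ 2 / r) := by field_simp
    have e3 : 0 ≤ κ * (B * (⟪e, η⟫ ^ 2 + r * (‖η‖ ^ 2 / r))) := by positivity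
    have e4 : κ * ‖η‖ ^ 2 ≤ 1 / 16 * ‖η‖ ^ 2 := by gcongr
    rw [e2] at h1
    nlinarith
  refine refl_contra hn (T2 u x) (T2 u y) (c2_symm hX) (c2_symm hY)
    (psd_of_convex hconv (Metric.closedBall_mem_nhds_of_mem (by simpa using hx1)) hX) e he1 hκ hκ2 hδ hδκ hYl ?_ (hdl x hx1)
    (lt_of_lt_of_le (pow_pos (by linarith) n) (hdl y hy1)) (hdu y hy1)
  intro ζ
  have hev : ∀ᶠ t : ℝ in 𝓝 0, 0 < r + t * (2 * ⟪e, ζ⟫) := by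
    have : ContinuousAt (fun t : ℝ => r + t * (2 * ⟪e, ζ⟫)) 0 := by fun_prop
    exact continuousAt_const.eventually_lt this (by simpa using hrpos)
  have h1 := (hve ζ (rfl' e ζ) (2 * ⟪e, ζ⟫) 0 (by
    filter_upwards [hev] with t ht
    rw [show x + t • ζ - (y + t • rfl' e ζ) = (r + t * (2 * ⟪e, ζ⟫)) • e by
      unfold rfl'
      rw [add_smul, ← hxy]; module]
    rw [norm_smul, he1, Real.norm_eq_abs, abs_of_pos ht]; simp)).2
  rw [refl_norm _ _ he1] at h1
  rw [← hB]
  nlinarith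

lemma lemG {n : ℕ} (hn : 0 < n) {u : Euc n → ℝ} {ℓ : Euc n} {c κ δ B : ℝ}
    (hB : B = 2 * 8 ^ n)
    (hC2 : ∀ x : Euc n, ‖x‖ < 1 → ContDiffAt ℝ 2 u x)
    (hcont : ContinuousOn u (Metric.closedBall 0 1))
    (hconv : ConvexOn ℝ (Metric.closedBall 0 1) u)
    (h0 : fderiv ℝ u 0 = 0)
    (hκ : 0 < κ) (hκ2 : κ ≤ 1 / 16) (hδ : 0 ≤ δ) (hδκ : δ ≤ κ)
    (happ : ∀ x : Euc n, ‖x‖ ≤ 1 → |u x - (c + ⟪ℓ, x⟫ + 1 / 2 * ‖x‖ ^ 2)| ≤ κ)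
    (hdl : ∀ x : Euc n, ‖x‖ < 1 → (1 - δ) ^ n ≤ (gramM (T2 u x) stdB).det)
    (hdu : ∀ x : Euc n, ‖x‖ < 1 → (gramM (T2 u x) stdB).det ≤ (1 + δ) ^ n) :
    ‖ℓ‖ ≤ (12 * (4 * B + 4) ^ 2 + 4 * B + 3) * κ := by
  have hB0 : 0 < B := by rw [hB]; positivity
  rcases eq_or_ne ℓ 0 with hl | hl
  · rw [hl, norm_zero]; positivity
  have hl0 : 0 < ‖ℓ‖ := norm_pos_iff.2 hl
  have h := lemG_aux hn hB hC2 hcont hconv hκ hκ2 hδ hδκ happ hdl hdu (-(κ / ‖ℓ‖) • ℓ) 0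
  have hnx : ‖-(κ / ‖ℓ‖) • ℓ‖ = κ := by
    rw [norm_smul, norm_neg, Real.norm_eq_abs, abs_of_pos (by positivity), div_mul_cancel₀ _ hl0.ne']
  have h := h (by rw [hnx]; linarith) (by simp)
  have ht := convex_tangent hconv (x := 0) (y := -(κ / ‖ℓ‖) • ℓ) (by simp) (by rw [mem_closedBall_zero_iff, hnx]; linarith)
    ((hC2 0 (by simp)).differentiableAt (by simp))
  rw [h0] at ht
  simp only [zero_apply, add_zero] at ht
  unfold mM at h
  rw [sub_zero, hnx, inner_smul_right, real_inner_self_eq_norm_sq, norm_zero] at h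
  have e1 : -(κ / ‖ℓ‖) * ‖ℓ‖ ^ 2 = - (κ * ‖ℓ‖) := by field_simp
  rw [e1] at h
  have : 0 ≤ κ * (B * κ ^ 2) := by positivity
  have e2 : κ * ‖ℓ‖ ≤ κ * ((12 * (4 * B + 4) ^ 2 + 4 * B + 3) * κ) := by nlinarith [sq_nonneg κ]
  exact le_of_mul_le_mul_left e2 hκ

end Part12

section Part13
open Filter Topology
open scoped ContDiff
set_option maxSynthPendingDepth 8

lemma hess_eq {n : ℕ} (u : Euc n → ℝ) (x : Euc n) : hessianMatrix u x = gramM (T2 u x) stdB := by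
  ext i j
  simp only [hessianMatrix, gramM, Matrix.of_apply, stdB, iteratedFDeriv_two_apply]
  rfl

lemma form_inj {n : ℕ} (B : Euc n →L[ℝ] Euc n →L[ℝ] ℝ) (hd : (gramM B stdB).det ≠ 0) (v : Euc n)
    (hv : B v = 0) : v = 0 := by
  have h : Matrix.vecMul (fun i => v i) (gramM B stdB) = 0 := by
    ext j
    have h1 : B v (stdB j) = 0 := by rw [hv]; rfl
    rw [bil_expand] at h1
    simp only [Matrix.vecMul, dotProduct, gramM, Matrix.of_apply, Pi.zero_apply]
    rw [← h1]
    refine Finset.sum_congr rfl fun i _ => ?_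
    simp [stdB, Pi.single_apply]
  have := Matrix.eq_zero_of_vecMul_eq_zero hd h
  ext i
  exact congrFun this i

lemma S_open {n : ℕ} (hn : 2 ≤ n) {u : Euc n → ℝ} {L : ℝ} {ξ : Euc n} {S : Set (Euc n)}
    (hS : S = {z : Euc n | u z < u 0 + L}) (hconv : Convex ℝ (closure S))
    (hb : Metric.ball ξ 1 ⊆ S) (hfr : ∀ z ∈ frontier S, u z = 0)
    (hd : ∀ z ∈ S, (gramM (T2 u z) stdB).det ≠ 0) : IsOpen S := by
  rw [← subset_interior_iff_isOpen]
  intro z hz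
  by_contra hzi
  have hzf : z ∈ frontier S := ⟨subset_closure hz, hzi⟩
  have hz0 := hfr z hzf
  have hrank : 1 < Module.rank ℝ (Euc n) := by
    rw [rank_eq_card_basis (EuclideanSpace.basisFun (Fin n) ℝ).toBasis]
    simp; omega
  have hξi : ξ ∈ interior S := mem_interior.2 ⟨_, hb, Metric.isOpen_ball, Metric.mem_ball_self one_pos⟩
  have hzξ : z ≠ ξ := fun h => hzi (h ▸ hξi)
  have hdz := hd z hz
  have hne : ∀ᶠ y in 𝓝[≠] z, fderiv ℝ u y ≠ 0 := by
    have hdiff : DifferentiableAt ℝ (fderiv ℝ u) z := by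
      by_contra hcon
      have h0 : T2 u z = 0 := fderiv_zero_of_not_differentiableAt hcon
      have := form_inj (T2 u z) hdz (stdB ⟨0, by omega⟩) (by rw [h0]; rfl)
      have h2 := congrArg (fun v : Euc n => v ⟨0, by omega⟩) this
      simp [stdB] at h2
    refine hdiff.hasFDerivAt.eventually_ne ?_
    obtain ⟨K, -, hK⟩ := LinearMap.exists_antilipschitzWith (T2 u z).toLinearMap (by
      rw [LinearMap.ker_eq_bot']
      intro v hv
      exact form_inj _ hdz v hv)
    exact ⟨K, hK⟩
  rw [eventually_nhdsWithin_iff, Metric.eventually_nhds_iff] at hne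
  obtain ⟨ε, hε, hne⟩ := hne
  have hnofr : ∀ y, dist y z < ε → y ≠ z → y ∉ frontier S := by
    intro y hy hyz hyf
    have h1 := hne hy hyz
    have h2 : ContinuousAt u y := by
      by_contra hcon
      exact h1 (fderiv_zero_of_not_differentiableAt fun h => hcon h.continuousAt)
    have h3 : u y < u 0 + L := by
      rw [hfr y hyf, ← hz0]
      rw [hS] at hz; exact hz
    refine hyf.2 (mem_interior_iff_mem_nhds.2 ?_)
    rw [hS]
    exact h2.eventually_lt continuousAt_const h3
  have hsph : ∀ s, 0 < s → s < ε → s < dist z ξ → Metric.sphere z s ⊆ interior S := by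
    intro s hs hsε hsd
    have hpre := isPreconnected_sphere hrank z s
    have hcov : Metric.sphere z s ⊆ interior S ∪ (closure S)ᶜ := by
      intro y hy
      rw [Metric.mem_sphere] at hy
      by_contra hcon
      rw [Set.mem_union, not_or, Set.notMem_compl_iff] at hcon
      exact hnofr y (by rw [hy]; exact hsε) (by rintro rfl; simp at hy; linarith) ⟨hcon.2, hcon.1⟩
    refine hpre.subset_left_of_subset_union isOpen_interior isClosed_closure.isOpen_compl ?_ hcov ?_
    · rw [Set.disjoint_compl_right_iff_subset]
      exact interior_subset.trans subset_closure
    · -- point on the segment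
      have hd0 : 0 < dist z ξ := dist_pos.2 hzξ
      set τ := s / dist z ξ with hτ
      have hτ0 : 0 < τ := div_pos hs hd0
      have hτ1 : τ < 1 := (div_lt_one hd0).2 hsd
      set y := (1 - τ) • z + τ • ξ with hy
      have hys : y ∈ Metric.sphere z s := by
        rw [Metric.mem_sphere, dist_eq_norm, hy,
          show (1 - τ) • z + τ • ξ - z = (-τ) • (z - ξ) by module, norm_smul, ← dist_eq_norm, norm_neg,
          Real.norm_eq_abs, abs_of_pos hτ0, hτ, div_mul_cancel₀ _ hd0.ne']
      have hyi : y ∈ interior (closure S) :=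
        hconv.combo_closure_interior_mem_interior (subset_closure (subset_closure hz))
          (interior_mono subset_closure hξi) (by linarith) hτ0 (by ring)
      refine ⟨y, hys, ?_⟩
      rcases hcov hys with h | h
      · exact h
      · exact absurd (interior_subset hyi) h
  apply hzi
  rw [mem_interior_iff_mem_nhds, Metric.mem_nhds_iff]
  have hd0 : 0 < dist z ξ := dist_pos.2 hzξ
  refine ⟨min ε (dist z ξ), lt_min hε hd0, fun y hy => ?_⟩
  rw [Metric.mem_ball, lt_min_iff] at hy
  rcases eq_or_ne y z with rfl | hyz
  · exact hz
  · exact interior_subset (hsph (dist y z) (dist_pos.2 hyz) hy.1 hy.2 rfl)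

lemma uL_zero {n : ℕ} (hn : 2 ≤ n) {u : Euc n → ℝ} {L : ℝ} {ξ : Euc n} {S : Set (Euc n)}
    (hS : S = {z : Euc n | u z < u 0 + L}) (hcont : ContinuousOn u (closure S))
    (hb : Metric.ball ξ 1 ⊆ S) (hb2 : S ⊆ Metric.ball ξ n) (hfr : ∀ z ∈ frontier S, u z = 0)
    (ho : IsOpen S) : u 0 + L = 0 := by
  have hfn : (frontier S).Nonempty := by
    rw [nonempty_frontier_iff]
    refine ⟨⟨ξ, hb (Metric.mem_ball_self one_pos)⟩, fun h => ?_⟩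
    haveI : Nontrivial (Euc n) := by
      haveI : Nonempty (Fin n) := ⟨⟨0, by omega⟩⟩
      infer_instance
    have h2 : Bornology.IsBounded (Set.univ : Set (Euc n)) := by
      rw [← h]; exact Metric.isBounded_ball.subset hb2
    exact NormedSpace.unbounded_univ ℝ (Euc n) h2
  obtain ⟨y, hy⟩ := hfn
  have h0 := hfr y hy
  have h1 : u 0 + L ≤ u y := by
    have : y ∉ S := fun h => hy.2 (ho.interior_eq.symm ▸ h)
    rw [hS] at this
    exact not_lt.1 this
  have h2 : u y ≤ u 0 + L := by
    have := ContinuousWithinAt.closure_le (s := S) hy.1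
      ((hcont y hy.1).mono subset_closure) continuousWithinAt_const (fun z hz => by
        rw [hS] at hz; exact le_of_lt hz) (g := fun _ => u 0 + L)
    exact this
  linarith

end Part13

section Part14
open Filter Topology
open scoped ContDiff
set_option maxSynthPendingDepth 8

lemma T2_le_of_locmax {E : Type} [NormedAddCommGroup E] [NormedSpace ℝ E] {f F : E → ℝ} {x : E}
    (hf : ContDiffAt ℝ 2 f x) (hF : ContDiffAt ℝ 2 F x)
    (hmax : ∀ᶠ y in 𝓝 x, f y - F y ≤ f x - F x) (ζ : E) : T2 f x ζ ζ ≤ T2 F x ζ ζ := by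
  have h := second_test (F := fun t : ℝ => f (x + t • ζ) - F (x + t • ζ))
    (F1 := fun t : ℝ => T1 f (x + t • ζ) ζ - T1 F (x + t • ζ) ζ)
    (F2 := T2 f x ζ ζ - T2 F x ζ ζ) ?_ ?_ ((c2_curve hf ζ).2.sub (c2_curve hF ζ).2)
  · linarith [h.2]
  · have hc : Tendsto (fun t : ℝ => x + t • ζ) (𝓝 0) (𝓝 x) := by
      have := (hV x ζ 0).continuousAt.tendsto
      simpa using this
    filter_upwards [hc.eventually hmax] with t ht
    simpa using ht
  · filter_upwards [(c2_curve hf ζ).1, (c2_curve hF ζ).1] with t h1 h2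
    exact h1.sub h2

lemma compare {n : ℕ} (hn : 0 < n) {f F : Euc n → ℝ} {S : Set (Euc n)} (ho : IsOpen S)
    (hbd : Bornology.IsBounded S)
    (hfc : ContinuousOn f (closure S)) (hFc : ContinuousOn F (closure S))
    (hf : ∀ x ∈ S, ContDiffAt ℝ 2 f x) (hF : ∀ x ∈ S, ContDiffAt ℝ 2 F x)
    (hfr : ∀ x ∈ frontier S, f x ≤ F x) (hp : ∀ x ∈ S, ∀ ζ, 0 ≤ T2 f x ζ ζ)
    {c : ℝ} (hc : 1 < c) (hdF : ∀ x ∈ S, 0 < (gramM (T2 F x) stdB).det)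
    (hdet : ∀ x ∈ S, c ^ n * (gramM (T2 F x) stdB).det ≤ (gramM (T2 f x) stdB).det) :
    ∀ x ∈ S, f x ≤ F x := by
  intro y hy
  have hK : IsCompact (closure S) := hbd.isCompact_closure
  obtain ⟨x, hx, hmax⟩ := hK.exists_isMaxOn ⟨y, subset_closure hy⟩ (hfc.sub hFc)
  have hyx : f y - F y ≤ f x - F x := hmax (subset_closure hy)
  by_cases hxS : x ∈ S
  · exfalso
    have h1 := T2_le_of_locmax (hf x hxS) (hF x hxS) (by
      filter_upwards [ho.mem_nhds hxS] with z hz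
      exact hmax (subset_closure hz))
    have := det_mono_forms hn (T2 f x) (T2 F x) (c2_symm (hf x hxS)) (c2_symm (hF x hxS)) (hp x hxS) h1 c
      (by linarith) (hdF x hxS) (hdet x hxS)
    linarith
  · have : x ∈ frontier S := ⟨hx, by rwa [ho.interior_eq]⟩
    linarith [hfr x this]

def quadf {n : ℕ} (a b : ℝ) (ξ : Euc n) (x : Euc n) : ℝ := a * ‖x - ξ‖ ^ 2 + b

lemma quadf_cd {n : ℕ} (a b : ℝ) (ξ : Euc n) : ContDiff ℝ 2 (quadf a b ξ) := by
  unfold quadf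
  exact (contDiff_const.mul ((contDiff_id.sub contDiff_const).norm_sq ℝ)).add contDiff_const

lemma quadf_T1 {n : ℕ} (a b : ℝ) (ξ x : Euc n) : T1 (quadf a b ξ) x = (2 * a) • iForm n (x - ξ) := by
  have h : HasFDerivAt (fun x : Euc n => ‖x - ξ‖ ^ 2) (2 • iForm n (x - ξ)) x := by
    have := ((hasFDerivAt_id x).sub_const ξ).norm_sq
    refine this.congr_fderiv ?_
    ext v
    simp [iForm_apply]
  have h2 := (h.const_mul a).add_const b
  have h3 : T1 (quadf a b ξ) x = a • (2 • iForm n (x - ξ)) := h2.fderiv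
  rw [h3]
  ext v; simp; ring

lemma quadf_T2 {n : ℕ} (a b : ℝ) (ξ x : Euc n) : T2 (quadf a b ξ) x = (2 * a) • iForm n := by
  have h : T1 (quadf a b ξ) = fun x => (2 * a) • iForm n (x - ξ) := funext fun x => quadf_T1 a b ξ x
  have h2 : HasFDerivAt (fun x => (2 * a) • iForm n (x - ξ)) ((2 * a) • iForm n) x := by
    have h4 : HasFDerivAt (fun x => iForm n (x - ξ)) (iForm n) x := by
      have h5 : (fun x => iForm n (x - ξ)) = fun x => iForm n x - iForm n ξ := by
        funext x; rw [map_sub]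
      rw [h5]
      exact ((iForm n).hasFDerivAt).sub_const _
    exact h4.const_smul (2 * a)
  have h3 : T2 (quadf a b ξ) x = fderiv ℝ (T1 (quadf a b ξ)) x := rfl
  rw [h3, h]
  exact h2.fderiv

lemma gramM_smul {n : ℕ} (a : ℝ) (B : Euc n →L[ℝ] Euc n →L[ℝ] ℝ) :
    (gramM (a • B) stdB).det = a ^ n * (gramM B stdB).det := by
  have : gramM (a • B) stdB = a • gramM B stdB := by
    ext i j; simp [gramM]
  rw [this, Matrix.det_smul]; simp

lemma quadf_det {n : ℕ} (a b : ℝ) (ξ x : Euc n) : (gramM (T2 (quadf a b ξ) x) stdB).det = (2 * a) ^ n := by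
  rw [quadf_T2, gramM_smul, inner_std_det, mul_one]

lemma T2_cmul {n : ℕ} (a : ℝ) {w : Euc n → ℝ} {x : Euc n} (hw : ContDiffAt ℝ 2 w x) :
    T2 (fun x => a * w x) x = a • T2 w x := by
  have h1 : T1 (fun x => a * w x) =ᶠ[𝓝 x] fun x => a • T1 w x := by
    filter_upwards [hw.eventually (by simp)] with y hy
    exact fderiv_const_mul (hy.differentiableAt (by simp)) a
  have h2 : T2 (fun x => a * w x) x = fderiv ℝ (fun x => a • T1 w x) x := h1.fderiv_eq
  rw [h2]
  have h3 : ContDiffAt ℝ 1 (T1 w) x := hw.fderiv_right (by norm_num)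
  exact fderiv_fun_const_smul (h3.differentiableAt (by simp)) a

end Part14

section Part15
open Filter Topology
open scoped ContDiff
set_option maxSynthPendingDepth 8

lemma two_le_infty : (2 : WithTop ℕ∞) ≤ ∞ := by
  have : ((2 : ℕ∞) : WithTop ℕ∞) ≤ ((⊤ : ℕ∞) : WithTop ℕ∞) := WithTop.coe_le_coe.2 le_top
  exact this

lemma mk_MA {n : ℕ} {S : Set (Euc n)} {w : Euc n → ℝ} (ho : IsOpen S) (hw : ContDiffOn ℝ ∞ w S)
    (hc : ConvexOn ℝ S w) (hd : ∀ x ∈ S, (gramM (T2 w x) stdB).det = 1) : MA n S w := by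
  have hat : ∀ x ∈ S, ContDiffAt ℝ 2 w x := fun x hx =>
    (hw.contDiffAt (ho.mem_nhds hx)).of_le two_le_infty
  have hpsd : ∀ x ∈ S, ∀ v, 0 ≤ T2 w x v v := fun x hx v => psd_of_convex hc (ho.mem_nhds hx) (hat x hx) v
  have honb : ∀ x ∈ S, _ := fun x hx =>
    exists_onb (T2 w x) (c2_symm (hat x hx)) (hpsd x hx) (by rw [hd x hx]; exact one_ne_zero)
  refine ⟨ho, hw, ?_, ?_⟩
  · intro x hx v hv
    obtain ⟨e, he, hexp, -⟩ := honb x hx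
    refine lt_of_le_of_ne (hpsd x hx v) fun h0 => hv ?_
    have h1 : T2 w x v v = ∑ a, (T2 w x v (e a)) ^ 2 := by
      conv_lhs => rw [hexp v]
      simp only [map_sum, sum_apply, map_smul, smul_apply, smul_eq_mul]
      simp [he, sq]
    rw [← h0] at h1
    have h2 := (Finset.sum_eq_zero_iff_of_nonneg (fun a _ => sq_nonneg _)).1 h1.symm
    rw [hexp v]
    refine Finset.sum_eq_zero fun a ha => ?_
    rw [pow_eq_zero_iff two_ne_zero |>.1 (h2 a ha), zero_smul]
  · intro x hx
    obtain ⟨e, he, hexp, hde⟩ := honb x hx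
    refine ⟨e, he, hexp, fun y hy => ?_⟩
    have := gramM_det (T2 w y) e
    rw [hd y hy] at this
    rw [hd x hx] at hde
    rw [hde] at this
    exact this

lemma sub_compact {n : ℕ} {S : Set (Euc n)} {w : Euc n → ℝ} (hbd : Bornology.IsBounded S)
    (hw : ContinuousOn w (closure S)) (hfr : ∀ x ∈ frontier S, w x = 0) (ho : IsOpen S) {ε : ℝ} (hε : 0 < ε) :
    IsCompact {x | x ∈ S ∧ w x ≤ -ε} := by
  have : {x | x ∈ S ∧ w x ≤ -ε} = closure S ∩ w ⁻¹' (Set.Iic (-ε)) := by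
    ext x
    constructor
    · rintro ⟨h1, h2⟩; exact ⟨subset_closure h1, h2⟩
    · rintro ⟨h1, h2⟩
      refine ⟨?_, h2⟩
      by_contra hx
      have h3 := hfr x ⟨h1, by rwa [ho.interior_eq]⟩
      have : w x ≤ -ε := h2
      linarith
  rw [this]
  exact hbd.isCompact_closure.of_isClosed_subset
    (hw.preimage_isClosed_of_isClosed isClosed_closure isClosed_Iic) Set.inter_subset_left

/-- Data of the problem after the openness of the section has been established. -/
structure Setup (n : ℕ) (S : Set (Euc n)) (ξ : Euc n) (u w : Euc n → ℝ) (δ : ℝ) : Prop where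
  hn : 2 ≤ n
  ho : IsOpen S
  hcS : Convex ℝ S
  hSu : S = {z | u z < 0}
  h0 : u 0 < 0
  uconv : ConvexOn ℝ (closure S) u
  ucont : ContinuousOn u (closure S)
  uC2 : ∀ x ∈ S, ContDiffAt ℝ 2 u x
  b1 : Metric.ball ξ 1 ⊆ S
  b2 : S ⊆ Metric.ball ξ n
  ufr : ∀ x ∈ frontier S, u x = 0
  wfr : ∀ x ∈ frontier S, w x = 0
  du0 : fderiv ℝ u 0 = 0
  hδ : 0 ≤ δ
  hδ2 : δ ≤ 1 / 20
  dl : ∀ x ∈ S, (1 - δ) ^ n ≤ (gramM (T2 u x) stdB).det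
  du : ∀ x ∈ S, (gramM (T2 u x) stdB).det ≤ (1 + δ) ^ n
  wconv : ConvexOn ℝ S w
  wsm : ContDiffOn ℝ ∞ w S
  wcont : ContinuousOn w (closure S)
  wd : ∀ x ∈ S, (gramM (T2 w x) stdB).det = 1

namespace Setup
variable {n : ℕ} {S : Set (Euc n)} {ξ : Euc n} {u w : Euc n → ℝ} {δ : ℝ} (H : Setup n S ξ u w δ)

lemma zero_mem (H : Setup n S ξ u w δ) : (0 : Euc n) ∈ S := by rw [H.hSu]; exact H.h0

lemma bdd (H : Setup n S ξ u w δ) : Bornology.IsBounded S := Metric.isBounded_ball.subset H.b2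

lemma wC2 (H : Setup n S ξ u w δ) : ∀ x ∈ S, ContDiffAt ℝ 2 w x := fun x hx =>
    (H.wsm.contDiffAt (H.ho.mem_nhds hx)).of_le two_le_infty

lemma n0 (H : Setup n S ξ u w δ) : 0 < n := by have := H.hn; omega

lemma upsd (H : Setup n S ξ u w δ) : ∀ x ∈ S, ∀ v, 0 ≤ T2 u x v v := fun x hx v =>
  psd_of_convex H.uconv (mem_of_superset (H.ho.mem_nhds hx) subset_closure) (H.uC2 x hx) v

lemma wpsd (H : Setup n S ξ u w δ) : ∀ x ∈ S, ∀ v, 0 ≤ T2 w x v v := fun x hx v =>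
  psd_of_convex H.wconv (H.ho.mem_nhds hx) (H.wC2 x hx) v

lemma ma (H : Setup n S ξ u w δ) : MA n S w := mk_MA H.ho H.wsm H.wconv H.wd

lemma wlow (H : Setup n S ξ u w δ) : ∀ x ∈ S, -((n:ℝ) ^ 2) ≤ w x := by
  intro x hx
  have h := compare H.n0 (f := quadf 1 (-(n:ℝ) ^ 2) ξ) (F := w) H.ho H.bdd
    (quadf_cd _ _ _).continuous.continuousOn H.wcont
    (fun x _ => (quadf_cd _ _ _).contDiffAt) H.wC2 (fun x hx => by
      rw [H.wfr x hx]
      have h1 : x ∈ Metric.closedBall ξ n :=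
        closure_minimal (H.b2.trans Metric.ball_subset_closedBall) Metric.isClosed_closedBall hx.1
      rw [Metric.mem_closedBall, dist_eq_norm] at h1
      unfold quadf
      nlinarith [norm_nonneg (x - ξ)])
    (fun x _ ζ => by
      rw [quadf_T2]; simp only [smul_apply, iForm_apply, real_inner_self_eq_norm_sq, smul_eq_mul]; positivity)
    (c := 2) (by norm_num) (fun x hx => by rw [H.wd x hx]; exact one_pos)
    (fun x hx => by rw [H.wd x hx, quadf_det]; norm_num) x hx
  unfold quadf at h
  nlinarith [sq_nonneg ‖x - ξ‖]

lemma unonpos (H : Setup n S ξ u w δ) : ∀ x ∈ closure S, u x ≤ 0 := by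
  intro x hx
  by_cases hxS : x ∈ S
  · rw [H.hSu] at hxS; exact le_of_lt hxS
  · exact (H.ufr x ⟨hx, by rwa [H.ho.interior_eq]⟩).le

lemma umin (H : Setup n S ξ u w δ) : ∀ x ∈ closure S, u 0 ≤ u x := by
  intro x hx
  have := convex_tangent H.uconv (subset_closure H.zero_mem) hx
    ((H.uC2 0 H.zero_mem).differentiableAt (by simp))
  rw [H.du0] at this
  simpa using this

lemma u0le (H : Setup n S ξ u w δ) : u 0 ≤ -1 / 4 := by
  have hcl : closure (Metric.ball ξ 1) ⊆ closure S := closure_mono H.b1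
  have h := compare H.n0 (f := u) (F := quadf (1/4) (-1/4) ξ) (S := Metric.ball ξ 1) Metric.isOpen_ball
    Metric.isBounded_ball (H.ucont.mono hcl)
    (quadf_cd _ _ _).continuous.continuousOn (fun x hx => H.uC2 x (H.b1 hx))
    (fun x _ => (quadf_cd _ _ _).contDiffAt) (fun x hx => by
      have h1 : ‖x - ξ‖ = 1 := by
        rw [frontier_ball _ one_ne_zero, Metric.mem_sphere, dist_eq_norm] at hx; exact hx
      unfold quadf
      rw [h1]
      linarith [H.unonpos x (hcl hx.1)])
    (fun x hx => H.upsd x (H.b1 hx))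
    (c := 19 / 10) (by norm_num) (fun x hx => by rw [quadf_det]; norm_num)
    (fun x hx => by
      rw [quadf_det, ← mul_pow]
      refine le_trans ?_ (H.dl x (H.b1 hx))
      have := H.hδ2
      exact pow_le_pow_left₀ (by norm_num) (by linarith) n) ξ (Metric.mem_ball_self one_pos)
  have h2 := H.umin ξ (subset_closure (H.b1 (Metric.mem_ball_self one_pos)))
  unfold quadf at h
  simp at h
  linarith


lemma u_ge (H : Setup n S ξ u w δ) : ∀ x ∈ S, (1 + δ) * w x ≤ u x := by
  intro x hx
  have key : ∀ ε : ℝ, 0 < ε → (1 + δ + ε) * w x ≤ u x := by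
    intro ε hε
    have hδ := H.hδ
    exact compare H.n0 (f := fun x => (1 + δ + ε) * w x) (F := u) H.ho H.bdd
      (continuousOn_const.mul H.wcont) H.ucont (fun x hx => contDiffAt_const.mul (H.wC2 x hx)) H.uC2
      (fun x hx => by simp [H.wfr x hx, H.ufr x hx])
      (fun x hx ζ => by
        rw [T2_cmul _ (H.wC2 x hx)]
        exact mul_nonneg (by positivity) (H.wpsd x hx ζ))
      (c := (1 + δ + ε) / (1 + δ)) (by rw [lt_div_iff₀ (by positivity)]; linarith)
      (fun x hx => lt_of_lt_of_le (pow_pos (by linarith [H.hδ2]) n) (H.dl x hx))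
      (fun x hx => by
        rw [T2_cmul _ (H.wC2 x hx), gramM_smul, H.wd x hx, mul_one, div_pow, div_mul_eq_mul_div,
          div_le_iff₀ (by positivity)]
        exact mul_le_mul_of_nonneg_left (H.du x hx) (by positivity)) x hx
  refine le_of_tendsto (x := 𝓝[>] (0:ℝ)) (f := fun ε : ℝ => (1 + δ + ε) * w x) ?_
    (eventually_mem_nhdsWithin.mono fun ε hε => key ε hε)
  have : ContinuousAt (fun ε : ℝ => (1 + δ + ε) * w x) 0 := by fun_prop
  have h2 := this.tendsto.mono_left (nhdsWithin_le_nhds (s := Set.Ioi (0:ℝ)))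
  simpa using h2

lemma u_le (H : Setup n S ξ u w δ) : ∀ x ∈ S, u x ≤ (1 - δ) * w x := by
  intro x hx
  have hδ := H.hδ
  have hδ2 := H.hδ2
  have key : ∀ ε : ℝ, 0 < ε → ε < 1 / 2 → u x ≤ (1 - δ - ε) * w x := by
    intro ε hε hε2
    have hpos : 0 < 1 - δ - ε := by linarith
    exact compare H.n0 (f := u) (F := fun x => (1 - δ - ε) * w x) H.ho H.bdd H.ucont
      (continuousOn_const.mul H.wcont) H.uC2 (fun x hx => contDiffAt_const.mul (H.wC2 x hx)) 
      (fun x hx => by simp [H.wfr x hx, H.ufr x hx]) H.upsd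
      (c := (1 - δ) / (1 - δ - ε)) (by rw [lt_div_iff₀ hpos]; linarith)
      (fun x hx => by
        rw [T2_cmul _ (H.wC2 x hx), gramM_smul, H.wd x hx, mul_one]; positivity)
      (fun x hx => by
        rw [T2_cmul _ (H.wC2 x hx), gramM_smul, H.wd x hx, mul_one, ← mul_pow,
          div_mul_cancel₀ _ hpos.ne']
        exact H.dl x hx) x hx
  refine ge_of_tendsto (x := 𝓝[>] (0:ℝ)) (f := fun ε : ℝ => (1 - δ - ε) * w x) ?_ ?_
  · have : ContinuousAt (fun ε : ℝ => (1 - δ - ε) * w x) 0 := by fun_prop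
    have h2 := this.tendsto.mono_left (nhdsWithin_le_nhds (s := Set.Ioi (0:ℝ)))
    simpa using h2
  · filter_upwards [Ioo_mem_nhdsGT (show (0:ℝ) < 1 / 2 by norm_num)] with ε hε
    exact key ε hε.1 hε.2

lemma uw (H : Setup n S ξ u w δ) : ∀ x ∈ S, |u x - w x| ≤ δ * (n:ℝ) ^ 2 := by
  intro x hx
  have h1 := H.u_ge x hx
  have h2 := H.u_le x hx
  have h3 := mul_le_mul_of_nonneg_left (H.wlow x hx) H.hδ
  rw [abs_le]
  constructor <;> nlinarith

lemma w0le (H : Setup n S ξ u w δ) : w 0 ≤ -1 / 8 := by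
  have h1 := H.u_ge 0 H.zero_mem
  have h2 := H.u0le
  by_contra h
  push Not at h
  nlinarith [H.hδ, H.hδ2]

end Setup

end Part15

section Part16
open Filter Topology
open scoped ContDiff
set_option maxSynthPendingDepth 8

lemma expand_w (n : ℕ) (hn : 2 ≤ n) : ∃ K r0 : ℝ, 0 < K ∧ 0 < r0 ∧
    ∀ (S : Set (Euc n)) (ξ : Euc n) (u w : Euc n → ℝ) (δ : ℝ), Setup n S ξ u w δ →
      ∀ (x : Euc n) (t : ℝ), 0 ≤ t → t ≤ r0 → T2 w 0 x x = t ^ 2 →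
        x ∈ S ∧ |w x - w 0 - T1 w 0 x - t ^ 2 / 2| ≤ 8 * K * t ^ 3 := by
  have hnn : (0:ℝ) < n := by exact_mod_cast (by omega : 0 < n)
  set Λ : ℝ := (n:ℝ) ^ 2 with hΛ
  have hΛ0 : 0 < Λ := by positivity
  have hCP : 0 < CPc n Λ := by unfold CPc; positivity
  have hCQ : 0 < CQc n Λ := by unfold CQc; positivity
  set p0 := Real.sqrt (32 ^ (4 * n) * CPc n Λ) with hp0
  set K := Real.sqrt (32 ^ (4 * n + 2) * CQc n Λ) with hK
  have hp0' : 0 < p0 := Real.sqrt_pos.2 (by positivity)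
  have hK' : 0 < K := Real.sqrt_pos.2 (by positivity)
  have hp2 : p0 ^ 2 = 32 ^ (4 * n) * CPc n Λ := Real.sq_sqrt (by positivity)
  have hK2 : K ^ 2 = 32 ^ (4 * n + 2) * CQc n Λ := Real.sq_sqrt (by positivity)
  refine ⟨K, min (1 / (64 * p0)) (1 / (8 * K)), hK', lt_min (by positivity) (by positivity), ?_⟩
  intro S ξ u w δ H x t ht0 htr hx
  have hcpt : ∀ ε : ℝ, 0 < ε → IsCompact {x | x ∈ S ∧ w x ≤ -ε} := fun ε hε =>
    sub_compact H.bdd H.wcont H.wfr H.ho hε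
  have aux : ∀ (m : ℕ) (s a b : ℝ), 1 / 32 ≤ s → 0 ≤ a → s ^ m * a ≤ b → a ≤ 32 ^ m * b := by
    intro m s a b hs ha hab
    have h1 : (1:ℝ) ≤ 32 ^ m * s ^ m := by
      rw [← mul_pow]; exact one_le_pow₀ (by linarith)
    calc a ≤ (32 ^ m * s ^ m) * a := le_mul_of_one_le_left ha h1
      _ = 32 ^ m * (s ^ m * a) := by ring
      _ ≤ _ := by gcongr
  have hP := P_est H.ma hn (ε := 1 / 32) (by norm_num) (hcpt _ (by norm_num)) H.wlow hΛ0.le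
  have hQ := Q_est H.ma hn (ε := 1 / 32) (by norm_num) (hcpt _ (by norm_num)) H.wlow hΛ0.le
  have hloc := local_exp H.ma H.zero_mem H.w0le (by
      have := hcpt (1 / 16) (by norm_num)
      rwa [show -(1/16 : ℝ) = -1/16 by norm_num] at this) hp0' hK'
    (fun y hy hwy V => by
      rw [hp2, mul_assoc]
      exact aux _ (- w y - 1 / 32) _ _ (by linarith) (sq_nonneg _) (hP y hy (by linarith) V))
    (fun y hy hwy V => by
      rw [hK2, mul_assoc]
      exact aux _ (- w y - 1 / 32) _ _ (by linarith) (sq_nonneg _) (hQ y hy (by linarith) V))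
    (r0 := min (1 / (64 * p0)) (1 / (8 * K)))
    (by
      calc min (1 / (64 * p0)) (1 / (8 * K)) * p0 ≤ 1 / (64 * p0) * p0 := by
            gcongr; exact min_le_left _ _
        _ = 1 / 64 := by field_simp)
    (by
      calc min (1 / (64 * p0)) (1 / (8 * K)) * K ≤ 1 / (8 * K) * K := by
            gcongr; exact min_le_right _ _
        _ = 1 / 8 := by field_simp)
  rcases ht0.eq_or_lt with h | h
  · have hx0 : x = 0 := by
      by_contra hne
      have := H.ma.pos 0 H.zero_mem x hne
      rw [hx, ← h] at this
      norm_num at this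
    rw [hx0, ← h]
    refine ⟨H.zero_mem, ?_⟩
    simp
  · have h1 := hloc (t⁻¹ • x) (by
      simp only [map_smul, smul_apply, smul_eq_mul, hx]; field_simp) t ⟨ht0, htr⟩
    rw [smul_smul, mul_inv_cancel₀ h.ne', one_smul, map_smul, smul_eq_mul, ← mul_assoc,
      mul_inv_cancel₀ h.ne', one_mul] at h1
    exact h1

lemma T1_comp {n : ℕ} {u : Euc n → ℝ} (P : Euc n →L[ℝ] Euc n) (a : ℝ) {y : Euc n}
    (hu : DifferentiableAt ℝ u (P y)) :
    T1 (fun y => a * u (P y)) y = a • (T1 u (P y)).comp P :=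
  ((hu.hasFDerivAt.comp y P.hasFDerivAt).const_mul a).fderiv

lemma T2_comp {n : ℕ} {u : Euc n → ℝ} (P : Euc n →L[ℝ] Euc n) (a : ℝ) {y : Euc n}
    (hu : ContDiffAt ℝ 2 u (P y)) (v z : Euc n) :
    T2 (fun y => a * u (P y)) y v z = a * T2 u (P y) (P v) (P z) := by
  have hU : ContDiffAt ℝ 2 (fun y => a * u (P y)) y :=
    contDiffAt_const.mul (hu.comp y P.contDiff.contDiffAt)
  have h1 : ContDiffAt ℝ 1 (T1 (fun y => a * u (P y))) y := hU.fderiv_right (by norm_num)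
  have h2 : ContDiffAt ℝ 1 (T1 u) (P y) := hu.fderiv_right (by norm_num)
  have c1 := (gen_curve (h1.differentiableAt (by simp)) v).clm_apply (hasDerivAt_const (0:ℝ) z)
  have c2 := ((gen_curve (h2.differentiableAt (by simp)) (P v)).clm_apply
    (hasDerivAt_const (0:ℝ) (P z))).const_mul a
  have hev : (fun t : ℝ => T1 (fun y => a * u (P y)) (y + t • v) z) =ᶠ[𝓝 0]
      fun t : ℝ => a * T1 u (P y + t • P v) (P z) := by
    have hc : Tendsto (fun t : ℝ => P y + t • P v) (𝓝 0) (𝓝 (P y)) := by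
      have := (hV (P y) (P v) 0).continuousAt.tendsto
      simpa using this
    filter_upwards [hc.eventually (hu.eventually (by simp))] with t ht
    have e1 : P (y + t • v) = P y + t • P v := by simp
    rw [T1_comp P a (by rw [e1]; exact ht.differentiableAt (by simp)), e1]
    simp
  have h3 := c1.unique (c2.congr_of_eventuallyEq hev)
  simpa using h3

end Part16

section Part17
open Filter Topology
open scoped ContDiff
set_option maxSynthPendingDepth 8

def Gc (n : ℕ) : ℝ := 12 * (4 * (2 * 8 ^ n) + 4) ^ 2 + 4 * (2 * 8 ^ n) + 3

lemma Gc_ge (n : ℕ) : 1 ≤ Gc n := by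
  unfold Gc
  have : (0:ℝ) ≤ 12 * (4 * (2 * 8 ^ n) + 4) ^ 2 + 4 * (2 * 8 ^ n) := by positivity
  linarith

lemma core_est {n : ℕ} {S : Set (Euc n)} {ξ : Euc n} {u w : Euc n → ℝ} {δ : ℝ}
    (H : Setup n S ξ u w δ) {K r0 : ℝ} (hK : 0 < K)
    (hexp : ∀ (x : Euc n) (t : ℝ), 0 ≤ t → t ≤ r0 → T2 w 0 x x = t ^ 2 →
        x ∈ S ∧ |w x - w 0 - T1 w 0 x - t ^ 2 / 2| ≤ 8 * K * t ^ 3)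
    {h : ℝ} (hh : 0 < h) (hh1 : h ≤ 1) (hhr : 2 * √h ≤ r0) (P : Euc n →L[ℝ] Euc n)
    (hP : ∀ y, T2 w 0 (P y) (P y) = h * ‖y‖ ^ 2)
    (hPd : (colM (fun i => P (stdB i))).det ^ 2 = h ^ n) {κ : ℝ} (hκ0 : 0 < κ) (hκ1 : κ ≤ 1 / 16)
    (hκ : n ^ 2 * (δ / h) + 64 * K * √h ≤ κ) :
    ∀ y : Euc n, ‖y‖ ≤ 2 → P y ∈ S ∧ |h⁻¹ * u (P y) - h⁻¹ * u 0 - 1 / 2 * ‖y‖ ^ 2| ≤ (2 + 2 * Gc n) * κ := by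
  have hs0 : 0 < √h := Real.sqrt_pos.2 hh
  have hs2 : √h ^ 2 = h := Real.sq_sqrt hh.le
  have hn1 : (1:ℝ) ≤ n := by exact_mod_cast H.n0
  have hE : ∀ y : Euc n, ‖y‖ ≤ 2 → P y ∈ S ∧
      |w (P y) - w 0 - T1 w 0 (P y) - h * ‖y‖ ^ 2 / 2| ≤ 64 * K * (h * √h) := by
    intro y hy
    have h1 := hexp (P y) (√h * ‖y‖) (by positivity)
      (le_trans (by nlinarith) hhr) (by rw [hP, mul_pow, hs2])
    refine ⟨h1.1, ?_⟩
    have h2 := h1.2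
    rw [mul_pow, hs2] at h2
    refine h2.trans ?_
    have e1 : (√h * ‖y‖) ^ 3 = h * √h * ‖y‖ ^ 3 := by
      rw [mul_pow, pow_succ, hs2]
    rw [e1]
    have e2 : ‖y‖ ^ 3 ≤ 2 ^ 3 := pow_le_pow_left₀ (norm_nonneg _) hy 3
    calc 8 * K * (h * √h * ‖y‖ ^ 3) ≤ 8 * K * (h * √h * 2 ^ 3) := by gcongr
      _ = _ := by ring
  set ℓ : Euc n := (InnerProductSpace.toDual ℝ (Euc n)).symm (h⁻¹ • (T1 w 0).comp P) with hℓ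
  have hℓi : ∀ y, ⟪ℓ, y⟫ = h⁻¹ * T1 w 0 (P y) := by
    intro y
    rw [hℓ, InnerProductSpace.toDual_symm_apply]; simp
  set U : Euc n → ℝ := fun y => h⁻¹ * u (P y) with hU
  have happ : ∀ y : Euc n, ‖y‖ ≤ 2 → |U y - (h⁻¹ * w 0 + ⟪ℓ, y⟫ + 1 / 2 * ‖y‖ ^ 2)| ≤ κ := by
    intro y hy
    obtain ⟨hy1, hy2⟩ := hE y hy
    have hy3 := H.uw _ hy1
    have e1 : U y - (h⁻¹ * w 0 + ⟪ℓ, y⟫ + 1 / 2 * ‖y‖ ^ 2) = h⁻¹ * ((u (P y) - w (P y)) +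
        (w (P y) - w 0 - T1 w 0 (P y) - h * ‖y‖ ^ 2 / 2)) := by
      rw [hℓi, hU]; field_simp; ring
    rw [e1, abs_mul, abs_of_pos (inv_pos.2 hh)]
    calc h⁻¹ * |(u (P y) - w (P y)) + (w (P y) - w 0 - T1 w 0 (P y) - h * ‖y‖ ^ 2 / 2)|
        ≤ h⁻¹ * (δ * n ^ 2 + 64 * K * (h * √h)) := by
          gcongr
          exact (abs_add_le _ _).trans (add_le_add hy3 hy2)
      _ = n ^ 2 * (δ / h) + 64 * K * √h := by field_simp
      _ ≤ κ := hκ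
  have hPS : ∀ y : Euc n, ‖y‖ ≤ 2 → P y ∈ S := fun y hy => (hE y hy).1
  have hδκ : δ ≤ κ := by
    refine le_trans ?_ hκ
    have h1 : δ ≤ δ / h := by rw [le_div_iff₀ hh]; nlinarith [H.hδ]
    have h2 : 0 ≤ δ / h := div_nonneg H.hδ hh.le
    have h3 : 0 ≤ 64 * K * √h := by positivity
    have h4 : (1:ℝ) ≤ (n:ℝ) ^ 2 := one_le_pow₀ hn1
    have h5 := mul_le_mul_of_nonneg_right h4 h2
    linarith
  have hdet : ∀ y : Euc n, ‖y‖ < 1 → (gramM (T2 U y) stdB).det = (gramM (T2 u (P y)) stdB).det := by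
    intro y hy
    have h1 : gramM (T2 U y) stdB = gramM (h⁻¹ • T2 u (P y)) (fun i => P (stdB i)) := by
      ext i j
      simp only [gramM, Matrix.of_apply, smul_apply, smul_eq_mul]
      exact T2_comp P h⁻¹ (H.uC2 _ (hPS y (by linarith))) _ _
    rw [h1, gramM_det, gramM_smul, hPd, inv_pow]
    field_simp
  have hl := lemG H.n0 (u := U) (ℓ := ℓ) (c := h⁻¹ * w 0) (κ := κ) (δ := δ) rfl
    (fun y hy => contDiffAt_const.mul ((H.uC2 _ (hPS y (by linarith))).comp y P.contDiff.contDiffAt))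
    (continuousOn_const.mul (H.ucont.comp P.continuous.continuousOn (fun y hy => subset_closure (hPS y (by
      rw [mem_closedBall_zero_iff] at hy; linarith)))))
    (by
      have h1 : ConvexOn ℝ (Metric.closedBall 0 1) (fun y => u (P y)) :=
        (H.uconv.comp_linearMap P.toLinearMap).subset (fun y hy => subset_closure (hPS y (by
          rw [mem_closedBall_zero_iff] at hy; linarith))) (convex_closedBall _ _)
      exact h1.smul (inv_pos.2 hh).le)
    (by
      have := T1_comp (u := u) P h⁻¹ (y := 0) (by
        rw [map_zero]; exact (H.uC2 0 H.zero_mem).differentiableAt (by simp))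
      rw [map_zero] at this
      change T1 U 0 = 0
      rw [hU, this]
      change h⁻¹ • (fderiv ℝ u 0).comp P = 0
      rw [H.du0]; simp) hκ0 hκ1 H.hδ hδκ (fun y hy => happ y (by linarith))
    (fun y hy => by rw [hdet y hy]; exact H.dl _ (hPS y (by linarith)))
    (fun y hy => by rw [hdet y hy]; exact H.du _ (hPS y (by linarith)))
  intro y hy
  refine ⟨hPS y hy, ?_⟩
  have a1 := happ y hy
  have a2 := happ 0 (by simp)
  simp only [inner_zero_right, norm_zero, hU, map_zero] at a2
  have a3 : |⟪ℓ, y⟫| ≤ 2 * (Gc n * κ) := by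
    refine (abs_real_inner_le_norm ℓ y).trans ?_
    have : ‖ℓ‖ ≤ Gc n * κ := hl
    nlinarith [norm_nonneg ℓ, norm_nonneg y]
  rw [abs_le] at a1 a2 a3 ⊢
  simp only [hU] at a1
  constructor <;> nlinarith [a1.1, a1.2, a2.1, a2.2, a3.1, a3.2]

lemma core_sets {n : ℕ} {S : Set (Euc n)} {ξ : Euc n} {u w : Euc n → ℝ} {δ : ℝ}
    (H : Setup n S ξ u w δ) {h θ : ℝ} (hh : 0 < h) (hhL : u 0 + h ≤ 0) (hθ0 : 0 ≤ θ) (hθ : θ ≤ 1 / 2)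
    (P : Euc n →L[ℝ] Euc n) (T : Euc n → Euc n) (hTP : ∀ y, T (P y) = y) (hPT : ∀ x, P (T x) = x)
    (hest : ∀ y : Euc n, ‖y‖ ≤ 2 → P y ∈ S ∧ |h⁻¹ * u (P y) - h⁻¹ * u 0 - 1 / 2 * ‖y‖ ^ 2| ≤ θ) :
    ∃ rm rp : ℝ, Metric.ball (0 : Euc n) 1 ⊆ Metric.ball (0 : Euc n) rm ∧
      Metric.ball (0 : Euc n) rm ⊆ T '' {z : Euc n | u z < u 0 + h} ∧
      T '' {z : Euc n | u z < u 0 + h} ⊆ Metric.ball (0 : Euc n) rp ∧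
      Metric.ball (0 : Euc n) rp ⊆ Metric.ball (0 : Euc n) 2 ∧
      |rm ^ 2 / 2 - 1| ≤ θ ∧ |rp ^ 2 / 2 - 1| ≤ θ := by
  have key : ∀ x : Euc n, h⁻¹ * u x - h⁻¹ * u 0 < 1 ↔ u x < u 0 + h := by
    intro x
    rw [← mul_sub, inv_mul_lt_iff₀ hh, mul_one]
    constructor <;> intro h <;> linarith
  have s1 : √(2 * (1 - θ)) ^ 2 = 2 * (1 - θ) := Real.sq_sqrt (by linarith)
  have s2 : √(2 * (1 + θ)) ^ 2 = 2 * (1 + θ) := Real.sq_sqrt (by linarith)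
  have hlow : ∀ x : Euc n, u x < u 0 + h → ‖T x‖ ≤ 2 := by
    intro x hx
    by_contra hcon
    push Not at hcon
    have hy0 : 0 < ‖T x‖ := by linarith
    set s := 2 / ‖T x‖ with hs
    have hs0 : 0 < s := by positivity
    have hs1 : s < 1 := by rw [hs, div_lt_one hy0]; exact hcon
    have hnz : ‖s • T x‖ = 2 := by
      rw [norm_smul, Real.norm_eq_abs, abs_of_pos hs0, hs, div_mul_cancel₀ _ hy0.ne']
    obtain ⟨-, h2⟩ := hest (s • T x) hnz.le
    rw [hnz, map_smul, hPT] at h2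
    have hxS : x ∈ closure S := subset_closure (by rw [H.hSu]; exact lt_of_lt_of_le hx hhL)
    have h3 := H.uconv.2 (subset_closure H.zero_mem) hxS (by linarith : 0 ≤ 1 - s) hs0.le (by ring)
    rw [smul_zero, zero_add, smul_eq_mul, smul_eq_mul] at h3
    have h4 : u (s • x) < u 0 + h := by nlinarith
    have h5 := (key _).2 h4
    have h6 := (abs_le.1 h2).1
    linarith
  refine ⟨√(2 * (1 - θ)), √(2 * (1 + θ)), ?_, ?_, ?_, ?_, ?_, ?_⟩
  · exact Metric.ball_subset_ball (Real.le_sqrt_of_sq_le (by linarith))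
  · intro y hy
    rw [mem_ball_zero_iff, Real.lt_sqrt (norm_nonneg _)] at hy
    refine ⟨P y, ?_, hTP y⟩
    have hy2 : ‖y‖ ≤ 2 := by nlinarith [norm_nonneg y]
    have h2 := (abs_le.1 (hest y hy2).2).2
    exact (key _).1 (by linarith)
  · rintro _ ⟨x, hx, rfl⟩
    have hx' : u x < u 0 + h := hx
    rw [mem_ball_zero_iff, Real.lt_sqrt (norm_nonneg _)]
    have h2 := (hest (T x) (hlow x hx')).2
    rw [hPT] at h2
    have h3 := (abs_le.1 h2).1
    have h4 := (key x).2 hx'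
    linarith
  · refine Metric.ball_subset_ball (Real.sqrt_le_iff.2 ⟨by norm_num, by linarith⟩)
  · rw [s1, abs_le]; constructor <;> linarith
  · rw [s2, abs_le]; constructor <;> linarith

end Part17

section Part18
open Filter Topology
open scoped ContDiff
set_option maxSynthPendingDepth 8

lemma sq_form {n : ℕ} (B : Euc n →L[ℝ] Euc n →L[ℝ] ℝ) {R : Matrix (Fin n) (Fin n) ℝ}
    (hR : R.PosSemidef) (hRR : R * R = gramM B stdB) (x : Euc n) :
    B x x = ‖Matrix.toEuclideanLin R x‖ ^ 2 := by
  have hsym : ∀ i j, R i j = R j i := by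
    intro i j
    have := hR.1.apply j i
    simpa using this
  have hg : ∀ i j, B (stdB i) (stdB j) = ∑ k, R k i * R k j := by
    intro i j
    have : (R * R) i j = gramM B stdB i j := by rw [hRR]
    rw [Matrix.mul_apply] at this
    simp only [gramM, Matrix.of_apply] at this
    rw [← this]
    exact Finset.sum_congr rfl fun k _ => by rw [hsym k i]
  rw [bil_expand, EuclideanSpace.norm_sq_eq]
  have e : ∀ k, (Matrix.toEuclideanLin R x) k = ∑ i, R k i * x i := by
    intro k
    simp [Matrix.toEuclideanLin, Matrix.toLpLin, Matrix.mulVec, dotProduct]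
  simp only [e, Real.norm_eq_abs, sq_abs, hg]
  simp only [pow_two, Finset.sum_mul_sum, Finset.mul_sum, Finset.sum_mul]
  rw [Finset.sum_comm' (s := Finset.univ) (t := fun _ => Finset.univ) (t' := Finset.univ) (s' := fun _ => Finset.univ) (by simp)]
  rw [Finset.sum_comm]
  have : ∀ f : Fin n → Fin n → Fin n → ℝ, ∑ i, ∑ j, ∑ k, f i j k = ∑ k, ∑ i, ∑ j, f i j k := by
    intro f
    rw [Finset.sum_comm (s := Finset.univ) (t := Finset.univ) (f := fun k i => ∑ j, f i j k)]
    exact Finset.sum_congr rfl fun i _ => Finset.sum_comm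
  rw [this]
  refine Finset.sum_congr rfl fun k _ => Finset.sum_congr rfl fun i _ =>
    Finset.sum_congr rfl fun j _ => by ring

lemma toLin_mul_apply {n : ℕ} (A B : Matrix (Fin n) (Fin n) ℝ) (x : Euc n) :
    Matrix.toEuclideanLin A (Matrix.toEuclideanLin B x) = Matrix.toEuclideanLin (A * B) x := by
  simp [Matrix.toEuclideanLin, Matrix.toLpLin, Matrix.mulVec_mulVec]

lemma toLin_one_apply {n : ℕ} (x : Euc n) :
    Matrix.toEuclideanLin (1 : Matrix (Fin n) (Fin n) ℝ) x = x := by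
  simp [Matrix.toEuclideanLin, Matrix.toLpLin]

lemma final_aux (n : ℕ) (hn : 2 ≤ n) :
    ∃ C₄ hc C' : ℝ, 0 < C₄ ∧ C₄ ≤ 1 ∧ 0 < hc ∧ hc ≤ 1 / 5 ∧ 0 < C' ∧ hc ≤ 1 / 8 ∧
      ∀ (S : Set (Euc n)) (ξ : Euc n) (u w : Euc n → ℝ) (δ : ℝ), Setup n S ξ u w δ →
        ∀ h : ℝ, 0 < h → h ≤ hc → δ ≤ C₄ * h →
          ∀ R : Matrix (Fin n) (Fin n) ℝ, R.PosSemidef → R * R = hessianMatrix w 0 →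
            ∃ rm rp : ℝ,
              Metric.ball (0 : Euc n) 1 ⊆ Metric.ball (0 : Euc n) rm ∧
              Metric.ball (0 : Euc n) rm ⊆
                (fun x => Matrix.toEuclideanLin ((h ^ (-(1 : ℝ) / 2)) • R) x) ''
                  {z : Euc n | u z < u 0 + h} ∧
              (fun x => Matrix.toEuclideanLin ((h ^ (-(1 : ℝ) / 2)) • R) x) ''
                  {z : Euc n | u z < u 0 + h} ⊆ Metric.ball (0 : Euc n) rp ∧
              Metric.ball (0 : Euc n) rp ⊆ Metric.ball (0 : Euc n) 2 ∧
              |rm ^ 2 / 2 - 1| ≤ C' * (δ / h + h ^ ((1 : ℝ) / 2)) ∧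
              |rp ^ 2 / 2 - 1| ≤ C' * (δ / h + h ^ ((1 : ℝ) / 2)) := by
  obtain ⟨K, r0, hK, hr0, hexp⟩ := expand_w n hn
  have hG := Gc_ge n
  have hCk : 0 < (n:ℝ) ^ 2 + 64 * K := by positivity
  set Ck := (n:ℝ) ^ 2 + 64 * K with hCkd
  have hC' : 0 < (2 + 2 * Gc n) * Ck := by positivity
  set C' := (2 + 2 * Gc n) * Ck with hC'd
  refine ⟨min 1 (1 / (8 * C')), min (1 / 8) (min ((r0 / 2) ^ 2) ((1 / (8 * C')) ^ 2)), C',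
    by positivity, min_le_left _ _, by positivity, (min_le_left _ _).trans (by norm_num), hC',
    min_le_left _ _, ?_⟩
  intro S ξ u w δ H h hh hhc hδ R hR hRR
  have hh8 : h ≤ 1 / 8 := hhc.trans (min_le_left _ _)
  have hhr : h ≤ (r0 / 2) ^ 2 := hhc.trans ((min_le_right _ _).trans (min_le_left _ _))
  have hhC : h ≤ (1 / (8 * C')) ^ 2 := hhc.trans ((min_le_right _ _).trans (min_le_right _ _))
  have hs0 : 0 < √h := Real.sqrt_pos.2 hh
  have hs2 : √h * √h = h := Real.mul_self_sqrt hh.le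
  have hsr : √h ≤ r0 / 2 := Real.sqrt_le_iff.2 ⟨by positivity, hhr⟩
  have hsC : √h ≤ 1 / (8 * C') := Real.sqrt_le_iff.2 ⟨by positivity, hhC⟩
  have hp1 : h ^ ((1:ℝ) / 2) = √h := (Real.sqrt_eq_rpow h).symm
  have hp2 : h ^ (-(1:ℝ) / 2) = (√h)⁻¹ := by
    rw [neg_div, Real.rpow_neg hh.le, hp1]
  have hdh0 : 0 ≤ δ / h := div_nonneg H.hδ hh.le
  have hdh : δ / h ≤ 1 / (8 * C') := by
    rw [div_le_iff₀ hh]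
    exact hδ.trans (mul_le_mul_of_nonneg_right (min_le_right _ _) hh.le)
  have hθ : C' * (δ / h + √h) ≤ 1 / 4 := by
    have : C' * (δ / h + √h) ≤ C' * (1 / (8 * C') + 1 / (8 * C')) := by gcongr
    refine this.trans (le_of_eq ?_)
    field_simp
    norm_num
  have hκ0 : 0 < Ck * (δ / h + √h) := by positivity
  have hθκ : C' * (δ / h + √h) = (2 + 2 * Gc n) * (Ck * (δ / h + √h)) := by rw [hC'd]; ring
  have hκ1 : Ck * (δ / h + √h) ≤ 1 / 16 := by
    have := mul_le_mul_of_nonneg_right (by linarith : (4:ℝ) ≤ 2 + 2 * Gc n) hκ0.le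
    linarith
  have hκ : (n:ℝ) ^ 2 * (δ / h) + 64 * K * √h ≤ Ck * (δ / h + √h) := by
    have h1 : 0 ≤ (n:ℝ) ^ 2 * √h := by positivity
    have h2 : 0 ≤ 64 * K * (δ / h) := by positivity
    rw [hCkd]; nlinarith
  rw [hess_eq] at hRR
  have hdetR : R.det ^ 2 = 1 := by
    rw [pow_two, ← Matrix.det_mul, hRR, H.wd 0 H.zero_mem]
  have hRu : IsUnit R.det := by
    rw [isUnit_iff_ne_zero]; intro h0; rw [h0] at hdetR; norm_num at hdetR
  have hRi : R * R⁻¹ = 1 := Matrix.mul_nonsing_inv R hRu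
  have hiR : R⁻¹ * R = 1 := Matrix.nonsing_inv_mul R hRu
  set P : Euc n →L[ℝ] Euc n := LinearMap.toContinuousLinearMap (Matrix.toEuclideanLin (√h • R⁻¹)) with hPdef
  have hPa : ∀ y, P y = Matrix.toEuclideanLin (√h • R⁻¹) y := fun y => rfl
  have hP : ∀ y, T2 w 0 (P y) (P y) = h * ‖y‖ ^ 2 := by
    intro y
    rw [sq_form _ hR hRR, hPa, toLin_mul_apply, Matrix.mul_smul, hRi, map_smul, LinearMap.smul_apply,
      toLin_one_apply, norm_smul, Real.norm_of_nonneg hs0.le, mul_pow, pow_two (√h), hs2]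
  have hcol : colM (fun i => P (stdB i)) = √h • R⁻¹ := by
    ext i j
    simp only [colM, Matrix.of_apply, hPa, stdB]
    simp [Matrix.toEuclideanLin, Matrix.toLpLin]
  have hPd : (colM (fun i => P (stdB i))).det ^ 2 = h ^ n := by
    have h1 : R⁻¹.det ^ 2 = 1 := by
      have := congrArg Matrix.det hRi
      rw [Matrix.det_mul, Matrix.det_one] at this
      have h2 : R.det ^ 2 * R⁻¹.det ^ 2 = 1 := by rw [← mul_pow, this, one_pow]
      rwa [hdetR, one_mul] at h2
    rw [hcol, Matrix.det_smul, Fintype.card_fin, mul_pow, h1, mul_one, ← pow_mul, mul_comm, pow_mul,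
      pow_two, hs2]
  have hest := core_est H hK (hexp S ξ u w δ H) hh (by linarith) (by linarith) P hP hPd hκ0 hκ1 hκ
  rw [← hθκ] at hest
  rw [hp1, hp2]
  refine core_sets H hh (by linarith [H.u0le]) (by positivity) (by linarith) P
    (fun x => Matrix.toEuclideanLin ((√h)⁻¹ • R) x) ?_ ?_ hest
  · intro y
    simp only [hPa]
    rw [toLin_mul_apply, Matrix.smul_mul, Matrix.mul_smul, hRi, smul_smul, inv_mul_cancel₀ hs0.ne',
      one_smul, toLin_one_apply]
  · intro y
    simp only [hPa]
    rw [toLin_mul_apply, Matrix.smul_mul, Matrix.mul_smul, hiR, smul_smul, mul_inv_cancel₀ hs0.ne',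
      one_smul, toLin_one_apply]

lemma make_setup {n : ℕ} (hn : 2 ≤ n) {L : ℝ} (hL : 0 < L) {ξ : Euc n} {u g w : Euc n → ℝ} {δ : ℝ}
    {S : Set (Euc n)} (hS : S = {z : Euc n | u z < u 0 + L})
    (hu : StrictConvexOn ℝ (closure S) u) (hu2 : ContDiffOn ℝ 2 u (closure S))
    (hb1 : Metric.ball ξ 1 ⊆ S) (hb2 : S ⊆ Metric.ball ξ (n : ℝ)) (hgr : gradient u 0 = 0)
    (hfr : ∀ z ∈ frontier S, u z = 0) (hdet : ∀ z ∈ S, hessDet u z = g z ^ n)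
    (hg : ∀ z ∈ S, |g z - 1| ≤ δ) (hδ : δ ≤ ((n : ℝ) ^ 2)⁻¹ / 5) (hw : ConvexOn ℝ S w)
    (hwsm : ContDiffOn ℝ (⊤ : ℕ∞) w S) (hwc : ContinuousOn w (closure S))
    (hwd : ∀ z ∈ S, hessDet w z = 1) (hwfr : ∀ z ∈ frontier S, w z = 0) :
    Setup n S ξ u w δ ∧ u 0 + L = 0 := by
  have h0S : (0 : Euc n) ∈ S := by
    rw [hS]; show u 0 < u 0 + L; linarith
  have hδ0 : 0 ≤ δ := (abs_nonneg _).trans (hg 0 h0S)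
  have hδ2 : δ ≤ 1 / 20 := by
    refine hδ.trans ?_
    have h2 : (2:ℝ) ≤ n := by exact_mod_cast hn
    have h4 : (4:ℝ) ≤ (n:ℝ) ^ 2 := by nlinarith
    have : ((n:ℝ) ^ 2)⁻¹ ≤ 4⁻¹ := by gcongr
    linarith
  have hdu : ∀ z ∈ S, (gramM (T2 u z) stdB).det = g z ^ n := by
    intro z hz; rw [← hess_eq]; exact hdet z hz
  have hgl : ∀ z ∈ S, 1 - δ ≤ g z ∧ g z ≤ 1 + δ := by
    intro z hz
    have := abs_le.1 (hg z hz)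
    constructor <;> linarith [this.1, this.2]
  have ho : IsOpen S := by
    refine S_open hn hS hu.1 hb1 hfr fun z hz => ?_
    rw [hdu z hz]
    exact (pow_pos (by linarith [(hgl z hz).1]) n).ne'
  have huL := uL_zero hn hS hu2.continuousOn hb1 hb2 hfr ho
  refine ⟨⟨hn, ho, hw.1, ?_, ?_, hu.convexOn, hu2.continuousOn, ?_, hb1, hb2, hfr, hwfr, ?_, hδ0, hδ2,
    ?_, ?_, hw, hwsm, hwc, ?_⟩, huL⟩
  · rw [hS, huL]
  · linarith
  · intro x hx
    exact hu2.contDiffAt (mem_of_superset (ho.mem_nhds hx) subset_closure)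
  · simpa [gradient] using hgr
  · intro x hx
    rw [hdu x hx]
    exact pow_le_pow_left₀ (by linarith) (hgl x hx).1 n
  · intro x hx
    rw [hdu x hx]
    exact pow_le_pow_left₀ (by linarith [(hgl x hx).1]) (hgl x hx).2 n
  · intro x hx; rw [← hess_eq]; exact hwd x hx

end Part18

end QuasiNorm

/-- Second part of the perturbation lemma for sections: with the same set-up, if
`0 < h ≤ h_c` and `δ ≤ min{C₄h, n^{−2}/5}`, then `S(u,h) ⊆ S(u,L/2)` and the map
`T x = h^{−1/2}(D²w(0))^{1/2} x` (with `R` the positive semidefinite square root of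
`D²w(0)`) satisfies `B₁ ⊆ B_{r₋} ⊆ T S(u,h) ⊆ B_{r₊} ⊆ B₂` with
`|r_±²/2 − 1| ≤ C′(δ/h + h^{1/2})`. -/
theorem section_perturbation_quasi_normalisation (n : ℕ) (hn : 2 ≤ n) :
    ∃ C₄ hc C' : ℝ, 0 < C₄ ∧ C₄ ≤ 1 ∧ 0 < hc ∧ hc ≤ 1 / 5 ∧ 0 < C' ∧
      ∀ (L : ℝ) (_ : 0 < L) (ξ : Euc n) (u g w : Euc n → ℝ) (δ : ℝ),
        StrictConvexOn ℝ (closure {z : Euc n | u z < u 0 + L}) u →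
        ContDiffOn ℝ 2 u (closure {z : Euc n | u z < u 0 + L}) →
        Metric.ball ξ 1 ⊆ {z : Euc n | u z < u 0 + L} →
        {z : Euc n | u z < u 0 + L} ⊆ Metric.ball ξ (n : ℝ) →
        gradient u 0 = 0 →
        (∀ z ∈ frontier {z : Euc n | u z < u 0 + L}, u z = 0) →
        (∀ z ∈ {z : Euc n | u z < u 0 + L}, hessDet u z = g z ^ n) →
        g 0 = 1 →
        (∀ z ∈ {z : Euc n | u z < u 0 + L}, |g z - 1| ≤ δ) →
        δ ≤ ((n : ℝ) ^ 2)⁻¹ / 5 →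
        ConvexOn ℝ {z : Euc n | u z < u 0 + L} w →
        ContDiffOn ℝ (⊤ : ℕ∞) w {z : Euc n | u z < u 0 + L} →
        ContinuousOn w (closure {z : Euc n | u z < u 0 + L}) →
        (∀ z ∈ {z : Euc n | u z < u 0 + L}, hessDet w z = 1) →
        (∀ z ∈ frontier {z : Euc n | u z < u 0 + L}, w z = 0) →
        ∀ h : ℝ, 0 < h → h ≤ hc → δ ≤ min (C₄ * h) (((n : ℝ) ^ 2)⁻¹ / 5) →
          ({z : Euc n | u z < u 0 + h} ⊆ {z : Euc n | u z < u 0 + L / 2}) ∧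
          ∀ R : Matrix (Fin n) (Fin n) ℝ, R.PosSemidef → R * R = hessianMatrix w 0 →
            ∃ rm rp : ℝ,
              Metric.ball (0 : Euc n) 1 ⊆ Metric.ball (0 : Euc n) rm ∧
              Metric.ball (0 : Euc n) rm ⊆
                (fun x => Matrix.toEuclideanLin ((h ^ (-(1 : ℝ) / 2)) • R) x) ''
                  {z : Euc n | u z < u 0 + h} ∧
              (fun x => Matrix.toEuclideanLin ((h ^ (-(1 : ℝ) / 2)) • R) x) ''
                  {z : Euc n | u z < u 0 + h} ⊆ Metric.ball (0 : Euc n) rp ∧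
              Metric.ball (0 : Euc n) rp ⊆ Metric.ball (0 : Euc n) 2 ∧
              |rm ^ 2 / 2 - 1| ≤ C' * (δ / h + h ^ ((1 : ℝ) / 2)) ∧
              |rp ^ 2 / 2 - 1| ≤ C' * (δ / h + h ^ ((1 : ℝ) / 2)) := by
  obtain ⟨C₄, hc, C', h1, h2, h3, h4, h5, h6, h7⟩ := final_aux n hn
  refine ⟨C₄, hc, C', h1, h2, h3, h4, h5, ?_⟩
  intro L hL ξ u g w δ hu hu2 hb1 hb2 hgr hfr hdet _ hg hδ hw hwsm hwc hwd hwfr h hh hhc hδ2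
  obtain ⟨H, huL⟩ := make_setup hn hL rfl hu hu2 hb1 hb2 hgr hfr hdet hg hδ hw hwsm hwc hwd hwfr
  refine ⟨fun z hz => ?_, h7 _ ξ u w δ H h hh hhc (hδ2.trans (min_le_left _ _))⟩
  have hz1 : u z < u 0 + h := hz
  show u z < u 0 + L / 2
  linarith [H.u0le]
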